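/- arXiv:2503.09741 — 2 statements merged into one kernel-verified Lean document; each statement's English description precedes it below -/
import Mathlib

section
/- Suppose χ₁ and χ₂ are odd quadratic characters (χ₁(−1) = χ₂(−1) = −1) with q₁, q₂ > 4 odd. Let γ = (a, b; r·q₁q₂, d) ∈ Γ₀(q₁q₂) with r ≥ 1, and let γ' = (d, −r; −b·q₁q₂, a). Then S_{χ₁,χ₂}(γ) = −S_{χ₂,χ₁}(γ') + (1 − ψ(γ)) · h(−q₁) · h(−q₂), where h(−q) denotes the class number of the imaginary quadratic number field ℚ(√−q). -/
open Complex Finset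
open scoped Classical

/-- The sawtooth function `B₁(x)`: `0` if `x ∈ ℤ`, and `x - ⌊x⌋ - 1/2` otherwise. -/
noncomputable def sawtooth (x : ℝ) : ℝ :=
  if ∃ n : ℤ, (n : ℝ) = x then 0 else Int.fract x - 1 / 2

/-- The newform Dedekind sum `S_{χ₁,χ₂}(a, c)` associated to Dirichlet characters
`χ₁ mod q₁` and `χ₂ mod q₂`. -/
noncomputable def newformDedekindSum {q₁ q₂ : ℕ} (χ₁ : DirichletCharacter ℂ q₁)
    (χ₂ : DirichletCharacter ℂ q₂) (a c : ℤ) : ℂ :=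
  ∑ j ∈ Finset.range c.toNat, ∑ n ∈ Finset.range q₁,
    (starRingEnd ℂ) (χ₂ (j : ZMod q₂)) * (starRingEnd ℂ) (χ₁ (n : ZMod q₁)) *
      (sawtooth ((j : ℝ) / (c : ℝ)) : ℂ) *
      (sawtooth ((n : ℝ) / (q₁ : ℝ) + (a : ℝ) * (j : ℝ) / (c : ℝ)) : ℂ)

/-- The newform Dedekind sum of a matrix `γ = (a, b; c, d) ∈ SL₂(ℤ)`:
it is `S_{χ₁,χ₂}(a, c)` if `c ≥ 1`, `S_{χ₁,χ₂}(-γ)` if `c ≤ -1`, and `0` if `c = 0`. -/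
noncomputable def newformDedekindSumSL {q₁ q₂ : ℕ} (χ₁ : DirichletCharacter ℂ q₁)
    (χ₂ : DirichletCharacter ℂ q₂) (γ : Matrix.SpecialLinearGroup (Fin 2) ℤ) : ℂ :=
  if γ.1 1 0 = 0 then 0
  else if 1 ≤ γ.1 1 0 then newformDedekindSum χ₁ χ₂ (γ.1 0 0) (γ.1 1 0)
  else newformDedekindSum χ₁ χ₂ (-(γ.1 0 0)) (-(γ.1 1 0))

/-- Membership in `Γ₀(N)`: the lower-left entry is divisible by `N`. -/
def InGamma0 (N : ℕ) (γ : Matrix.SpecialLinearGroup (Fin 2) ℤ) : Prop :=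
  (N : ℤ) ∣ γ.1 1 0

/-- Membership in `Γ₁(N)`: lower-left entry divisible by `N` and both diagonal
entries congruent to `1` mod `N`. -/
def InGamma1 (N : ℕ) (γ : Matrix.SpecialLinearGroup (Fin 2) ℤ) : Prop :=
  InGamma0 N γ ∧ (N : ℤ) ∣ (γ.1 0 0 - 1) ∧ (N : ℤ) ∣ (γ.1 1 1 - 1)

/-- `x` lies in the ring of integers `ℤ[χ₁,χ₂]` of the field `F_{χ₁,χ₂} ⊆ ℂ` generated
by the values of `χ₁` and `χ₂`: `x` lies in the subfield of `ℂ` generated by the values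
of the characters and is integral over `ℤ`. -/
def InRingOfIntegers {q₁ q₂ : ℕ} (χ₁ : DirichletCharacter ℂ q₁)
    (χ₂ : DirichletCharacter ℂ q₂) (x : ℂ) : Prop :=
  x ∈ Subfield.closure (Set.range (χ₁ : ZMod q₁ → ℂ) ∪ Set.range (χ₂ : ZMod q₂ → ℂ)) ∧
    IsIntegral ℤ x

open IntermediateField in
/-- The class number `h(-q)` of the imaginary quadratic field `ℚ(√-q)`. -/
noncomputable def imagQuadClassNumber (q : ℕ) : ℕ :=
  Nat.card (ClassGroup (NumberField.RingOfIntegers ℚ⟮(Complex.I * (Real.sqrt q : ℂ) : ℂ)⟯))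

lemma ofReal_mul_cpow {T : ℝ} (hT : 0 < T) {w : ℂ} (hw : w ≠ 0) (s : ℂ) :
    ((T : ℂ) * w) ^ s = (T : ℂ) ^ s * w ^ s := by
  have hT' : (T : ℂ) ≠ 0 := by exact_mod_cast hT.ne'
  rw [cpow_def_of_ne_zero (mul_ne_zero hT' hw), cpow_def_of_ne_zero hT', cpow_def_of_ne_zero hw,
    log_ofReal_mul hT hw, ofReal_log hT.le, ← Complex.exp_add, add_mul]

lemma inv_re_pos {a : ℂ} (ha : 0 < a.re) : 0 < (a⁻¹).re := by
  rw [inv_re]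
  have : a ≠ 0 := by rintro rfl; simp at ha
  exact div_pos ha (normSq_pos.mpr this)

lemma summable_shifted_gaussian {a : ℂ} (ha : 0 < a.re) (s : ℝ) :
    Summable fun k : ℤ ↦ cexp (-Real.pi / a * (k + s) ^ 2) := by
  have h : 0 < (I * a⁻¹).im := by simpa using inv_re_pos ha
  refine (((summable_jacobiTheta₂_term_iff (I * s / a) (I * a⁻¹)).mpr h).mul_left
    (cexp (-Real.pi / a * s ^ 2))).congr fun k ↦ ?_
  rw [jacobiTheta₂_term, ← Complex.exp_add]
  congr 1
  ring_nf
  simp only [I_sq]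
  ring

lemma tsum_shifted_gaussian {a : ℂ} (ha : 0 < a.re) (s : ℝ) :
    ∑' k : ℤ, cexp (-Real.pi / a * (k + s) ^ 2) = a ^ (1 / 2 : ℂ) *
      ∑' n : ℤ, cexp (-Real.pi * a * n ^ 2 + 2 * Real.pi * (-I * s) * n) := by
  have h := Complex.tsum_exp_neg_quadratic ha (-I * s)
  have e : I * (-I * s) = s := by rw [← mul_assoc, mul_neg, I_mul_I, neg_neg, one_mul]
  rw [e] at h
  rw [h, ← mul_assoc, mul_one_div, div_self, one_mul]
  rw [Ne, cpow_eq_zero_iff]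
  rintro ⟨rfl, -⟩
  simp at ha

lemma tendsto_tsum_gaussian_one {a : ℝ → ℂ} {l : Filter ℝ}
    (ha : Filter.Tendsto (fun T ↦ (a T).re) l Filter.atTop) (s : ℝ) :
    Filter.Tendsto (fun T ↦
      ∑' n : ℤ, cexp (-Real.pi * a T * n ^ 2 + 2 * Real.pi * (-I * s) * n)) l (nhds 1) := by
  have hn (z : ℂ) (n : ℤ) : ‖cexp (-Real.pi * z * n ^ 2 + 2 * Real.pi * (-I * s) * n)‖ =
      Real.exp (-Real.pi * z.re * n ^ 2) := by
    rw [norm_exp]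
    congr 1
    simp [-ofReal_intCast, pow_two]
  have hg : (∑' n : ℤ, if n = 0 then (1 : ℂ) else 0) = 1 := by simp
  rw [← hg]
  refine tendsto_tsum_of_dominated_convergence (bound := fun n : ℤ ↦ Real.exp (-Real.pi * n ^ 2))
    ?_ ?_ ?_
  · have := (summable_shifted_gaussian (a := 1) (by simp) 0).norm
    refine this.congr fun n ↦ ?_
    rw [norm_exp]
    congr 1
    simp [-ofReal_intCast, pow_two]
  · intro n
    split_ifs with h
    · subst h
      simp only [Int.cast_zero]
      simpa using tendsto_const_nhds
    · rw [tendsto_zero_iff_norm_tendsto_zero]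
      simp only [hn]
      refine Real.tendsto_exp_atBot.comp ?_
      have h2 : (0 : ℝ) < Real.pi * n ^ 2 := by
        have : (n : ℝ) ≠ 0 := by exact_mod_cast h
        positivity
      have := Filter.tendsto_neg_atTop_atBot.comp (ha.atTop_mul_const h2)
      refine this.congr fun T ↦ ?_
      simp only [Function.comp]
      ring
  · filter_upwards [ha.eventually_ge_atTop 1] with T hT n
    rw [hn]
    refine Real.exp_le_exp.mpr ?_
    have : (0 : ℝ) ≤ Real.pi * n ^ 2 := by positivity
    nlinarith

lemma tsum_mul_residue {N : ℕ} [NeZero N] {f E : ℤ → ℂ} (hf : ∀ m k : ℤ, f (m + k * N) = f m)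
    (hE : Summable E) (hfE : Summable fun m ↦ f m * E m) :
    ∑' m, f m * E m = ∑ r : Fin N, f r * ∑' k : ℤ, E (k * N + r) := by
  have h0 : Summable fun x : ℤ × Fin N ↦ E (x.1 * N + x.2) :=
    ((Int.divModEquiv N).symm.summable_iff.mpr hE).congr fun x ↦ by simp [Int.divModEquiv]
  have h1 : Summable fun x : ℤ × Fin N ↦ f (x.1 * N + x.2) * E (x.1 * N + x.2) :=
    ((Int.divModEquiv N).symm.summable_iff.mpr hfE).congr fun x ↦ by simp [Int.divModEquiv]
  have h2 : Summable fun x : Fin N × ℤ ↦ f (x.2 * N + x.1) * E (x.2 * N + x.1) :=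
    (Equiv.prodComm (Fin N) ℤ).summable_iff.mpr h1
  rw [← (Int.divModEquiv N).symm.tsum_eq]
  have : ∀ x : ℤ × Fin N, f ((Int.divModEquiv N).symm x) * E ((Int.divModEquiv N).symm x)
      = f (x.1 * N + x.2) * E (x.1 * N + x.2) := fun x ↦ by simp [Int.divModEquiv]
  rw [tsum_congr this, ← (Equiv.prodComm _ _).tsum_eq]
  refine (h2.tsum_prod).trans ?_
  rw [tsum_fintype]
  refine Finset.sum_congr rfl fun r _ ↦ ?_
  rw [← tsum_mul_left]
  refine tsum_congr fun k ↦ ?_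
  have := hf r k
  rw [add_comm] at this
  simp only [this]

lemma norm_exp_two_pi_I_mul (x : ℝ) : ‖cexp (2 * Real.pi * I * x)‖ = 1 := by
  rw [norm_exp]; simp

lemma summable_mul_of_norm_le_one {f E : ℤ → ℂ} (hf : ∀ m, ‖f m‖ ≤ 1) (hE : Summable E) :
    Summable fun m ↦ f m * E m := by
  refine Summable.of_norm_bounded hE.norm fun m ↦ ?_
  rw [norm_mul]
  exact mul_le_of_le_one_left (norm_nonneg _) (hf m)

lemma tendsto_shifted_gaussian_div {a : ℝ → ℂ} (c : ℂ)
    (ha : ∀ T : ℝ, a T = T + c) (s : ℝ) :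
    Filter.Tendsto (fun T : ℝ ↦
      (∑' k : ℤ, cexp (-Real.pi / a T * (k + s) ^ 2)) / (T : ℂ) ^ (1 / 2 : ℂ)) Filter.atTop
      (nhds 1) := by
  have hre : Filter.Tendsto (fun T ↦ (a T).re) Filter.atTop Filter.atTop := by
    simp only [ha, add_re, ofReal_re]
    exact Filter.tendsto_atTop_add_const_right _ _ Filter.tendsto_id
  have h1 : Filter.Tendsto (fun T : ℝ ↦ (1 + c * (T⁻¹ : ℝ)) ^ (1 / 2 : ℂ)) Filter.atTop
      (nhds 1) := by
    have h0 : Filter.Tendsto (fun T : ℝ ↦ 1 + c * ((T⁻¹ : ℝ) : ℂ)) Filter.atTop (nhds 1) := by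
      have := (continuous_ofReal.tendsto 0).comp tendsto_inv_atTop_zero
      simpa using (this.const_mul c).const_add 1
    have := h0.cpow tendsto_const_nhds (b := (1 / 2 : ℂ)) (Or.inl (by simp))
    simpa using this
  have h2 := h1.mul (tendsto_tsum_gaussian_one hre s)
  rw [mul_one] at h2
  refine h2.congr' ?_
  filter_upwards [hre.eventually_gt_atTop 0, Filter.eventually_gt_atTop 0] with T hT hT0
  have hT' : (T : ℂ) ≠ 0 := by exact_mod_cast hT0.ne'
  have e : a T = T * (1 + c * (T⁻¹ : ℝ)) := by
    rw [ha]; push_cast; field_simp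
  have hne : a T ≠ 0 := by rintro h; rw [h] at hT; simp at hT
  rw [tsum_shifted_gaussian hT]
  have : (a T) ^ (1 / 2 : ℂ) = (T : ℂ) ^ (1 / 2 : ℂ) * (1 + c * (T⁻¹ : ℝ)) ^ (1 / 2 : ℂ) := by
    rw [e]
    exact ofReal_mul_cpow hT0 (right_ne_zero_of_mul (e ▸ hne)) _
  rw [this]
  have h3 : (T : ℂ) ^ (1 / 2 : ℂ) ≠ 0 := by
    rw [Ne, cpow_eq_zero_iff]; tauto
  field_simp

lemma theta_identity {p : ℕ} (hp : 0 < p) {T : ℝ} (hT : 0 < T) :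
    ∑ r : Fin p, cexp (2 * Real.pi * I * ((r : ℕ) ^ 2 / p : ℝ)) *
      ∑' k : ℤ, cexp (-Real.pi / (T + (-I / (2 * p))) * (k + ((r : ℕ) / p : ℝ)) ^ 2) =
    1 / (-4 * I * T / (2 * p * T - I)) ^ (1 / 2 : ℂ) *
      ∑ r : Fin 2, cexp (-Real.pi * I * p * (r : ℕ) ^ 2 / 2) *
        ∑' k : ℤ, cexp (-Real.pi / (T + 0) * (k + ((r : ℕ) / (2 : ℕ) : ℝ)) ^ 2) := by
  have hp' : (p : ℂ) ≠ 0 := by exact_mod_cast hp.ne'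
  have hT' : (T : ℂ) ≠ 0 := by exact_mod_cast hT.ne'
  have : NeZero p := ⟨hp.ne'⟩
  have hd : (2 * p * T - I : ℂ) ≠ 0 := by
    intro h
    have := congrArg Complex.im h
    simp at this
  set A : ℂ := -4 * I * T / (2 * p * T - I) with hA
  have hA0 : A ≠ 0 := by
    rw [hA]; exact div_ne_zero (by simp [hT']) hd
  have hAinv : A⁻¹ = I * p / 2 + 1 / (4 * T) := by
    rw [hA]; field_simp; ring_nf; simp only [I_sq]; ring
  have hAre : 0 < A.re := by
    have : 0 < (A⁻¹).re := by
      rw [hAinv]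
      have : (I * p / 2 + 1 / (4 * T) : ℂ) = ((1 / (4 * T) : ℝ) : ℂ) + ((p / 2 : ℝ) : ℂ) * I := by
        push_cast; ring
      rw [this]; simp; positivity
    simpa using inv_re_pos this
  have ha1 : (T + (-I / (2 * p)) : ℂ) = (2 * p * T - I) / (2 * p) := by
    field_simp
    ring
  have ha1' : (T + (-I / (2 * p)) : ℂ) = T + ((-(1 / (2 * p)) : ℝ) : ℂ) * I := by
    push_cast; ring
  have ha10 : (T + (-I / (2 * p)) : ℂ) ≠ 0 := by
    rw [ha1]; exact div_ne_zero hd (by simpa using hp.ne')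
  set a1 : ℂ := T + (-I / (2 * p)) with ha1def
  have hP := Complex.tsum_exp_neg_quadratic hAre 0
  simp only [mul_zero, zero_mul, add_zero] at hP ⊢
  have hS1 : Summable fun m : ℤ ↦ cexp (-Real.pi / (p ^ 2 * a1) * m ^ 2) := by
    have h := summable_shifted_gaussian (a := p ^ 2 * a1) (by
      rw [ha1']
      have : (p ^ 2 * (T + ((-(1 / (2 * p)) : ℝ) : ℂ) * I) : ℂ) = ((p ^ 2 * T : ℝ) : ℂ) +
        ((p ^ 2 * -(1 / (2 * p)) : ℝ) : ℂ) * I := by push_cast; ring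
      rw [this]
      simp only [add_re, ofReal_re, re_ofReal_mul, I_re, mul_zero, add_zero]
      positivity) 0
    simpa using h
  have hS2 : Summable fun m : ℤ ↦ cexp (-Real.pi / (4 * T) * m ^ 2) := by
    have h := summable_shifted_gaussian (a := ((4 * T : ℝ) : ℂ)) (by
      rw [ofReal_re]; positivity) 0
    simpa using h
  have hf1 (m k : ℤ) : cexp (2 * Real.pi * I * ((m + k * p : ℤ) ^ 2 / p : ℝ)) =
      cexp (2 * Real.pi * I * (m ^ 2 / p : ℝ)) := by
    refine Complex.exp_eq_exp_iff_exists_int.mpr ⟨2 * m * k + k ^ 2 * p, ?_⟩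
    push_cast
    field_simp
    ring
  have hf2 (m k : ℤ) : cexp (2 * Real.pi * I * (-(p * (m + k * (2 : ℕ) : ℤ) ^ 2 / 4) : ℝ)) =
      cexp (2 * Real.pi * I * (-(p * m ^ 2 / 4) : ℝ)) := by
    refine Complex.exp_eq_exp_iff_exists_int.mpr ⟨-p * (m * k + k ^ 2), ?_⟩
    push_cast
    field_simp
    ring
  have e1 (m : ℤ) : cexp (-Real.pi * A * m ^ 2) = cexp (2 * Real.pi * I * (m ^ 2 / p : ℝ)) *
      cexp (-Real.pi / (p ^ 2 * a1) * m ^ 2) := by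
    rw [← Complex.exp_add]
    congr 1
    have key : A = 2 * I * (-1 / p) + 1 / (p ^ 2 * a1) := by
      have : 1 / (p ^ 2 * a1) = 2 / (p * (2 * p * T - I)) := by
        rw [ha1]; field_simp
      rw [this, hA, div_eq_iff hd, add_mul]
      have : 2 / (p * (2 * p * T - I)) * (2 * p * T - I) = 2 / p := by
        field_simp
      rw [this]
      field_simp
      linear_combination -2 * I_sq
    rw [key]
    push_cast
    ring
  have e2 (m : ℤ) : cexp (-Real.pi / A * m ^ 2) =
      cexp (2 * Real.pi * I * (-(p * m ^ 2 / 4) : ℝ)) *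
      cexp (-Real.pi / (4 * T) * m ^ 2) := by
    rw [← Complex.exp_add]
    congr 1
    rw [div_eq_mul_inv, hAinv]
    push_cast
    field_simp
    ring
  rw [tsum_congr e1, tsum_congr e2, tsum_mul_residue hf1 hS1
    (summable_mul_of_norm_le_one (fun m ↦ (norm_exp_two_pi_I_mul _).le) hS1),
    tsum_mul_residue hf2 hS2
    (summable_mul_of_norm_le_one (fun m ↦ (norm_exp_two_pi_I_mul _).le) hS2)] at hP
  refine (Finset.sum_congr rfl fun r _ ↦ ?_).trans (hP.trans (congrArg _
    (Finset.sum_congr rfl fun r _ ↦ ?_)))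
  · congr 1
    refine tsum_congr fun k ↦ ?_
    congr 1
    push_cast
    field_simp
  · congr 1
    · congr 1
      push_cast; ring
    · refine tsum_congr fun k ↦ ?_
      congr 1
      push_cast
      field_simp
      ring

lemma gauss_sum_sq {p : ℕ} (hp : 0 < p) :
    ∑ r : Fin p, cexp (2 * Real.pi * I * ((r : ℕ) ^ 2 / p : ℝ)) =
      Real.sqrt p * (1 + (-I) ^ p) / (1 - I) := by
  have hp' : (p : ℂ) ≠ 0 := by exact_mod_cast hp.ne'
  have hL : Filter.Tendsto (fun T : ℝ ↦
      (∑ r : Fin p, cexp (2 * Real.pi * I * ((r : ℕ) ^ 2 / p : ℝ)) *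
      ∑' k : ℤ, cexp (-Real.pi / (T + (-I / (2 * p))) * (k + ((r : ℕ) / p : ℝ)) ^ 2)) /
        (T : ℂ) ^ (1 / 2 : ℂ)) Filter.atTop
      (nhds (∑ r : Fin p, cexp (2 * Real.pi * I * ((r : ℕ) ^ 2 / p : ℝ)) * 1)) := by
    simp only [Finset.sum_div, mul_div_assoc]
    exact tendsto_finsetSum _ fun r _ ↦
      (tendsto_shifted_gaussian_div (-I / (2 * p)) (fun _ ↦ rfl) _).const_mul _
  have hR : Filter.Tendsto (fun T : ℝ ↦
      (∑ r : Fin 2, cexp (-Real.pi * I * p * (r : ℕ) ^ 2 / 2) *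
        ∑' k : ℤ, cexp (-Real.pi / (T + 0) * (k + ((r : ℕ) / (2 : ℕ) : ℝ)) ^ 2)) /
        (T : ℂ) ^ (1 / 2 : ℂ)) Filter.atTop
      (nhds (∑ r : Fin 2, cexp (-Real.pi * I * p * (r : ℕ) ^ 2 / 2) * 1)) := by
    simp only [Finset.sum_div, mul_div_assoc]
    exact tendsto_finsetSum _ fun r _ ↦
      (tendsto_shifted_gaussian_div 0 (fun _ ↦ rfl) _).const_mul _
  have hA : Filter.Tendsto (fun T : ℝ ↦ -4 * I * T / (2 * p * T - I)) Filter.atTop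
      (nhds (-2 * I / p)) := by
    have h0 : Filter.Tendsto (fun T : ℝ ↦ -4 * I / (2 * p - I * ((T⁻¹ : ℝ) : ℂ))) Filter.atTop
        (nhds (-4 * I / (2 * p - I * (0 : ℝ)))) :=
      tendsto_const_nhds.div (tendsto_const_nhds.sub (((continuous_ofReal.tendsto 0).comp
        tendsto_inv_atTop_zero).const_mul I)) (by simpa using hp.ne')
    have e : (-4 * I / (2 * p - I * (0 : ℝ)) : ℂ) = -2 * I / p := by
      simp only [ofReal_zero, mul_zero, sub_zero]
      field_simp
      norm_num
    rw [e] at h0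
    refine h0.congr' ?_
    filter_upwards [Filter.eventually_gt_atTop 0] with T hT
    have hT' : (T : ℂ) ≠ 0 := by exact_mod_cast hT.ne'
    rw [← mul_div_mul_right _ _ hT']
    congr 1
    push_cast
    field_simp
  have hs : (Real.sqrt p : ℂ) ≠ 0 := by
    have : Real.sqrt p ≠ 0 := (Real.sqrt_pos.mpr (by exact_mod_cast hp)).ne'
    exact_mod_cast this
  have hs2 : (Real.sqrt p : ℂ) ^ 2 = p := by
    rw [← ofReal_pow, Real.sq_sqrt (by positivity)]; simp
  have hz : (-2 * I / p : ℂ) ^ (1 / 2 : ℂ) = (1 - I) / Real.sqrt p := by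
    have h := sq_cpow_two_inv (x := (1 - I) / Real.sqrt p) (by
      rw [div_ofReal_re]
      simp only [sub_re, one_re, I_re, sub_zero]
      have : 0 < Real.sqrt p := Real.sqrt_pos.mpr (by exact_mod_cast hp)
      positivity)
    rw [div_pow, hs2] at h
    rw [← h]
    congr 1
    · congr 1
      ring_nf
      simp only [I_sq]
      ring
    · norm_num
  have hA' : Filter.Tendsto (fun T : ℝ ↦ 1 / (-4 * I * T / (2 * p * T - I)) ^ (1 / 2 : ℂ))
      Filter.atTop (nhds (1 / ((1 - I) / Real.sqrt p))) := by
    rw [← hz]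
    refine tendsto_const_nhds.div (hA.cpow tendsto_const_nhds ?_) ?_
    · refine Or.inr ?_
      rw [show (-2 * I / p : ℂ) = ((-2 / p : ℝ) : ℂ) * I by push_cast; ring]
      simp
      exact hp.ne'
    · rw [hz]
      refine div_ne_zero ?_ hs
      intro h
      have := congrArg Complex.re h
      simp at this
  have := tendsto_nhds_unique_of_eventuallyEq hL (hA'.mul hR) (by
    filter_upwards [Filter.eventually_gt_atTop 0] with T hT
    rw [theta_identity hp hT, mul_div_assoc])
  simp only [mul_one] at this
  rw [this, Fin.sum_univ_two]
  have e2 : cexp (-Real.pi * I * p * ((1 : Fin 2) : ℕ) ^ 2 / 2) = (-I) ^ p := by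
    rw [← Complex.exp_neg_pi_div_two_mul_I, ← Complex.exp_nat_mul]
    congr 1
    simp
    ring
  rw [e2]
  simp
  ring

lemma gauss_sum_sq_three {p : ℕ} (h : p % 4 = 3) :
    ∑ r : Fin p, cexp (2 * Real.pi * I * ((r : ℕ) ^ 2 / p : ℝ)) = I * Real.sqrt p := by
  rw [gauss_sum_sq (by omega)]
  have : (-I) ^ p = I := by
    rw [← Nat.div_add_mod p 4, h, pow_add, pow_mul]
    simp [pow_succ]
  have h2 : (1 - I : ℂ) ≠ 0 := by
    intro h
    have := congrArg Complex.re h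
    simp at this
  rw [this, div_eq_iff h2]
  ring_nf
  simp only [I_sq]
  ring

lemma jacobiSym_val_castHom {m n : ℕ} [NeZero m] [NeZero n] (h : m ∣ n) (z : ZMod n) :
    jacobiSym (z.val : ℤ) m = jacobiSym ((ZMod.castHom h (ZMod m) z).val : ℤ) m := by
  rw [jacobiSym.mod_left, jacobiSym.mod_left ((ZMod.castHom h (ZMod m) z).val : ℤ)]
  congr 1
  rw [← Int.ModEq, ← ZMod.intCast_eq_intCast_iff]
  simp

lemma stdAddChar_chinese {m n : ℕ} [NeZero m] [NeZero n] (h : m.Coprime n) :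
    ∃ (u : (ZMod m)ˣ) (v : (ZMod n)ˣ), ∀ z : ZMod (m * n), ZMod.stdAddChar z =
      ZMod.stdAddChar ((u : ZMod m) * (ZMod.castHom (dvd_mul_right m n) (ZMod m) z)) *
      ZMod.stdAddChar ((v : ZMod n) * (ZMod.castHom (dvd_mul_left n m) (ZMod n) z)) := by
  obtain ⟨U, V, hUV⟩ := (Nat.isCoprime_iff_coprime.mpr h)
  have hv : IsUnit (U : ZMod n) := by
    refine IsUnit.of_mul_eq_one (m : ZMod n) ?_
    have := congrArg (Int.cast : ℤ → ZMod n) hUV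
    simpa using this
  have hu : IsUnit (V : ZMod m) := by
    refine IsUnit.of_mul_eq_one (n : ZMod m) ?_
    have := congrArg (Int.cast : ℤ → ZMod m) hUV
    simpa using this
  refine ⟨hu.unit, hv.unit, fun z ↦ ?_⟩
  obtain ⟨j, rfl⟩ := ZMod.intCast_surjective z
  simp only [IsUnit.unit_spec, map_intCast, ← Int.cast_mul, ZMod.stdAddChar_coe]
  rw [← Complex.exp_add]
  congr 1
  have hm : (m : ℂ) ≠ 0 := NeZero.ne _
  have hn : (n : ℂ) ≠ 0 := NeZero.ne _
  have hUV' : (U * m + V * n : ℂ) = 1 := by exact_mod_cast hUV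
  push_cast
  field_simp
  linear_combination -j * hUV'

lemma sum_jacobiSym_mul_stdAddChar_prime {p : ℕ} [Fact p.Prime] (hp : p ≠ 2) (a : (ZMod p)ˣ) :
    ∑ x : ZMod p, (jacobiSym (x.val : ℤ) p : ℂ) * ZMod.stdAddChar ((a : ZMod p) * x) =
      ∑ x : ZMod p, ZMod.stdAddChar ((a : ZMod p) * x ^ 2) := by
  have h1 (x : ZMod p) : jacobiSym (x.val : ℤ) p = quadraticChar (ZMod p) x := by
    rw [← jacobiSym.legendreSym.to_jacobiSym, legendreSym]
    simp
  have h0 : ∑ x : ZMod p, ZMod.stdAddChar ((a : ZMod p) * x) = 0 := by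
    have := AddChar.sum_mulShift (a : ZMod p) (ZMod.isPrimitive_stdAddChar p)
    simpa [mul_comm] using this
  have h2 : ∑ x : ZMod p, ZMod.stdAddChar ((a : ZMod p) * x ^ 2) =
      ∑ y : ZMod p, ∑ x ∈ univ.filter (fun x : ZMod p ↦ x ^ 2 = y),
        ZMod.stdAddChar ((a : ZMod p) * y) := by
    rw [← Finset.sum_fiberwise (s := univ) (g := fun x : ZMod p ↦ x ^ 2)]
    refine Finset.sum_congr rfl fun y _ ↦ Finset.sum_congr rfl fun x hx ↦ ?_
    rw [(Finset.mem_filter.mp hx).2]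
  have h3 (y : ZMod p) : ((univ.filter (fun x : ZMod p ↦ x ^ 2 = y)).card : ℂ) =
      (quadraticChar (ZMod p) y : ℂ) + 1 := by
    have := quadraticChar_card_sqrts (F := ZMod p) (by rwa [ZMod.ringChar_zmod_n]) y
    have h4 : ({x : ZMod p | x ^ 2 = y}.toFinset) = univ.filter (fun x : ZMod p ↦ x ^ 2 = y) := by
      ext; simp
    rw [h4] at this
    exact_mod_cast this
  rw [h2]
  simp only [Finset.sum_const, nsmul_eq_mul, h3, add_mul, one_mul, Finset.sum_add_distrib, h0,
    add_zero, h1]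

lemma sum_chinese {m n : ℕ} [NeZero m] [NeZero n] (h : m.Coprime n) (f : ZMod m → ℂ)
    (g : ZMod n → ℂ) :
    ∑ z : ZMod (m * n), f (ZMod.castHom (dvd_mul_right m n) (ZMod m) z) *
      g (ZMod.castHom (dvd_mul_left n m) (ZMod n) z) = (∑ x, f x) * ∑ y, g y := by
  rw [Finset.sum_mul_sum, ← Finset.sum_product', Finset.univ_product_univ]
  refine Fintype.sum_equiv (ZMod.chineseRemainder h).toEquiv _ _ fun z ↦ ?_
  congr 2
  · exact congrArg (fun φ : ZMod (m * n) →+* ZMod m ↦ φ z) (Subsingleton.elim _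
      ((RingHom.fst _ _).comp (ZMod.chineseRemainder h : ZMod (m * n) →+* ZMod m × ZMod n)))
  · exact congrArg (fun φ : ZMod (m * n) →+* ZMod n ↦ φ z) (Subsingleton.elim _
      ((RingHom.snd _ _).comp (ZMod.chineseRemainder h : ZMod (m * n) →+* ZMod m × ZMod n)))

lemma sum_jacobiSym_mul_stdAddChar (m : ℕ) (hm : Squarefree m) (ho : Odd m) :
    ∀ [NeZero m], ∀ a : (ZMod m)ˣ,
    ∑ x : ZMod m, (jacobiSym (x.val : ℤ) m : ℂ) * ZMod.stdAddChar ((a : ZMod m) * x) =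
      ∑ x : ZMod m, ZMod.stdAddChar ((a : ZMod m) * x ^ 2) := by
  induction m using Nat.recOnPosPrimePosCoprime with
  | zero => simp at ho
  | one =>
    intro _ a
    have : Subsingleton (ZMod 1) := inferInstance
    refine Finset.sum_congr rfl fun x _ ↦ ?_
    simp [Subsingleton.elim x 0]
  | prime_pow p n hp hn =>
    have h1 : n = 1 := by
      have := (Nat.squarefree_pow_iff hp.one_lt.ne' hn.ne').mp hm
      exact this.2
    rw [h1, pow_one] at ho ⊢
    intro _ a
    have : Fact p.Prime := ⟨hp⟩
    have hp2 : p ≠ 2 := by rintro rfl; exact absurd ho (by decide)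
    exact sum_jacobiSym_mul_stdAddChar_prime hp2 a
  | coprime m n h1 h2 h IHm IHn =>
    intro _ a
    have : NeZero m := ⟨by omega⟩
    have : NeZero n := ⟨by omega⟩
    obtain ⟨u, v, huv⟩ := stdAddChar_chinese h
    rw [Nat.squarefree_mul h] at hm
    rw [Nat.odd_mul] at ho
    specialize IHm hm.1 ho.1 (u * Units.map (ZMod.castHom (dvd_mul_right m n) (ZMod m)) a)
    specialize IHn hm.2 ho.2 (v * Units.map (ZMod.castHom (dvd_mul_left n m) (ZMod n)) a)
    have e := congrArg₂ (· * ·) IHm IHn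
    simp only [← sum_chinese h] at e
    refine Eq.trans (Finset.sum_congr rfl fun z _ ↦ ?_) (e.trans
      (Finset.sum_congr rfl fun z _ ↦ ?_))
    · rw [jacobiSym.mul_right, huv, jacobiSym_val_castHom (dvd_mul_right m n),
        jacobiSym_val_castHom (dvd_mul_left n m)]
      simp only [map_mul, Units.val_mul, Units.coe_map, MonoidHom.coe_coe, mul_assoc]
      push_cast
      ring
    · rw [huv]
      simp [mul_assoc]

lemma quadratic_unitHom_prime {p : ℕ} [Fact p.Prime] (f : (ZMod p)ˣ →* ℂˣ)
    (hf : ∀ u, f u ^ 2 = 1) :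
    ∃ d, d ∣ p ∧ ∀ u, (f u : ℂ) = jacobiSym ((u : ZMod p).val : ℤ) d := by
  have hJ (x : ZMod p) : jacobiSym (x.val : ℤ) p = quadraticChar (ZMod p) x := by
    rw [← jacobiSym.legendreSym.to_jacobiSym, legendreSym]
    simp
  have hsq (u : (ZMod p)ˣ) (hu : quadraticChar (ZMod p) u = 1) : f u = 1 := by
    rw [quadraticChar_one_iff_isSquare u.ne_zero] at hu
    obtain ⟨y, hy⟩ := hu
    have hy0 : y ≠ 0 := by rintro rfl; simp at hy
    have : u = Units.mk0 y hy0 ^ 2 := by ext; simp [hy, sq]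
    rw [this, map_pow, hf]
  by_cases h : ∃ y : (ZMod p)ˣ, quadraticChar (ZMod p) y ≠ 1 ∧ f y = 1
  · obtain ⟨y, hy, hfy⟩ := h
    refine ⟨1, one_dvd _, fun u ↦ ?_⟩
    rw [jacobiSym.one_right]
    by_cases hu : quadraticChar (ZMod p) u = 1
    · simp [hsq u hu]
    · have hy' := (quadraticChar_dichotomy y.ne_zero).resolve_left hy
      have hu' := (quadraticChar_dichotomy u.ne_zero).resolve_left hu
      have := hsq (u * y) (by rw [Units.val_mul, map_mul, hy', hu']; norm_num)
      rw [map_mul, hfy, mul_one] at this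
      simp [this]
  · push Not at h
    refine ⟨p, dvd_rfl, fun u ↦ ?_⟩
    rw [hJ]
    rcases quadraticChar_dichotomy u.ne_zero with hu | hu
    · simp [hsq u hu, hu]
    · have h1 := h u (by rw [hu]; decide)
      have h2 : (f u : ℂ) ^ 2 = 1 := by
        rw [← Units.val_pow_eq_pow_val, hf u, Units.val_one]
      rcases eq_or_eq_neg_of_sq_eq_sq _ 1 (h2.trans (one_pow 2).symm) with h3 | h3
      · exact absurd (Units.ext h3) h1
      · rw [h3, hu]; simp

lemma quadratic_unitHom_eq_jacobiSym (m : ℕ) (hm : Squarefree m) (ho : Odd m) :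
    ∀ f : (ZMod m)ˣ →* ℂˣ, (∀ u, f u ^ 2 = 1) →
    ∃ d, d ∣ m ∧ ∀ u, (f u : ℂ) = jacobiSym ((u : ZMod m).val : ℤ) d := by
  induction m using Nat.recOnPosPrimePosCoprime with
  | zero => simp at ho
  | one =>
    intro f _
    refine ⟨1, dvd_rfl, fun u ↦ ?_⟩
    rw [Subsingleton.elim u 1]
    simp
  | prime_pow p n hp hn =>
    have h1 : n = 1 := by
      have := (Nat.squarefree_pow_iff hp.one_lt.ne' hn.ne').mp hm
      exact this.2
    rw [h1, pow_one] at ho ⊢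
    have : Fact p.Prime := ⟨hp⟩
    exact quadratic_unitHom_prime
  | coprime m n h1 h2 h IHm IHn =>
    intro f hf
    have : NeZero m := ⟨by omega⟩
    have : NeZero n := ⟨by omega⟩
    rw [Nat.squarefree_mul h] at hm
    rw [Nat.odd_mul] at ho
    let e : (ZMod (m * n))ˣ ≃* (ZMod m)ˣ × (ZMod n)ˣ :=
      (Units.mapEquiv (ZMod.chineseRemainder h).toMulEquiv).trans MulEquiv.prodUnits
    have e1 (u) : ((e u).1 : ZMod m) = ZMod.castHom (dvd_mul_right m n) (ZMod m) u :=
      congrArg (fun φ : ZMod (m * n) →+* ZMod m ↦ φ u) (Subsingleton.elim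
        ((RingHom.fst _ _).comp (ZMod.chineseRemainder h : ZMod (m * n) →+* ZMod m × ZMod n)) _)
    have e2 (u) : ((e u).2 : ZMod n) = ZMod.castHom (dvd_mul_left n m) (ZMod n) u :=
      congrArg (fun φ : ZMod (m * n) →+* ZMod n ↦ φ u) (Subsingleton.elim
        ((RingHom.snd _ _).comp (ZMod.chineseRemainder h : ZMod (m * n) →+* ZMod m × ZMod n)) _)
    obtain ⟨d1, hd1, H1⟩ := IHm hm.1 ho.1 ((f.comp e.symm.toMonoidHom).comp (MonoidHom.inl _ _))
      fun u ↦ hf _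
    obtain ⟨d2, hd2, H2⟩ := IHn hm.2 ho.2 ((f.comp e.symm.toMonoidHom).comp (MonoidHom.inr _ _))
      fun u ↦ hf _
    refine ⟨d1 * d2, mul_dvd_mul hd1 hd2, fun u ↦ ?_⟩
    have : NeZero d1 := ⟨ne_zero_of_dvd_ne_zero (by omega) hd1⟩
    have : NeZero d2 := ⟨ne_zero_of_dvd_ne_zero (by omega) hd2⟩
    have hu : u = e.symm ((e u).1, 1) * e.symm (1, (e u).2) := by
      rw [← map_mul]
      simp
    have h3 := H1 (e u).1
    have h4 := H2 (e u).2
    simp only [MonoidHom.comp_apply, MonoidHom.inl_apply, MonoidHom.inr_apply, e1, e2,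
      MulEquiv.coe_toMonoidHom] at h3 h4
    conv_lhs => rw [hu, map_mul, Units.val_mul, h3, h4]
    have t (a b c : ℕ) [NeZero a] [NeZero b] [NeZero c] (hab : a ∣ b) (hbc : b ∣ c) (z : ZMod c) :
        jacobiSym (z.val : ℤ) a = jacobiSym ((ZMod.castHom hbc (ZMod b) z).val : ℤ) a := by
      rw [jacobiSym_val_castHom (hab.trans hbc), jacobiSym_val_castHom hab]
      congr 3
      exact congrArg (fun φ : ZMod c →+* ZMod a ↦ φ z) (Subsingleton.elim _
        ((ZMod.castHom hab (ZMod a)).comp (ZMod.castHom hbc (ZMod b))))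
    rw [jacobiSym.mul_right, t d1 m _ hd1 (dvd_mul_right m n), t d2 n _ hd2 (dvd_mul_left n m)]
    push_cast
    rfl

lemma quadratic_apply_sq {q : ℕ} {χ : DirichletCharacter ℂ q} (h : χ ^ 2 = 1) (u : (ZMod q)ˣ) :
    χ.toUnitHom u ^ 2 = 1 := by
  have := congrArg (fun χ : DirichletCharacter ℂ q ↦ χ u) h
  simp only [MulChar.pow_apply_coe, MulChar.one_apply_coe] at this
  ext
  simpa using this

lemma squarefree_of_isPrimitive_quadratic {q : ℕ} (ho : Odd q) {χ : DirichletCharacter ℂ q}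
    (hp : χ.IsPrimitive) (h2 : χ ^ 2 = 1) : Squarefree q := by
  have : NeZero q := ⟨by rintro rfl; simp at ho⟩
  rw [Nat.squarefree_iff_prime_squarefree]
  rintro p hpp ⟨k, hk⟩
  have hd : p * k ∣ q := ⟨p, by rw [hk]; ring⟩
  have hfac : χ.FactorsThrough (p * k) := by
    rw [DirichletCharacter.factorsThrough_iff_ker_unitsMap hd]
    intro u hu
    rw [MonoidHom.mem_ker] at hu ⊢
    obtain ⟨j, hj⟩ := ZMod.intCast_surjective (u : ZMod q)
    have h1 : ((p * k : ℕ) : ℤ) ∣ j - 1 := by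
      have := congrArg Units.val hu
      rw [ZMod.unitsMap_val, Units.val_one, ← hj, ZMod.cast_intCast hd] at this
      rw [← ZMod.intCast_zmod_eq_zero_iff_dvd]
      simp [this]
    have h3 : (p : ℤ) ∣ ∑ i ∈ range p, j ^ i := by
      rw [← ZMod.intCast_zmod_eq_zero_iff_dvd]
      have : (j : ZMod p) = 1 := by
        rw [← sub_eq_zero]
        have := (ZMod.intCast_zmod_eq_zero_iff_dvd (j - 1) p).mpr
          ((by push_cast; exact dvd_mul_right _ _ : (p : ℤ) ∣ (p * k : ℕ)).trans h1)
        simpa using this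
      simp [this]
    have h4 : (q : ℤ) ∣ j ^ p - 1 := by
      rw [← mul_geom_sum, hk]
      have := mul_dvd_mul h3 h1
      push_cast at this ⊢
      rw [mul_comm (j - 1)]
      rwa [mul_assoc]
    have h5 : u ^ p = 1 := by
      ext
      rw [← ZMod.intCast_zmod_eq_zero_iff_dvd] at h4
      push_cast at h4
      rw [hj, sub_eq_zero] at h4
      simpa using h4
    have hop : Odd p := by
      rw [hk, Nat.odd_mul, Nat.odd_mul] at ho
      exact ho.1.1
    obtain ⟨t, ht⟩ := hop
    have h6 := congrArg χ.toUnitHom h5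
    rw [map_pow, map_one, ht, pow_succ, pow_mul, quadratic_apply_sq h2, one_pow, one_mul] at h6
    exact h6
  have hc := DirichletCharacter.conductor_dvd_of_mem_conductorSet χ hfac
  rw [hp] at hc
  have h0 := NeZero.pos q
  have h1 : 0 < p * k := Nat.pos_of_dvd_of_pos hd h0
  have := Nat.le_of_dvd h1 hc
  have h3 := hpp.two_le
  nlinarith

lemma eq_jacobiSym_of_isPrimitive_quadratic {q : ℕ} (ho : Odd q) {χ : DirichletCharacter ℂ q}
    (hp : χ.IsPrimitive) (h2 : χ ^ 2 = 1) (n : ℤ) : χ (n : ZMod q) = jacobiSym n q := by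
  have : NeZero q := ⟨by rintro rfl; simp at ho⟩
  have hmod (d : ℕ) (hd : d ∣ q) : jacobiSym (((n : ZMod q)).val : ℤ) d = jacobiSym n d := by
    refine jacobiSym.mod_left' ?_
    have : NeZero d := ⟨ne_zero_of_dvd_ne_zero (NeZero.ne q) hd⟩
    rw [← Int.ModEq, ← ZMod.intCast_eq_intCast_iff]
    simp [ZMod.cast_intCast hd]
  obtain ⟨d, hd, H⟩ := quadratic_unitHom_eq_jacobiSym q
    (squarefree_of_isPrimitive_quadratic ho hp h2) ho χ.toUnitHom (quadratic_apply_sq h2)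
  have : NeZero d := ⟨ne_zero_of_dvd_ne_zero (NeZero.ne q) hd⟩
  have hfac : χ.FactorsThrough d := by
    rw [DirichletCharacter.factorsThrough_iff_ker_unitsMap hd]
    intro u hu
    rw [MonoidHom.mem_ker] at hu ⊢
    ext
    rw [H, jacobiSym_val_castHom hd]
    have := congrArg Units.val hu
    rw [ZMod.unitsMap_val, Units.val_one] at this
    rw [ZMod.castHom_apply, this]
    have : jacobiSym ((1 : ZMod d).val : ℤ) d = jacobiSym 1 d := by
      refine jacobiSym.mod_left' ?_
      rw [← Int.ModEq, ← ZMod.intCast_eq_intCast_iff]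
      simp
    rw [this]
    simp
  have hc := DirichletCharacter.conductor_dvd_of_mem_conductorSet χ hfac
  rw [hp] at hc
  obtain rfl := Nat.dvd_antisymm hd hc
  by_cases hu : IsCoprime n d
  · have hu' : IsUnit (n : ZMod d) := by rwa [ZMod.coe_int_isUnit_iff_isCoprime, isCoprime_comm]
    have := H hu'.unit
    rw [IsUnit.unit_spec, hmod d hd] at this
    rw [← this]
    simp
  · rw [(DirichletCharacter.apply_eq_zero_iff χ n).mpr hu]
    rw [jacobiSym.eq_zero_iff_not_coprime.mpr]
    · simp
    · rwa [Int.isCoprime_iff_gcd_eq_one] at hu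

lemma mod_four_of_odd_quadratic {q : ℕ} (ho : Odd q) {χ : DirichletCharacter ℂ q}
    (hp : χ.IsPrimitive) (h2 : χ ^ 2 = 1) (hodd : χ (-1) = -1) : q % 4 = 3 := by
  have h := eq_jacobiSym_of_isPrimitive_quadratic ho hp h2 (-1)
  push_cast at h
  rw [hodd, jacobiSym.at_neg_one ho] at h
  have h3 : ZMod.χ₄ (q : ZMod 4) = -1 := by exact_mod_cast h.symm
  by_contra hq
  have : q % 4 = 1 := by
    have := Nat.odd_iff.mp ho
    omega
  rw [ZMod.χ₄_nat_one_mod_four this] at h3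
  norm_num at h3

lemma gaussSum_of_odd_quadratic {q : ℕ} [NeZero q] (ho : Odd q) {χ : DirichletCharacter ℂ q}
    (hp : χ.IsPrimitive) (h2 : χ ^ 2 = 1) (hodd : χ (-1) = -1) :
    gaussSum χ ZMod.stdAddChar = I * Real.sqrt q := by
  have h := sum_jacobiSym_mul_stdAddChar q (squarefree_of_isPrimitive_quadratic ho hp h2) ho 1
  simp only [Units.val_one, one_mul] at h
  rw [← gauss_sum_sq_three (mod_four_of_odd_quadratic ho hp h2 hodd), gaussSum]
  refine Eq.trans (Finset.sum_congr rfl fun x _ ↦ ?_) (h.trans ?_)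
  · rw [← eq_jacobiSym_of_isPrimitive_quadratic ho hp h2]
    simp
  · obtain ⟨m, rfl⟩ : ∃ m, q = m + 1 := ⟨q - 1, (Nat.succ_pred (NeZero.ne q)).symm⟩
    refine Finset.sum_congr rfl fun x _ ↦ ?_
    have : (x : ZMod (m + 1)) ^ 2 = (((ZMod.val x : ℕ) : ℤ) ^ 2 : ℤ) := by
      push_cast
      rw [ZMod.natCast_zmod_val]
    rw [this, ZMod.stdAddChar_coe]
    congr 1
    push_cast
    simp [ZMod.val]
    ring

lemma rpow_neg_sub_bound {s : ℝ} (h1 : 1 ≤ s) (h2 : s ≤ 2) (i : ℕ) (hi : i ≠ 0) :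
    |((i + 1 : ℕ) : ℝ) ^ (-s) - (i : ℝ) ^ (-s)| ≤ 2 / (i : ℝ) ^ 2 := by
  have hi1 : (1 : ℝ) ≤ i := by exact_mod_cast Nat.one_le_iff_ne_zero.mpr hi
  have hi0 : (0 : ℝ) < i := by linarith
  have e : ((i + 1 : ℕ) : ℝ) ^ (-s) = (i : ℝ) ^ (-s) * (1 + 1 / i : ℝ) ^ (-s) := by
    rw [← Real.mul_rpow hi0.le (by positivity)]
    congr 1
    push_cast
    field_simp
  have h3 : (1 + 1 / i : ℝ) ^ (-s) ≤ 1 :=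
    Real.rpow_le_one_of_one_le_of_nonpos (by simp) (by linarith)
  have h4 : (1 + 1 / i : ℝ) ^ (-2 : ℝ) ≤ (1 + 1 / i : ℝ) ^ (-s) :=
    Real.rpow_le_rpow_of_exponent_le (by simp) (by linarith)
  have h5 : 1 - 2 / (i : ℝ) ≤ (1 + 1 / i : ℝ) ^ (-2 : ℝ) := by
    rw [Real.rpow_neg (by positivity), show (2 : ℝ) = ((2 : ℕ) : ℝ) by norm_num, Real.rpow_natCast]
    have : (1 + 1 / i : ℝ) ^ 2 ≠ 0 := by positivity
    rw [← sub_nonneg]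
    have e2 : ((1 + 1 / i : ℝ) ^ 2)⁻¹ - (1 - (2 : ℕ) / (i : ℝ)) =
        (3 * i + 2) / (i * (i + 1) ^ 2) := by
      push_cast
      field_simp
      ring
    rw [e2]
    positivity
  have h6 : (i : ℝ) ^ (-s) ≤ (i : ℝ)⁻¹ := by
    rw [← Real.rpow_neg_one]
    exact Real.rpow_le_rpow_of_exponent_le hi1 (by linarith)
  have h7 : 0 ≤ (i : ℝ) ^ (-s) := by positivity
  rw [e, abs_sub_comm, abs_of_nonneg (by nlinarith)]
  calc (i : ℝ) ^ (-s) - (i : ℝ) ^ (-s) * (1 + 1 / i : ℝ) ^ (-s)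
      = (i : ℝ) ^ (-s) * (1 - (1 + 1 / i : ℝ) ^ (-s)) := by ring
    _ ≤ (i : ℝ)⁻¹ * (2 / i) := by
      refine mul_le_mul h6 (by linarith) (by linarith) (by positivity)
    _ = 2 / (i : ℝ) ^ 2 := by field_simp

lemma norm_sum_range_dirichlet_le {q : ℕ} [NeZero q] {χ : DirichletCharacter ℂ q} (hχ : χ ≠ 1)
    (n : ℕ) : ‖∑ i ∈ range n, χ (i : ZMod q)‖ ≤ q := by
  have h0 : ∑ i ∈ range q, χ (i : ZMod q) = 0 := by
    have := MulChar.sum_eq_zero_of_ne_one hχ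
    rw [← this]
    refine Finset.sum_bij (fun i _ ↦ (i : ZMod q)) (by simp) ?_ ?_ (by simp)
    · intro a ha b hb hab
      have := (ZMod.natCast_eq_natCast_iff' a b q).mp hab
      rwa [Nat.mod_eq_of_lt (mem_range.mp ha), Nat.mod_eq_of_lt (mem_range.mp hb)] at this
    · intro b _
      exact ⟨b.val, mem_range.mpr (ZMod.val_lt b), by simp⟩
  have h1 (k r : ℕ) : ∑ i ∈ range (q * k + r), χ (i : ZMod q) = ∑ i ∈ range r, χ (i : ZMod q) := by
    induction k with
    | zero => simp
    | succ k ih =>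
      rw [mul_add, mul_one, add_comm (q * k) q, add_assoc, Finset.sum_range_add, h0, zero_add,
        ← ih]
      simp
  rw [← Nat.div_add_mod n q, h1]
  refine (norm_sum_le _ _).trans ?_
  refine (Finset.sum_le_sum fun i _ ↦ DirichletCharacter.norm_le_one χ _).trans ?_
  simp only [sum_const, card_range, nsmul_eq_mul, mul_one]
  exact_mod_cast (Nat.mod_lt n (NeZero.pos q)).le

lemma tendsto_sum_dirichlet_div {q : ℕ} [NeZero q] (hq : q ≠ 1) {χ : DirichletCharacter ℂ q}
    (hχ : χ ≠ 1) :
    Filter.Tendsto (fun N ↦ ∑ n ∈ range N, χ (n : ZMod q) / n) Filter.atTop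
      (nhds (DirichletCharacter.LFunction χ 1)) := by
  let G : ℕ → ℂ := fun n ↦ ∑ i ∈ range n, χ (i : ZMod q)
  let t : ℝ → ℕ → ℂ := fun s i ↦ ((((i + 1 : ℕ) : ℝ) ^ (-s) - (i : ℝ) ^ (-s) : ℝ) : ℂ) * G (i + 1)
  have hχ0 : χ 0 = 0 := DirichletCharacter.map_zero' χ hq
  have hG1 : G 1 = 0 := by simp [G, hχ0]
  have hb (s : ℝ) (h1 : 1 ≤ s) (h2 : s ≤ 2) (i : ℕ) : ‖t s i‖ ≤ 2 / (i : ℝ) ^ 2 * q := by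
    rcases eq_or_ne i 0 with rfl | hi
    · simp [t, hG1]
    · simp only [t]
      rw [norm_mul, Complex.norm_real, Real.norm_eq_abs]
      exact mul_le_mul (rpow_neg_sub_bound h1 h2 i hi) (norm_sum_range_dirichlet_le hχ _)
        (norm_nonneg _) (by positivity)
  have hbs : Summable fun i : ℕ ↦ 2 / (i : ℝ) ^ 2 * q := by
    have := (Real.summable_one_div_nat_pow.mpr (one_lt_two)).mul_left (2 * q : ℝ)
    refine this.congr fun i ↦ by ring
  have hlim (s : ℝ) (h1 : 1 ≤ s) (h2 : s ≤ 2) :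
      Filter.Tendsto (fun N ↦ ∑ n ∈ range N, (((n : ℝ) ^ (-s) : ℝ) : ℂ) * χ (n : ZMod q))
        Filter.atTop (nhds (-∑' i, t s i)) := by
    have hs : Summable (t s) := Summable.of_norm_bounded hbs (hb s h1 h2)
    rw [← Filter.tendsto_add_atTop_iff_nat 1]
    have e (n : ℕ) : ∑ i ∈ range (n + 1), (((i : ℝ) ^ (-s) : ℝ) : ℂ) * χ (i : ZMod q) =
        (((n : ℝ) ^ (-s) : ℝ) : ℂ) * G (n + 1) - ∑ i ∈ range n, t s i := by
      have := Finset.sum_range_by_parts (fun i : ℕ ↦ (((i : ℝ) ^ (-s) : ℝ) : ℂ))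
        (fun i : ℕ ↦ χ (i : ZMod q)) (n + 1)
      simp only [smul_eq_mul, Nat.add_sub_cancel] at this
      rw [this]
      simp only [t, G]
      push_cast
      rfl
    simp only [e]
    rw [← zero_sub (∑' i, t s i)]
    refine Filter.Tendsto.sub ?_ hs.hasSum.tendsto_sum_nat
    refine squeeze_zero_norm (a := fun n : ℕ ↦ (n : ℝ) ^ (-s) * q) (fun n ↦ ?_) ?_
    · rw [norm_mul, Complex.norm_real, Real.norm_of_nonneg (by positivity)]
      exact mul_le_mul_of_nonneg_left (norm_sum_range_dirichlet_le hχ _) (by positivity)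
    · have := (tendsto_rpow_neg_atTop (by linarith : 0 < s)).comp tendsto_natCast_atTop_atTop
      simpa using this.mul_const (q : ℝ)
  have hL (s : ℝ) (h1 : 1 < s) (h2 : s ≤ 2) : DirichletCharacter.LFunction χ s = -∑' i, t s i := by
    have hre : 1 < (s : ℂ).re := by simpa
    rw [DirichletCharacter.LFunction_eq_LSeries χ hre, LSeries]
    have hsum := (ZMod.LSeriesSummable_of_one_lt_re χ hre).hasSum.tendsto_sum_nat
    refine tendsto_nhds_unique hsum ((hlim s h1.le h2).congr fun N ↦ ?_)
    refine Finset.sum_congr rfl fun n _ ↦ ?_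
    rcases eq_or_ne n 0 with rfl | hn
    · simp [hχ0]
    · rw [LSeries.term_of_ne_zero hn, ofReal_cpow (by positivity)]
      push_cast
      rw [cpow_neg]
      ring
  have hcont : Filter.Tendsto (fun s : ℝ ↦ -∑' i, t s i) (nhdsWithin 1 (Set.Ioi 1))
      (nhds (-∑' i, t 1 i)) := by
    refine (tendsto_tsum_of_dominated_convergence hbs (fun i ↦ ?_) ?_).neg
    · refine Filter.Tendsto.mul_const _ ?_
      refine (continuous_ofReal.tendsto _).comp ?_
      refine tendsto_nhdsWithin_of_tendsto_nhds ?_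
      rcases eq_or_ne i 0 with rfl | hi
      · simp only [zero_add, Nat.cast_one, Real.one_rpow, Nat.cast_zero]
        refine tendsto_const_nhds.sub ?_
        refine tendsto_const_nhds.congr' ?_
        filter_upwards [lt_mem_nhds (zero_lt_one (α := ℝ))] with s hs
        rw [Real.zero_rpow (by norm_num), Real.zero_rpow (by simpa using hs.ne')]
      · have hi' : (i : ℝ) ≠ 0 := by exact_mod_cast hi
        have hi'' : ((i + 1 : ℕ) : ℝ) ≠ 0 := by positivity
        refine ContinuousAt.tendsto (f := fun s : ℝ ↦ ((i + 1 : ℕ) : ℝ) ^ (-s) - (i : ℝ) ^ (-s)) ?_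
        have hn : ContinuousAt (fun s : ℝ ↦ -s) 1 := continuous_neg.continuousAt
        exact ((Real.continuousAt_const_rpow hi'').comp hn).sub
          ((Real.continuousAt_const_rpow hi').comp hn)
    · filter_upwards [Ioc_mem_nhdsGT (one_lt_two (α := ℝ))] with s hs i
      exact hb s hs.1.le hs.2 i
  have hLc : Filter.Tendsto (fun s : ℝ ↦ DirichletCharacter.LFunction χ s)
      (nhdsWithin 1 (Set.Ioi 1)) (nhds (DirichletCharacter.LFunction χ 1)) := by
    refine tendsto_nhdsWithin_of_tendsto_nhds ?_
    have := ((DirichletCharacter.differentiable_LFunction hχ).continuous.comp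
      continuous_ofReal).tendsto 1
    simpa [Function.comp_def] using this
  have : DirichletCharacter.LFunction χ 1 = -∑' i, t 1 i := by
    refine tendsto_nhds_unique hLc (hcont.congr' ?_)
    filter_upwards [Ioc_mem_nhdsGT (one_lt_two (α := ℝ))] with s hs
    exact (hL s hs.1 hs.2).symm
  rw [this]
  refine (hlim 1 le_rfl one_le_two).congr fun N ↦ Finset.sum_congr rfl fun n _ ↦ ?_
  rw [Real.rpow_neg_one]
  push_cast
  ring

lemma arg_one_sub_exp {x : ℝ} (h0 : 0 < x) (h1 : x < 1) :
    arg (1 - cexp (2 * Real.pi * I * x)) = Real.pi * (x - 1 / 2) := by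
  have e : 1 - cexp (2 * Real.pi * I * x) = ((2 * Real.sin (Real.pi * x) : ℝ) : ℂ) *
      (cos ((Real.pi * (x - 1 / 2) : ℝ) : ℂ) + sin ((Real.pi * (x - 1 / 2) : ℝ) : ℂ) * I) := by
    have c1 : cos ((Real.pi * (x - 1 / 2) : ℝ) : ℂ) = sin (Real.pi * x : ℂ) := by
      rw [← cos_pi_div_two_sub, ← cos_neg]
      push_cast
      ring_nf
    have c2 : sin ((Real.pi * (x - 1 / 2) : ℝ) : ℂ) = -cos (Real.pi * x : ℂ) := by
      rw [← sin_pi_div_two_sub, ← sin_neg]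
      push_cast
      ring_nf
    rw [c1, c2, show (2 * Real.pi * I * x : ℂ) = (2 * (Real.pi * x)) * I by ring, exp_mul_I,
      cos_two_mul, sin_two_mul]
    push_cast
    linear_combination (-2 : ℂ) * sin_sq_add_cos_sq (Real.pi * x : ℂ)
  rw [e, arg_mul_cos_add_sin_mul_I]
  · have := Real.sin_pos_of_pos_of_lt_pi (x := Real.pi * x) (by positivity)
      (by nlinarith [Real.pi_pos])
    positivity
  · constructor <;> nlinarith [Real.pi_pos]

lemma stdAddChar_eq_exp_val {q : ℕ} [NeZero q] (a : ZMod q) :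
    ZMod.stdAddChar a = cexp (2 * Real.pi * I * ((a.val / q : ℝ) : ℂ)) := by
  have := ZMod.stdAddChar_coe (N := q) (a.val : ℤ)
  rw [show (((a.val : ℕ) : ℤ) : ZMod q) = a by simp] at this
  rw [this]
  congr 1
  push_cast
  ring

lemma one_sub_stdAddChar_mem_slitPlane {q : ℕ} [NeZero q] {a : ZMod q} (ha : a ≠ 0) :
    1 - ZMod.stdAddChar a ∈ slitPlane := by
  have hn : ‖(ZMod.stdAddChar a : ℂ)‖ = 1 := ZMod.stdAddChar.norm_apply a
  have h1 : (ZMod.stdAddChar a : ℂ) ≠ 1 := by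
    intro h
    exact ha (ZMod.injective_stdAddChar (by simpa using h))
  left
  have h2 : (ZMod.stdAddChar a : ℂ).re ≤ 1 := (re_le_norm _).trans hn.le
  refine lt_of_le_of_ne (by simpa using h2) fun h ↦ h1 ?_
  have h3 : (ZMod.stdAddChar a : ℂ).re = 1 := by
    simp at h
    linarith
  have h4 := Complex.sq_norm (ZMod.stdAddChar a : ℂ)
  rw [hn, normSq_apply, h3] at h4
  refine Complex.ext h3 ?_
  simp
  nlinarith

lemma LFunction_one_mul_gaussSum {q : ℕ} [NeZero q] (hq : q ≠ 1) {χ : DirichletCharacter ℂ q}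
    (hχ : χ ≠ 1) (hp : χ.IsPrimitive) (h2 : χ ^ 2 = 1) :
    DirichletCharacter.LFunction χ 1 * gaussSum χ ZMod.stdAddChar =
      -∑ a : ZMod q, χ a * log (1 - ZMod.stdAddChar a) := by
  have hinv : χ⁻¹ = χ := by
    rw [inv_eq_iff_mul_eq_one, ← sq, h2]
  have hG (n : ℕ) : χ (n : ZMod q) * gaussSum χ ZMod.stdAddChar =
      ∑ a : ZMod q, χ a * ZMod.stdAddChar a ^ n := by
    have := gaussSum_mulShift_of_isPrimitive ZMod.stdAddChar hp (n : ZMod q)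
    rw [hinv] at this
    rw [← this, gaussSum]
    refine Finset.sum_congr rfl fun a _ ↦ ?_
    rw [AddChar.mulShift_apply, ← AddChar.map_nsmul_eq_pow, nsmul_eq_mul]
  have abel := (Complex.tendsto_tsum_powerSeries_nhdsWithin_lt
    (tendsto_sum_dirichlet_div hq hχ)).mul_const (gaussSum χ ZMod.stdAddChar)
  rw [Filter.tendsto_map'_iff] at abel
  have hlim : Filter.Tendsto (fun r : ℝ ↦ -∑ a : ZMod q, χ a * log (1 - ZMod.stdAddChar a * r))
      (nhdsWithin 1 (Set.Iio 1)) (nhds (-∑ a : ZMod q, χ a * log (1 - ZMod.stdAddChar a))) := by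
    refine (tendsto_finsetSum _ fun a _ ↦ ?_).neg
    rcases eq_or_ne a 0 with rfl | ha
    · simp [DirichletCharacter.map_zero' χ hq]
    · refine Filter.Tendsto.const_mul _ ?_
      refine tendsto_nhdsWithin_of_tendsto_nhds ?_
      have hc : ContinuousAt (fun r : ℝ ↦ (1 - ZMod.stdAddChar a * r : ℂ)) 1 := by fun_prop
      have := (hc.clog (by simpa using one_sub_stdAddChar_mem_slitPlane ha)).tendsto
      simpa using this
  refine tendsto_nhds_unique abel (hlim.congr' ?_)
  filter_upwards [Ioo_mem_nhdsLT (zero_lt_one (α := ℝ))] with r hr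
  have hs (a : ZMod q) : HasSum (fun n : ℕ ↦ χ a * ((ZMod.stdAddChar a * r) ^ n / n))
      (χ a * -log (1 - ZMod.stdAddChar a * r)) := by
    refine (hasSum_taylorSeries_neg_log ?_).mul_left _
    have hn : ‖(ZMod.stdAddChar a : ℂ)‖ = 1 := ZMod.stdAddChar.norm_apply a
    rw [norm_mul, hn, one_mul, norm_real, Real.norm_of_nonneg hr.1.le]
    exact hr.2
  have hs' := hasSum_sum fun a (_ : a ∈ (univ : Finset (ZMod q))) ↦ hs a
  have e : -∑ a : ZMod q, χ a * log (1 - ZMod.stdAddChar a * r) =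
      ∑ a : ZMod q, χ a * -log (1 - ZMod.stdAddChar a * r) := by
    simp
  rw [e, ← hs'.tsum_eq, Function.comp_apply, ← tsum_mul_right]
  refine tsum_congr fun n ↦ ?_
  rw [show χ (n : ZMod q) / n * (r : ℂ) ^ n * gaussSum χ ZMod.stdAddChar =
    (χ (n : ZMod q) * gaussSum χ ZMod.stdAddChar) * ((r : ℂ) ^ n / n) by ring, hG, Finset.sum_mul]
  refine Finset.sum_congr rfl fun a _ ↦ ?_
  rw [mul_pow]
  ring

lemma sum_log_one_sub_stdAddChar {q : ℕ} [NeZero q] (hq : q ≠ 1) {χ : DirichletCharacter ℂ q}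
    (hodd : χ (-1) = -1) :
    ∑ a : ZMod q, χ a * log (1 - ZMod.stdAddChar a) =
      I * Real.pi * ∑ a : ZMod q, χ a * ((a.val / q - 1 / 2 : ℝ) : ℂ) := by
  have hχ0 : χ 0 = 0 := DirichletCharacter.map_zero' χ hq
  have hz : ∑ a : ZMod q, χ a * (Real.log ‖1 - ZMod.stdAddChar a‖ : ℂ) = 0 := by
    have h1 : ∑ a : ZMod q, χ a * (Real.log ‖1 - ZMod.stdAddChar a‖ : ℂ) =
        ∑ a : ZMod q, χ (-a) * (Real.log ‖1 - ZMod.stdAddChar (-a)‖ : ℂ) :=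
      (Equiv.sum_comp (Equiv.neg (ZMod q))
        (fun a ↦ χ a * (Real.log ‖1 - ZMod.stdAddChar a‖ : ℂ))).symm
    have h2 (a : ZMod q) : χ (-a) * (Real.log ‖1 - ZMod.stdAddChar (-a)‖ : ℂ) =
        -(χ a * (Real.log ‖1 - ZMod.stdAddChar a‖ : ℂ)) := by
      have : (1 - ZMod.stdAddChar (-a) : ℂ) = (starRingEnd ℂ) (1 - ZMod.stdAddChar a) := by
        rw [map_sub, map_one, AddChar.map_neg_eq_conj]
      rw [this, RCLike.norm_conj, neg_eq_neg_one_mul, map_mul, hodd]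
      ring
    simp only [h2, Finset.sum_neg_distrib] at h1
    exact self_eq_neg.mp h1
  rw [← zero_add (I * _ * _), ← hz, Finset.mul_sum, ← Finset.sum_add_distrib]
  refine Finset.sum_congr rfl fun a _ ↦ ?_
  rcases eq_or_ne a 0 with rfl | ha
  · simp [hχ0]
  · have hv : 0 < a.val := Nat.pos_of_ne_zero (by simpa using ha)
    have hq0 : (0 : ℝ) < q := by exact_mod_cast NeZero.pos q
    have hv2 : (a.val : ℝ) < q := by exact_mod_cast ZMod.val_lt a
    rw [log, stdAddChar_eq_exp_val, arg_one_sub_exp (by positivity) ((div_lt_one hq0).mpr hv2)]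
    push_cast
    ring

lemma LFunction_one_eq {q : ℕ} [NeZero q] (ho : Odd q) (hq : q ≠ 1) {χ : DirichletCharacter ℂ q}
    (hχ : χ ≠ 1) (hp : χ.IsPrimitive) (h2 : χ ^ 2 = 1) (hodd : χ (-1) = -1) :
    DirichletCharacter.LFunction χ 1 =
      -(Real.pi / Real.sqrt q) * ∑ a : ZMod q, χ a * ((a.val / q - 1 / 2 : ℝ) : ℂ) := by
  have h := LFunction_one_mul_gaussSum hq hχ hp h2
  rw [sum_log_one_sub_stdAddChar hq hodd, gaussSum_of_odd_quadratic ho hp h2 hodd] at h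
  have hs : (Real.sqrt q : ℂ) ≠ 0 := by
    rw [ofReal_ne_zero]
    exact (Real.sqrt_pos.mpr (by exact_mod_cast NeZero.pos q)).ne'
  generalize ∑ a : ZMod q, χ a * ((a.val / q - 1 / 2 : ℝ) : ℂ) = B at h ⊢
  field_simp
  refine mul_left_cancel₀ I_ne_zero ?_
  linear_combination h

section idealCount

variable {R : Type*} [CommRing R] [IsDedekindDomain R] [Module.Free ℤ R] [Module.Finite ℤ R]

omit [Module.Finite ℤ R] in
lemma Ideal.mul_sup_span_eq_left {I J : Ideal R} {m n : ℕ} (hmn : m.Coprime n)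
    (hI : Ideal.absNorm I = m) (hJ : Ideal.absNorm J = n) : I * J ⊔ Ideal.span {(m : R)} = I := by
  have hm : (m : R) ∈ I := hI ▸ Ideal.absNorm_mem I
  have hn : (n : R) ∈ J := hJ ▸ Ideal.absNorm_mem J
  refine le_antisymm (sup_le Ideal.mul_le_left (by simpa [Ideal.span_le] using hm)) ?_
  intro x hx
  obtain ⟨u, v, huv⟩ := Nat.isCoprime_iff_coprime.mpr hmn
  have huv' : (u : R) * m + v * n = 1 := by exact_mod_cast congrArg (Int.cast : ℤ → R) huv
  have : x = x * v * n + x * u * m := by linear_combination -x * huv'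
  rw [this]
  refine Submodule.add_mem_sup (Ideal.mul_mem_mul (I.mul_mem_right _ hx) hn) ?_
  exact Ideal.mul_mem_left _ _ (Ideal.mem_span_singleton_self _)

omit [Module.Finite ℤ R] in
lemma Ideal.sup_span_mul_sup_span {L : Ideal R} {m n : ℕ} (hmn : m.Coprime n)
    (hL : Ideal.absNorm L = m * n) :
    (L ⊔ Ideal.span {(m : R)}) * (L ⊔ Ideal.span {(n : R)}) = L := by
  have hmem : (m : R) * n ∈ L := by
    have := Ideal.absNorm_mem L
    rw [hL] at this
    exact_mod_cast this
  refine le_antisymm ?_ ?_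
  · rw [Ideal.mul_le]
    intro r hr s hs
    obtain ⟨a, ha, b, hb, rfl⟩ := Submodule.mem_sup.mp hr
    obtain ⟨c, hc, d, hd, rfl⟩ := Submodule.mem_sup.mp hs
    obtain ⟨b, rfl⟩ := Ideal.mem_span_singleton'.mp hb
    obtain ⟨d, rfl⟩ := Ideal.mem_span_singleton'.mp hd
    rw [add_mul, mul_add (b * (m : R))]
    refine L.add_mem (L.mul_mem_right _ ha) (L.add_mem (L.mul_mem_left _ hc) ?_)
    rw [show b * (m : R) * (d * n) = b * d * (m * n) by ring]
    exact L.mul_mem_left _ hmem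
  · intro x hx
    obtain ⟨u, v, huv⟩ := Nat.isCoprime_iff_coprime.mpr hmn
    have huv' : (u : R) * m + v * n = 1 := by exact_mod_cast congrArg (Int.cast : ℤ → R) huv
    have : x = (u * m) * x + x * (v * n) := by linear_combination -x * huv'
    rw [this]
    refine Ideal.add_mem _ (Ideal.mul_mem_mul ?_ ?_) (Ideal.mul_mem_mul ?_ ?_)
    · exact Ideal.mem_sup_right (Ideal.mul_mem_left _ _ (Ideal.mem_span_singleton_self _))
    · exact Ideal.mem_sup_left hx
    · exact Ideal.mem_sup_left hx
    · exact Ideal.mem_sup_right (Ideal.mul_mem_left _ _ (Ideal.mem_span_singleton_self _))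

lemma Ideal.card_absNorm_mul_of_coprime {m n : ℕ} (hmn : m.Coprime n) (hm : m ≠ 0) (hn : n ≠ 0) :
    Nat.card {I : Ideal R // Ideal.absNorm I = m * n} =
      Nat.card {I : Ideal R // Ideal.absNorm I = m} *
        Nat.card {I : Ideal R // Ideal.absNorm I = n} := by
  rw [← Nat.card_prod]
  symm
  refine Nat.card_congr (Equiv.ofBijective
    (fun p ↦ ⟨p.1.1 * p.2.1, by rw [map_mul, p.1.2, p.2.2]⟩) ⟨?_, ?_⟩)
  · rintro ⟨⟨I, hI⟩, ⟨J, hJ⟩⟩ ⟨⟨I', hI'⟩, ⟨J', hJ'⟩⟩ h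
    have h : I * J = I' * J' := congrArg Subtype.val h
    have e1 : I = I' := by
      rw [← Ideal.mul_sup_span_eq_left hmn hI hJ, h, Ideal.mul_sup_span_eq_left hmn hI' hJ']
    have e2 : J = J' := by
      rw [← Ideal.mul_sup_span_eq_left hmn.symm hJ hI, mul_comm, h, mul_comm,
        Ideal.mul_sup_span_eq_left hmn.symm hJ' hI']
    subst e1 e2
    rfl
  · rintro ⟨L, hL⟩
    have hprod := Ideal.sup_span_mul_sup_span hmn hL
    set I := L ⊔ Ideal.span {(m : R)} with hI
    set J := L ⊔ Ideal.span {(n : R)} with hJ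
    have hN : Ideal.absNorm I * Ideal.absNorm J = m * n := by rw [← map_mul, hprod, hL]
    have hdI : Ideal.absNorm I ∣ m ^ Module.finrank ℤ R := by
      rw [← Ideal.absNorm_span_natCast]
      exact Ideal.absNorm_dvd_absNorm_of_le le_sup_right
    have hdJ : Ideal.absNorm J ∣ n ^ Module.finrank ℤ R := by
      rw [← Ideal.absNorm_span_natCast]
      exact Ideal.absNorm_dvd_absNorm_of_le le_sup_right
    have h1 : Ideal.absNorm I ∣ m :=
      (Nat.Coprime.coprime_dvd_left hdI (hmn.pow_left _)).dvd_of_dvd_mul_right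
        (hN ▸ dvd_mul_right _ _)
    have h2 : Ideal.absNorm J ∣ n :=
      (Nat.Coprime.coprime_dvd_left hdJ (hmn.symm.pow_left _)).dvd_of_dvd_mul_left
        (hN ▸ dvd_mul_left _ _)
    have h3 := Nat.le_of_dvd (Nat.pos_of_ne_zero hm) h1
    have h4 := Nat.le_of_dvd (Nat.pos_of_ne_zero hn) h2
    have h5 : Ideal.absNorm I = m := by
      by_contra hne
      have : Ideal.absNorm I * Ideal.absNorm J < m * n :=
        Nat.mul_lt_mul_of_lt_of_le (lt_of_le_of_ne h3 hne) h4 (Nat.pos_of_ne_zero hn)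
      omega
    have h6 : Ideal.absNorm J = n := by
      rw [h5] at hN
      exact Nat.eq_of_mul_eq_mul_left (Nat.pos_of_ne_zero hm) hN
    exact ⟨⟨⟨I, h5⟩, ⟨J, h6⟩⟩, Subtype.ext hprod⟩

omit [Module.Finite ℤ R] in
lemma Ideal.dvd_span_pow_of_absNorm_eq {I : Ideal R} {p k : ℕ} (hI : Ideal.absNorm I = p ^ k) :
    I ∣ Ideal.span {(p : R)} ^ k := by
  rw [Ideal.span_singleton_pow, Ideal.dvd_iff_le, Ideal.span_singleton_le_iff_mem]
  have := Ideal.absNorm_mem I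
  rw [hI] at this
  exact_mod_cast this

omit [Module.Free ℤ R] [Module.Finite ℤ R] in
lemma Ideal.eq_pow_of_dvd_prime_pow {P I : Ideal R} (hP : Prime P) {n : ℕ} (h : I ∣ P ^ n) :
    ∃ i, I = P ^ i := by
  obtain ⟨i, -, hi⟩ := (dvd_prime_pow hP n).mp h
  exact ⟨i, associated_iff_eq.mp hi⟩

omit [Module.Finite ℤ R] in
lemma Ideal.card_absNorm_prime_pow_of_split {p : ℕ} (hp : p.Prime) {P Q : Ideal R}
    (hPQ : P * Q = Ideal.span {(p : R)}) (hP : Ideal.absNorm P = p) (hQ : Ideal.absNorm Q = p)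
    (hne : P ≠ Q) (k : ℕ) : Nat.card {I : Ideal R // Ideal.absNorm I = p ^ k} = k + 1 := by
  have hP0 : P ≠ ⊥ := by rintro rfl; simp at hP; exact hp.ne_zero hP.symm
  have hQ0 : Q ≠ ⊥ := by rintro rfl; simp at hQ; exact hp.ne_zero hQ.symm
  have hPp : Prime P := Ideal.prime_of_isPrime hP0 (Ideal.isPrime_of_irreducible_absNorm (hP ▸ hp))
  have hQp : Prime Q := Ideal.prime_of_isPrime hQ0 (Ideal.isPrime_of_irreducible_absNorm (hQ ▸ hp))
  have key (i j d : ℕ) (h : P ^ i * Q ^ (j + d + 1) = P ^ (i + d + 1) * Q ^ j) : False := by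
    rw [show P ^ i * Q ^ (j + d + 1) = P ^ i * Q ^ j * Q ^ (d + 1) by ring,
      show P ^ (i + d + 1) * Q ^ j = P ^ i * Q ^ j * P ^ (d + 1) by ring] at h
    have h2 : Q ^ (d + 1) = P ^ (d + 1) :=
      mul_left_cancel₀ (mul_ne_zero (pow_ne_zero _ hP0) (pow_ne_zero _ hQ0)) h
    have h3 : P ∣ Q := hPp.dvd_of_dvd_pow (h2 ▸ dvd_pow_self P (Nat.succ_ne_zero d))
    exact hne (associated_iff_eq.mp ((hPp.dvd_prime_iff_associated hQp).mp h3))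
  rw [← Nat.card_fin (k + 1)]
  symm
  refine Nat.card_congr (Equiv.ofBijective
    (fun i : Fin (k + 1) ↦ ⟨P ^ (i : ℕ) * Q ^ (k - i), ?_⟩) ⟨?_, ?_⟩)
  · rw [map_mul, map_pow, map_pow, hP, hQ, ← pow_add, Nat.add_sub_cancel' (Nat.lt_succ_iff.mp i.2)]
  · intro i j h
    have h : P ^ (i : ℕ) * Q ^ (k - i) = P ^ (j : ℕ) * Q ^ (k - j) := congrArg Subtype.val h
    have hi := i.2
    have hj := j.2
    rcases lt_trichotomy (i : ℕ) j with hij | hij | hij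
    · refine (key i (k - j) (j - i - 1) ?_).elim
      rw [show k - (j : ℕ) + (j - i - 1) + 1 = k - i by omega,
        show (i : ℕ) + (j - i - 1) + 1 = j by omega, h]
    · exact Fin.ext hij
    · refine (key j (k - i) (i - j - 1) ?_).elim
      rw [show k - (i : ℕ) + (i - j - 1) + 1 = k - j by omega,
        show (j : ℕ) + (i - j - 1) + 1 = i by omega, h]
  · rintro ⟨I, hI⟩
    have h1 := Ideal.dvd_span_pow_of_absNorm_eq hI
    rw [← hPQ, mul_pow] at h1
    obtain ⟨A, B, hA, hB, rfl⟩ := exists_dvd_and_dvd_of_dvd_mul h1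
    obtain ⟨i, rfl⟩ := Ideal.eq_pow_of_dvd_prime_pow hPp hA
    obtain ⟨j, rfl⟩ := Ideal.eq_pow_of_dvd_prime_pow hQp hB
    rw [map_mul, map_pow, map_pow, hP, hQ, ← pow_add] at hI
    have hk := Nat.pow_right_injective hp.two_le hI
    refine ⟨⟨i, by omega⟩, Subtype.ext ?_⟩
    simp only
    rw [show k - i = j by omega]

omit [Module.Finite ℤ R] in
lemma Ideal.card_absNorm_prime_pow_of_ramified {p : ℕ} (hp : p.Prime) {P : Ideal R}
    (hPP : P * P = Ideal.span {(p : R)}) (hP : Ideal.absNorm P = p) (k : ℕ) :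
    Nat.card {I : Ideal R // Ideal.absNorm I = p ^ k} = 1 := by
  have hP0 : P ≠ ⊥ := by rintro rfl; simp at hP; exact hp.ne_zero hP.symm
  have hPp : Prime P := Ideal.prime_of_isPrime hP0 (Ideal.isPrime_of_irreducible_absNorm (hP ▸ hp))
  rw [Nat.card_eq_one_iff_exists]
  refine ⟨⟨P ^ k, by rw [map_pow, hP]⟩, ?_⟩
  rintro ⟨I, hI⟩
  have h1 := Ideal.dvd_span_pow_of_absNorm_eq hI
  rw [← hPP, ← sq, ← pow_mul] at h1
  obtain ⟨i, rfl⟩ := Ideal.eq_pow_of_dvd_prime_pow hPp h1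
  rw [map_pow, hP] at hI
  have hk := Nat.pow_right_injective hp.two_le hI
  exact Subtype.ext (congrArg (P ^ ·) hk)

lemma Ideal.card_absNorm_prime_pow_of_inert {p : ℕ} (hp : p.Prime)
    (hfr : Module.finrank ℤ R = 2) (hP : Prime (Ideal.span {(p : R)})) (k : ℕ) :
    Nat.card {I : Ideal R // Ideal.absNorm I = p ^ k} = if Even k then 1 else 0 := by
  have hN : Ideal.absNorm (Ideal.span {(p : R)}) = p ^ 2 := by
    rw [Ideal.absNorm_span_natCast, hfr]
  have hI (I : Ideal R) (hI : Ideal.absNorm I = p ^ k) :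
      ∃ i, I = Ideal.span {(p : R)} ^ i ∧ k = 2 * i := by
    obtain ⟨i, rfl⟩ := Ideal.eq_pow_of_dvd_prime_pow hP (Ideal.dvd_span_pow_of_absNorm_eq hI)
    rw [map_pow, hN, ← pow_mul] at hI
    exact ⟨i, rfl, (Nat.pow_right_injective hp.two_le hI).symm⟩
  split_ifs with hk
  · obtain ⟨j, rfl⟩ := hk.two_dvd
    rw [Nat.card_eq_one_iff_exists]
    refine ⟨⟨Ideal.span {(p : R)} ^ j, by rw [map_pow, hN, pow_mul]⟩, ?_⟩
    rintro ⟨I, h⟩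
    obtain ⟨i, rfl, hi⟩ := hI I h
    simp [show i = j by omega]
  · rw [Nat.card_eq_zero]
    left
    refine ⟨fun ⟨I, h⟩ ↦ ?_⟩
    obtain ⟨i, -, hi⟩ := hI I h
    exact hk (hi ▸ even_two_mul i)

end idealCount

section splitting

variable {R : Type*} [CommRing R] [IsDedekindDomain R] [Module.Free ℤ R] [Module.Finite ℤ R]

lemma span_pair_mul_span_pair_eq_span_prime {p : ℕ} (hp : p.Prime)
    (hfr : Module.finrank ℤ R = 2) {θ : R} {m : ℤ} (hθ : θ * θ = θ - m)
    (hrep : ∀ x : R, ∃ u v : ℤ, x = u + v * θ)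
    (hind : ∀ u v : ℤ, (u : R) + v * θ = 0 → u = 0 ∧ v = 0)
    {c : ℤ} (hc : (p : ℤ) ∣ c * c - c + m)
    (hc' : ¬ (p : ℤ) ∣ 2 * c - 1 ∨ ¬ (p : ℤ) * p ∣ c * c - c + m) :
    Ideal.span {(p : R), θ - c} * Ideal.span {(p : R), θ - (1 - c : ℤ)} = Ideal.span {(p : R)} ∧
      Ideal.absNorm (Ideal.span {(p : R), θ - c}) = p ∧
      Ideal.absNorm (Ideal.span {(p : R), θ - (1 - c : ℤ)}) = p := by
  obtain ⟨g, hg⟩ := hc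
  have hpi : Prime (p : ℤ) := Nat.prime_iff_prime_int.mp hp
  have hgR : (c * c - c + m : R) = p * g := by exact_mod_cast congrArg (Int.cast : ℤ → R) hg
  have hprod : Ideal.span {(p : R), θ - c} * Ideal.span {(p : R), θ - (1 - c : ℤ)} =
      Ideal.span {(p : R)} := by
    rw [Ideal.span_pair_mul_span_pair]
    refine le_antisymm ?_ ?_
    · rw [Ideal.span_le]
      rintro x (rfl | rfl | rfl | rfl) <;>
        simp only [SetLike.mem_coe, Ideal.mem_span_singleton]
      · exact dvd_mul_right _ _
      · exact dvd_mul_right _ _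
      · exact dvd_mul_left _ _
      · refine ⟨-g, ?_⟩
        push_cast
        linear_combination hθ - hgR
    · rw [Ideal.span_singleton_le_iff_mem]
      set S := Ideal.span {(p : R) * p, (p : R) * (θ - (1 - c : ℤ)), (θ - c) * (p : R),
        (θ - c) * (θ - (1 - c : ℤ))} with hS
      have m1 : (p : R) * p ∈ S := Ideal.subset_span (by simp)
      have m2 : (p : R) * (θ - (1 - c : ℤ)) ∈ S := Ideal.subset_span (by simp)
      have m3 : (θ - c) * (p : R) ∈ S := Ideal.subset_span (by simp)
      have m4 : (θ - c) * (θ - (1 - c : ℤ)) ∈ S := Ideal.subset_span (by simp)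
      obtain ⟨t, ht, htS⟩ : ∃ t : ℤ, ¬ (p : ℤ) ∣ t ∧ (p : R) * t ∈ S := by
        rcases hc' with h | h
        · refine ⟨_, h, ?_⟩
          convert S.sub_mem m2 m3 using 1
          push_cast
          ring
        · refine ⟨g, fun h' ↦ h (hg ▸ mul_dvd_mul_left _ h'), ?_⟩
          convert S.neg_mem m4 using 1
          push_cast
          linear_combination -hgR + hθ
      obtain ⟨u, v, huv⟩ := (hpi.coprime_iff_not_dvd).mpr ht
      have huv' : (u : R) * p + v * t = 1 := by exact_mod_cast congrArg (Int.cast : ℤ → R) huv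
      have e : (p : R) = u * (p * p) + v * (p * t) := by linear_combination -(p : R) * huv'
      rw [e]
      exact S.add_mem (S.mul_mem_left _ m1) (S.mul_mem_left _ htS)
  have hnot (e : ℤ) : Ideal.span {(p : R), θ - e} ≠ Ideal.span {(p : R)} := by
    intro h
    have h1 : θ - e ∈ Ideal.span {(p : R)} := h ▸ Ideal.subset_span (by simp)
    obtain ⟨y, hy⟩ := Ideal.mem_span_singleton.mp h1
    obtain ⟨u, v, rfl⟩ := hrep y
    have := hind (-e - p * u) (1 - p * v) (by push_cast; linear_combination hy)
    have h2 : (p : ℤ) ∣ 1 := ⟨v, by linarith [this.2]⟩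
    exact hpi.not_isUnit (isUnit_of_dvd_one h2)
  have hN := congrArg Ideal.absNorm hprod
  rw [map_mul, Ideal.absNorm_span_natCast, hfr] at hN
  refine ⟨hprod, (Nat.Prime.mul_eq_prime_sq_iff hp ?_ ?_).mp hN⟩
  · rw [Ne, Ideal.absNorm_eq_one_iff]
    intro h
    rw [h, Ideal.top_mul] at hprod
    exact hnot _ hprod
  · rw [Ne, Ideal.absNorm_eq_one_iff]
    intro h
    rw [h, Ideal.mul_top] at hprod
    exact hnot _ hprod

lemma prime_span_of_inert {p : ℕ} (hp : p.Prime)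
    (hfr : Module.finrank ℤ R = 2) {θ : R} {m : ℤ} (hθ : θ * θ = θ - m)
    (hc : ∀ c : ℤ, ¬ (p : ℤ) ∣ c * c - c + m) : Prime (Ideal.span {(p : R)}) := by
  have hN : Ideal.absNorm (Ideal.span {(p : R)}) = p ^ 2 := by
    rw [Ideal.absNorm_span_natCast, hfr]
  have hne : Ideal.span {(p : R)} ≠ ⊤ := by
    intro h
    rw [h, Ideal.absNorm_top] at hN
    exact hp.one_lt.ne' (Nat.pow_eq_one.mp hN.symm |>.resolve_right (by norm_num))
  obtain ⟨P, hPm, hle⟩ := Ideal.exists_le_maximal _ hne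
  have hpP : (p : R) ∈ P := hle (Ideal.mem_span_singleton_self _)
  obtain ⟨J, hJ⟩ := Ideal.dvd_iff_le.mpr hle
  have hNJ : Ideal.absNorm P * Ideal.absNorm J = p ^ 2 := by rw [← map_mul, ← hJ, hN]
  have hP1 : Ideal.absNorm P ≠ 1 := by
    rw [Ne, Ideal.absNorm_eq_one_iff]
    exact hPm.ne_top
  have hPp : Ideal.absNorm P ≠ p := by
    intro h
    have := Fact.mk hp
    have hcard : Nat.card (R ⧸ P) = p := by
      rw [← h, Ideal.absNorm_apply]
      rfl
    have h1 : (1 : R ⧸ P) ≠ 0 := by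
      have := Ideal.Quotient.nontrivial_iff.mpr hPm.ne_top
      exact one_ne_zero
    obtain ⟨c, hcc⟩ := AddSubgroup.mem_zmultiples_iff.mp
      (mem_zmultiples_of_prime_card hcard h1 (g' := Ideal.Quotient.mk P θ))
    have h2 : θ - c ∈ P := by
      rw [← Ideal.Quotient.eq_zero_iff_mem, map_sub, ← hcc]
      simp
    have h3 : ((c * c - c + m : ℤ) : R) ∈ P := by
      have := P.neg_mem (P.mul_mem_right (θ - (1 - c)) h2)
      convert this using 1
      push_cast
      linear_combination hθ
    have h4 : (c * c - c + m : ℤ) ∈ P.comap (algebraMap ℤ R) := by simpa using h3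
    rw [← Ideal.span_singleton_absNorm (h ▸ hp), h, Ideal.mem_span_singleton] at h4
    exact hc c h4
  have hJ1 : J = ⊤ := by
    rw [← Ideal.absNorm_eq_one_iff]
    by_contra h
    exact hPp ((Nat.Prime.mul_eq_prime_sq_iff hp hP1 h).mp hNJ).1
  rw [hJ, hJ1, Ideal.mul_top]
  refine Ideal.prime_of_isPrime ?_ hPm.isPrime
  rintro rfl
  simp at hNJ
  exact hp.ne_zero (pow_eq_zero_iff two_ne_zero |>.mp hNJ.symm)

end splitting

lemma jacobiSym_eq_jacobiSym_neg_of_mod_four {p q : ℕ} (hp : Odd p) (hq : q % 4 = 3) :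
    jacobiSym p q = jacobiSym (-q) p := by
  have hqo : Odd q := Nat.odd_iff.mpr (by omega)
  rw [jacobiSym.neg _ hp]
  rcases Nat.odd_mod_four_iff.mp (Nat.odd_iff.mp hp) with h | h
  · rw [ZMod.χ₄_nat_one_mod_four h, one_mul, jacobiSym.quadratic_reciprocity_one_mod_four h hqo]
  · rw [ZMod.χ₄_nat_three_mod_four h, jacobiSym.quadratic_reciprocity_three_mod_four h hq]
    ring

lemma exists_root_of_jacobiSym_eq_one {p q : ℕ} (hp : p.Prime) (hq : q % 4 = 3) {m : ℤ}
    (hm : 4 * m = q + 1) (h : jacobiSym p q = 1) :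
    ∃ c : ℤ, (p : ℤ) ∣ c * c - c + m ∧ ¬ (p : ℤ) ∣ 2 * c - 1 := by
  rcases hp.eq_two_or_odd' with rfl | hpo
  · refine ⟨0, ?_, by norm_num⟩
    have := jacobiSym.at_two (Nat.odd_iff.mpr (by omega : q % 2 = 1))
    rw [Nat.cast_ofNat] at h
    rw [h, ZMod.χ₈_nat_eq_if_mod_eight] at this
    have h8 : q % 8 = 7 := by
      by_contra h8
      rw [if_neg (by omega), if_neg (by omega)] at this
      norm_num at this
    push_cast
    omega
  · have := Fact.mk hp
    rw [jacobiSym_eq_jacobiSym_neg_of_mod_four hpo hq, ← jacobiSym.legendreSym.to_jacobiSym] at h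
    have h0 : ((-q : ℤ) : ZMod p) ≠ 0 := by
      intro h0
      rw [(legendreSym.eq_zero_iff _ _).mpr h0] at h
      norm_num at h
    obtain ⟨x, hx⟩ := (legendreSym.eq_one_iff p h0).mp h
    have h2 : (2 : ZMod p) ≠ 0 := by
      intro h2
      have := (ZMod.natCast_eq_zero_iff 2 p).mp (by exact_mod_cast h2)
      have := (Nat.prime_dvd_prime_iff_eq hp Nat.prime_two).mp this
      subst this
      exact (by decide : ¬ Odd 2) hpo
    obtain ⟨c, hc⟩ := ZMod.intCast_surjective ((1 + x) / 2)
    have hm' : (4 * m : ZMod p) = q + 1 := by exact_mod_cast congrArg (Int.cast : ℤ → ZMod p) hm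
    have hc2 : (2 * c - 1 : ZMod p) = x := by
      rw [hc]
      field_simp
      ring
    push_cast at hx
    refine ⟨c, ?_, ?_⟩
    · rw [← ZMod.intCast_zmod_eq_zero_iff_dvd]
      push_cast
      have : (2 * 2 : ZMod p) * (c * c - c + m) = 0 := by
        linear_combination hm' - hx + (2 * c - 1 + x) * hc2
      exact (mul_eq_zero.mp this).resolve_left (mul_ne_zero h2 h2)
    · rw [← ZMod.intCast_zmod_eq_zero_iff_dvd]
      push_cast
      rw [hc2]
      rintro rfl
      push_cast at h0
      exact h0 (by simpa using hx)

lemma exists_root_of_jacobiSym_eq_zero {p q : ℕ} (hp : p.Prime)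
    (hsq : Squarefree q) {m : ℤ} (hm : 4 * m = q + 1) (h : jacobiSym p q = 0) :
    ∃ c : ℤ, (p : ℤ) ∣ c * c - c + m ∧ (p : ℤ) ∣ 2 * c - 1 ∧ ¬ (p : ℤ) * p ∣ c * c - c + m := by
  have hpq : p ∣ q := by
    by_contra hpq
    have : Int.gcd p q = 1 := by
      rw [Int.gcd_natCast_natCast]
      exact (Nat.Prime.coprime_iff_not_dvd hp).mpr hpq
    exact jacobiSym.ne_zero this h
  have hc : (2 : ℤ) * m * (2 * m) - 2 * m + m = q * m := by linear_combination m * hm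
  have hpq' : (p : ℤ) ∣ q := by exact_mod_cast hpq
  refine ⟨2 * m, ?_, ?_, ?_⟩
  · rw [hc]
    exact hpq'.mul_right _
  · rw [show 2 * (2 * m) - 1 = (q : ℤ) by linarith]
    exact hpq'
  · rw [hc]
    intro hd
    have hcop : IsCoprime ((p : ℤ) * p) m := by
      have : IsCoprime (q : ℤ) m := ⟨-1, 4, by linarith⟩
      exact (this.of_isCoprime_of_dvd_left hpq').mul_left (this.of_isCoprime_of_dvd_left hpq')
    have := hcop.dvd_of_dvd_mul_right hd
    have h2 := hsq p (by exact_mod_cast this)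
    exact hp.one_lt.ne' (Nat.isUnit_iff.mp h2)

lemma not_dvd_of_jacobiSym_eq_neg_one {p q : ℕ} (hp : p.Prime) (hq : q % 4 = 3) {m : ℤ}
    (hm : 4 * m = q + 1) (h : jacobiSym p q = -1) (c : ℤ) : ¬ (p : ℤ) ∣ c * c - c + m := by
  intro hd
  rcases hp.eq_two_or_odd' with rfl | hpo
  · have := jacobiSym.at_two (Nat.odd_iff.mpr (by omega : q % 2 = 1))
    rw [Nat.cast_ofNat] at h
    rw [h, ZMod.χ₈_nat_eq_if_mod_eight, if_neg (by omega)] at this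
    have h8 : q % 8 = 3 := by
      by_contra h8
      rw [if_pos (by omega)] at this
      norm_num at this
    have he : (2 : ℤ) ∣ c * c - c := by
      have := Int.even_mul_pred_self c
      rw [show c * c - c = c * (c - 1) by ring]
      exact this.two_dvd
    push_cast at hd
    omega
  · have := Fact.mk hp
    rw [jacobiSym_eq_jacobiSym_neg_of_mod_four hpo hq, ← jacobiSym.legendreSym.to_jacobiSym,
      legendreSym.eq_neg_one_iff] at h
    refine h ⟨2 * c - 1, ?_⟩
    rw [← ZMod.intCast_zmod_eq_zero_iff_dvd] at hd
    have hm' : (4 * m : ZMod p) = q + 1 := by exact_mod_cast congrArg (Int.cast : ℤ → ZMod p) hm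
    push_cast at hd ⊢
    linear_combination -4 * hd + hm'

section coefficients

variable {R : Type*} [CommRing R] [IsDedekindDomain R] [Module.Free ℤ R] [Module.Finite ℤ R]

lemma card_absNorm_prime_pow_eq_sum {q p : ℕ} (hp : p.Prime) (hq : q % 4 = 3)
    (hsq : Squarefree q) (hfr : Module.finrank ℤ R = 2) {θ : R} {m : ℤ} (hm : 4 * m = q + 1)
    (hθ : θ * θ = θ - m) (hrep : ∀ x : R, ∃ u v : ℤ, x = u + v * θ)
    (hind : ∀ u v : ℤ, (u : R) + v * θ = 0 → u = 0 ∧ v = 0) (k : ℕ) :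
    (Nat.card {I : Ideal R // Ideal.absNorm I = p ^ k} : ℤ) =
      ∑ i ∈ range (k + 1), jacobiSym p q ^ i := by
  have hneg (I : Ideal R) (x y : R) (hx : x ∈ I) (hxy : x - y ∈ I) : y ∈ I := by
    simpa using I.sub_mem hx hxy
  rcases jacobiSym.trichotomy p q with h | h | h
  · obtain ⟨c, h1, h2, h3⟩ := exists_root_of_jacobiSym_eq_zero hp hsq hm h
    obtain ⟨hPQ, hP, hQ⟩ := span_pair_mul_span_pair_eq_span_prime hp hfr hθ hrep hind h1 (Or.inr h3)
    have e : Ideal.span {(p : R), θ - c} = Ideal.span {(p : R), θ - (1 - c : ℤ)} := by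
      obtain ⟨t, ht⟩ := h2
      have ht' : (2 * c - 1 : R) = p * t := by exact_mod_cast congrArg (Int.cast : ℤ → R) ht
      refine le_antisymm ?_ ?_ <;> rw [Ideal.span_le, Set.insert_subset_iff,
          Set.singleton_subset_iff] <;> refine ⟨Ideal.subset_span (by simp), ?_⟩
      · rw [SetLike.mem_coe, Ideal.mem_span_pair]
        refine ⟨-t, 1, ?_⟩
        push_cast
        linear_combination ht'
      · rw [SetLike.mem_coe, Ideal.mem_span_pair]
        refine ⟨t, 1, ?_⟩
        push_cast
        linear_combination -ht'
    rw [← e] at hPQ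
    rw [Ideal.card_absNorm_prime_pow_of_ramified hp hPQ hP, h, Finset.sum_range_succ']
    simp
  · obtain ⟨c, h1, h2⟩ := exists_root_of_jacobiSym_eq_one hp hq hm h
    obtain ⟨hPQ, hP, hQ⟩ := span_pair_mul_span_pair_eq_span_prime hp hfr hθ hrep hind h1 (Or.inl h2)
    rw [Ideal.card_absNorm_prime_pow_of_split hp hPQ hP hQ, h]
    · simp
    · intro e
      obtain ⟨u, v, huv⟩ := ((Nat.prime_iff_prime_int.mp hp).coprime_iff_not_dvd).mpr h2
      have huv' : (u : R) * p + v * (2 * c - 1) = 1 := by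
        exact_mod_cast congrArg (Int.cast : ℤ → R) huv
      set P := Ideal.span {(p : R), θ - c} with hPdef
      have m1 : (p : R) ∈ P := Ideal.subset_span (by simp)
      have m2 : θ - c ∈ P := Ideal.subset_span (by simp)
      have m3 : θ - (1 - c : ℤ) ∈ P := e ▸ Ideal.subset_span (by simp)
      have : (1 : R) ∈ P := by
        have := P.add_mem (P.mul_mem_left (u : R) m1) (P.mul_mem_left (v : R) (P.sub_mem m3 m2))
        convert this using 1
        push_cast
        linear_combination -huv'
      rw [(Ideal.eq_top_iff_one P).mpr this, Ideal.absNorm_top] at hP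
      exact hp.one_lt.ne hP
  · have hin := prime_span_of_inert hp hfr hθ (not_dvd_of_jacobiSym_eq_neg_one hp hq hm h)
    rw [Ideal.card_absNorm_prime_pow_of_inert hp hfr hin, h, neg_one_geom_sum]
    rcases Nat.even_or_odd k with hk | hk
    · simp [hk, Nat.even_add_one]
    · simp [Nat.not_even_iff_odd.mpr hk, Nat.even_add_one]

lemma card_absNorm_eq_zetaMul {q : ℕ} {χ : DirichletCharacter ℂ q}
    (hχ : ∀ n : ℤ, χ (n : ZMod q) = jacobiSym n q) (hq : q % 4 = 3)
    (hsq : Squarefree q) (hfr : Module.finrank ℤ R = 2) {θ : R} {m : ℤ} (hm : 4 * m = q + 1)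
    (hθ : θ * θ = θ - m) (hrep : ∀ x : R, ∃ u v : ℤ, x = u + v * θ)
    (hind : ∀ u v : ℤ, (u : R) + v * θ = 0 → u = 0 ∧ v = 0) {n : ℕ} (hn : n ≠ 0) :
    (Nat.card {I : Ideal R // Ideal.absNorm I = n} : ℂ) = χ.zetaMul n := by
  let f : ArithmeticFunction ℂ :=
    ⟨fun n ↦ if n = 0 then 0 else (Nat.card {I : Ideal R // Ideal.absNorm I = n} : ℂ), by simp⟩
  have hf (n : ℕ) (hn : n ≠ 0) : f n = Nat.card {I : Ideal R // Ideal.absNorm I = n} := if_neg hn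
  have hfm : f.IsMultiplicative := by
    rw [ArithmeticFunction.IsMultiplicative.iff_ne_zero]
    constructor
    · rw [hf 1 one_ne_zero]
      have : Nat.card {I : Ideal R // Ideal.absNorm I = 1} = 1 := by
        rw [Nat.card_eq_one_iff_exists]
        refine ⟨⟨⊤, Ideal.absNorm_top⟩, fun I ↦ Subtype.ext ?_⟩
        exact Ideal.absNorm_eq_one_iff.mp I.2
      rw [this, Nat.cast_one]
    · intro m n hm hn hmn
      rw [hf _ (mul_ne_zero hm hn), hf _ hm, hf _ hn, Ideal.card_absNorm_mul_of_coprime hmn hm hn]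
      push_cast
      rfl
  have hz := χ.isMultiplicative_zetaMul
  rw [← hf n hn]
  congr 1
  rw [ArithmeticFunction.IsMultiplicative.eq_iff_eq_on_prime_powers f hfm _ hz]
  intro p k hp
  rw [hf _ (pow_ne_zero _ hp.ne_zero)]
  have h1 := card_absNorm_prime_pow_eq_sum hp hq hsq hfr hm hθ hrep hind k
  have h2 := congrArg (Int.cast : ℤ → ℂ) h1
  rw [Int.cast_natCast] at h2
  rw [h2, DirichletCharacter.zetaMul, ArithmeticFunction.coe_zeta_mul_apply,
    Nat.sum_divisors_prime_pow hp]
  push_cast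
  refine Finset.sum_congr rfl fun i _ ↦ ?_
  have h3 := hχ p
  rw [Int.cast_natCast] at h3
  simp only [toArithmeticFunction, ArithmeticFunction.coe_mk]
  rw [if_neg (pow_ne_zero _ hp.ne_zero)]
  push_cast
  rw [map_pow, h3]

end coefficients

open NumberField in
lemma dedekindZeta_residue_eq_LFunction_one {K : Type*} [Field K] [NumberField K]
    {q : ℕ} [NeZero q] {χ : DirichletCharacter ℂ q} (hχ1 : χ ≠ 1)
    (hK : ∀ n : ℕ, n ≠ 0 →
      (Nat.card {I : Ideal (𝓞 K) // Ideal.absNorm I = n} : ℂ) = χ.zetaMul n) :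
    (dedekindZeta_residue K : ℂ) = DirichletCharacter.LFunction χ 1 := by
  have h2 : Filter.Tendsto (fun s : ℝ ↦ ((s : ℂ) - 1) * riemannZeta s)
      (nhdsWithin 1 (Set.Ioi 1)) (nhds 1) := by
    have := riemannZeta_residue_one
    refine this.comp ?_
    refine tendsto_nhdsWithin_iff.mpr ⟨?_, ?_⟩
    · have := continuous_ofReal.tendsto (1 : ℝ)
      rw [ofReal_one] at this
      exact tendsto_nhdsWithin_of_tendsto_nhds this
    · filter_upwards [self_mem_nhdsWithin] with s hs
      have : s ≠ 1 := ne_of_gt hs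
      simpa using this
  have h3 : Filter.Tendsto (fun s : ℝ ↦ DirichletCharacter.LFunction χ s)
      (nhdsWithin 1 (Set.Ioi 1)) (nhds (DirichletCharacter.LFunction χ 1)) := by
    refine tendsto_nhdsWithin_of_tendsto_nhds ?_
    have := ((DirichletCharacter.differentiable_LFunction hχ1).continuous.comp
      continuous_ofReal).tendsto 1
    simpa [Function.comp_def] using this
  have h4 := h2.mul h3
  rw [one_mul] at h4
  refine tendsto_nhds_unique (tendsto_sub_one_mul_dedekindZeta_nhdsGT K) (h4.congr' ?_)
  filter_upwards [self_mem_nhdsWithin] with s hs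
  have hre : 1 < (s : ℂ).re := by simpa using hs
  have e1 : dedekindZeta K s = LSeries χ.zetaMul s := LSeries_congr (fun {n} hn ↦ hK n hn) _
  have e2 : DirichletCharacter.LFunction χ s =
      LSeries (toArithmeticFunction (fun n : ℕ ↦ χ (n : ZMod q))) s := by
    rw [DirichletCharacter.LFunction_eq_LSeries χ hre]
    refine LSeries_congr (fun {n} hn ↦ ?_) _
    simp [toArithmeticFunction, hn]
  rw [e1, e2, DirichletCharacter.zetaMul, ArithmeticFunction.LSeries_mul', ← mul_assoc]
  · congr 2
    exact (ArithmeticFunction.LSeries_zeta_eq_riemannZeta hre).symm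
  · exact ArithmeticFunction.LSeriesSummable_zeta_iff.mpr hre
  · refine LSeriesSummable_of_bounded_of_one_lt_re (m := 1) (fun n hn ↦ ?_) hre
    simpa only [toArithmeticFunction, ArithmeticFunction.coe_mk, hn, if_false] using χ.norm_le_one _

section quadratic_field

open NumberField

variable {K : Type*} [Field K] [NumberField K] {q : ℕ} {m : ℤ} {θ : 𝓞 K}

lemma finrank_eq_two_of_quadratic_basis (hrep : ∀ x : 𝓞 K, ∃ u v : ℤ, x = u + v * θ)
    (hind : ∀ u v : ℤ, (u : 𝓞 K) + v * θ = 0 → u = 0 ∧ v = 0) (hθ : θ * θ = θ - m) :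
    Module.finrank ℤ (𝓞 K) = 2 ∧ discr K = 1 - 4 * m := by
  have hli : LinearIndependent ℤ ![(1 : 𝓞 K), θ] := by
    rw [LinearIndependent.pair_iff]
    intro s t h
    exact hind s t (by simpa [zsmul_eq_mul] using h)
  have hsp : ⊤ ≤ Submodule.span ℤ (Set.range ![(1 : 𝓞 K), θ]) := by
    intro x _
    obtain ⟨u, v, rfl⟩ := hrep x
    simp only [Matrix.range_cons, Matrix.range_empty, Set.union_empty]
    have := Submodule.mem_span_pair (R := ℤ) (x := (1 : 𝓞 K)) (y := θ) (z := u + v * θ)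
    refine this.2 ⟨u, v, by simp [zsmul_eq_mul]⟩
  let b : Module.Basis (Fin 2) ℤ (𝓞 K) := Module.Basis.mk hli hsp
  have b0 : b 0 = 1 := by simp [b]
  have b1 : b 1 = θ := by simp [b]
  refine ⟨by rw [Module.finrank_eq_card_basis b]; simp, ?_⟩
  have repr (u v : ℤ) : b.repr (u + v * θ) = Finsupp.single 0 u + Finsupp.single 1 v := by
    rw [← b.repr.apply_symm_apply (Finsupp.single 0 u + Finsupp.single 1 v)]
    congr 1
    simp [b0, b1, zsmul_eq_mul]
  have tr (u v : ℤ) : Algebra.trace ℤ (𝓞 K) (u + v * θ) = 2 * u + v := by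
    rw [Algebra.trace_eq_matrix_trace b, Matrix.trace_fin_two, Algebra.leftMulMatrix_eq_repr_mul,
      Algebra.leftMulMatrix_eq_repr_mul, b0, b1, mul_one]
    have e : ((u : 𝓞 K) + v * θ) * θ = ((-(v * m) : ℤ) : 𝓞 K) + ((u + v : ℤ) : 𝓞 K) * θ := by
      push_cast
      linear_combination (v : 𝓞 K) * hθ
    rw [e, repr, repr]
    simp
    ring
  rw [← discr_eq_discr K b, Algebra.discr_def, Matrix.det_fin_two]
  simp only [Algebra.traceMatrix_apply, Algebra.traceForm_apply, b0, b1]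
  have t1 := tr 1 0
  have t2 := tr 0 1
  have t3 := tr (-m) 1
  simp only [Int.cast_one, Int.cast_zero, zero_mul, add_zero, one_mul, zero_add, mul_one,
    Int.cast_neg, mul_zero] at t1 t2 t3 ⊢
  have e : θ * θ = -(m : 𝓞 K) + θ := by rw [hθ]; ring
  rw [e, t1, t2, t3]
  ring

lemma embedding_quadratic (hm : 4 * m = q + 1) (hθ : θ * θ = θ - m) (φ : K →+* ℂ) :
    (φ θ).re = 1 / 2 ∧ (φ θ).im ^ 2 = q / 4 ∨ q = 0 := by
  rcases Nat.eq_zero_or_pos q with h | h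
  · exact Or.inr h
  left
  have hm' : (4 : ℝ) * m = q + 1 := by exact_mod_cast hm
  have h1 : φ θ * φ θ = φ θ - m := by
    rw [← map_mul, ← map_mul, hθ]
    simp
  have h2 := congrArg Complex.re h1
  have h3 := congrArg Complex.im h1
  simp at h2 h3
  set x := (φ θ).re
  set y := (φ θ).im
  have h0 : (0 : ℝ) < q := by exact_mod_cast h
  have h4 : y * (2 * x - 1) = 0 := by linarith
  rcases mul_eq_zero.1 h4 with h5 | h5
  · rw [h5] at h2
    nlinarith [sq_nonneg (2 * x - 1)]
  · have : x = 1 / 2 := by linarith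
    refine ⟨this, ?_⟩
    rw [this] at h2
    nlinarith

lemma isTotallyComplex_of_quadratic (h0 : q ≠ 0) (hm : 4 * m = q + 1) (hθ : θ * θ = θ - m) :
    IsTotallyComplex K where
  isComplex v := by
    rw [← InfinitePlace.not_isReal_iff_isComplex]
    rintro ⟨φ, hφ, -⟩
    obtain ⟨-, h⟩ := (embedding_quadratic hm hθ φ).resolve_right h0
    have h1 : (φ θ).im = 0 := by
      have := RingHom.congr_fun hφ (θ : K)
      exact Complex.conj_eq_iff_im.1 this
    rw [h1] at h
    have : (q : ℝ) ≠ 0 := by exact_mod_cast h0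
    apply this
    linarith

lemma torsionOrder_eq_two_of_quadratic (h4 : 4 < q) (hm : 4 * m = q + 1) (hθ : θ * θ = θ - m)
    (hrep : ∀ x : 𝓞 K, ∃ u v : ℤ, x = u + v * θ) :
    Units.torsionOrder K = 2 := by
  have key (x : Units.torsion K) : (x : (𝓞 K)ˣ) = 1 ∨ (x : (𝓞 K)ˣ) = -1 := by
    obtain ⟨φ⟩ := (inferInstance : Nonempty (K →+* ℂ))
    obtain ⟨hr, hi⟩ := (embedding_quadratic hm hθ φ).resolve_right (by omega)
    obtain ⟨u, v, huv⟩ := hrep ((x : (𝓞 K)ˣ) : 𝓞 K)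
    have hn : ‖φ (((x : (𝓞 K)ˣ) : 𝓞 K) : K)‖ = 1 := by
      have := (Units.mem_torsion K).1 x.2 (InfinitePlace.mk φ)
      simpa [InfinitePlace.apply] using this
    rw [huv] at hn
    have hn2 : Complex.normSq (u + v * φ θ) = 1 := by
      rw [Complex.normSq_eq_norm_sq]
      simp at hn
      rw [hn]; norm_num
    rw [Complex.normSq_apply] at hn2
    simp at hn2
    rw [hr] at hn2
    have h5 : ((2 * u + v) ^ 2 + q * v ^ 2 : ℝ) = 4 := by nlinarith
    have h6 : (2 * u + v) ^ 2 + q * v ^ 2 = 4 := by exact_mod_cast h5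
    have hq : (4 : ℤ) < q := by exact_mod_cast h4
    have hv : v = 0 := by
      by_contra hv
      have : 0 < v ^ 2 := by positivity
      nlinarith [sq_nonneg (2 * u + v)]
    subst hv
    have hu : u ^ 2 = 1 := by nlinarith
    rcases sq_eq_sq_iff_eq_or_eq_neg.1 (hu.trans (one_pow 2).symm) with rfl | rfl
    · left; ext; simp [huv]
    · right; ext; simp [huv]
  let := Fintype.ofFinite (Units.torsion K)
  rw [Units.torsionOrder, Nat.card_eq_fintype_card]
  refine (Finset.card_eq_two.2 ⟨1, ⟨-1, neg_one_mem_torsion⟩,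
    by simp [← Subtype.coe_ne_coe], Finset.ext fun x ↦ ⟨fun _ ↦ ?_, fun _ ↦ Finset.mem_univ _⟩⟩)
  rw [Finset.mem_insert, Finset.mem_singleton, ← Subtype.val_inj, ← Subtype.val_inj]
  exact key x

lemma regulator_eq_one_of_rank_eq_zero (h : Units.rank K = 0) : Units.regulator K = 1 := by
  rw [Units.regulator_eq_det']
  have : IsEmpty (Fin (Units.rank K)) := by rw [h]; infer_instance
  have : IsEmpty {w : InfinitePlace K // w ≠ Units.dirichletUnitTheorem.w₀} :=
    (Units.equivFinRank (K := K)).symm.isEmpty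
  rw [Matrix.det_isEmpty]
  simp

lemma dedekindZeta_residue_of_quadratic (h4 : 4 < q) (hm : 4 * m = q + 1) (hθ : θ * θ = θ - m)
    (hrep : ∀ x : 𝓞 K, ∃ u v : ℤ, x = u + v * θ)
    (hind : ∀ u v : ℤ, (u : 𝓞 K) + v * θ = 0 → u = 0 ∧ v = 0) :
    dedekindZeta_residue K = Real.pi / Real.sqrt q * classNumber K := by
  obtain ⟨hf, hd⟩ := finrank_eq_two_of_quadratic_basis hrep hind hθ
  have := isTotallyComplex_of_quadratic (by omega) hm hθ
  rw [RingOfIntegers.rank] at hf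
  have hc : InfinitePlace.nrComplexPlaces K = 1 := by
    have := IsTotallyComplex.finrank (K := K)
    omega
  have hr : InfinitePlace.nrRealPlaces K = 0 := IsTotallyComplex.nrRealPlaces_eq_zero K
  have hrank : Units.rank K = 0 := by
    rw [Units.rank, InfinitePlace.card_eq_nrRealPlaces_add_nrComplexPlaces, hc, hr]
  rw [dedekindZeta_residue_def, hc, hr, regulator_eq_one_of_rank_eq_zero hrank,
    torsionOrder_eq_two_of_quadratic h4 hm hθ hrep, hd]
  have : |((1 - 4 * m : ℤ) : ℝ)| = q := by rw [hm]; simp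
  rw [this]
  have : Real.sqrt q ≠ 0 := by
    rw [Real.sqrt_ne_zero']
    exact_mod_cast (by omega : 0 < q)
  push_cast
  field_simp

end quadratic_field

section imaginary_quadratic

open NumberField IntermediateField

variable {q : ℕ}

lemma I_mul_sqrt_sq (q : ℕ) : (I * (Real.sqrt q : ℂ)) ^ 2 = -(q : ℂ) := by
  rw [mul_pow, I_sq, ← ofReal_pow, Real.sq_sqrt (Nat.cast_nonneg q)]
  simp

lemma isIntegral_I_mul_sqrt (q : ℕ) (A : Type*) [CommRing A] [Algebra A ℂ] :
    IsIntegral A (I * (Real.sqrt q : ℂ)) := by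
  apply IsIntegral.of_pow (n := 2) (by norm_num)
  rw [I_mul_sqrt_sq]
  have := (isIntegral_algebraMap (R := A) (A := ℂ) (x := (q : A))).neg
  rwa [map_natCast] at this

lemma numberField_adjoin_I_mul_sqrt (q : ℕ) : NumberField ℚ⟮(I * (Real.sqrt q : ℂ) : ℂ)⟯ where
  to_charZero := inferInstance
  to_finiteDimensional := adjoin.finiteDimensional (isIntegral_I_mul_sqrt q ℚ)

lemma mem_adjoin_I_mul_sqrt {z : ℂ} (hz : z ∈ ℚ⟮(I * (Real.sqrt q : ℂ) : ℂ)⟯) :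
    ∃ r s : ℚ, z = r + s * (I * (Real.sqrt q : ℂ)) := by
  have h := (IntermediateField.adjoin_simple_toSubalgebra_of_isAlgebraic
    (isIntegral_I_mul_sqrt q ℚ).isAlgebraic)
  have hz' : z ∈ Algebra.adjoin ℚ {(I * (Real.sqrt q : ℂ) : ℂ)} := by
    rw [← h]; exact hz
  clear hz
  induction hz' using Algebra.adjoin_induction with
  | mem x hx => exact ⟨0, 1, by simp at hx; simp [hx]⟩
  | algebraMap r => exact ⟨r, 0, by simp⟩
  | add x y hx hy ihx ihy =>
    obtain ⟨r, s, rfl⟩ := ihx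
    obtain ⟨t, u, rfl⟩ := ihy
    exact ⟨r + t, s + u, by push_cast; ring⟩
  | mul x y hx hy ihx ihy =>
    obtain ⟨r, s, rfl⟩ := ihx
    obtain ⟨t, u, rfl⟩ := ihy
    refine ⟨r * t - q * s * u, r * u + s * t, ?_⟩
    push_cast
    linear_combination (s : ℂ) * u * I_mul_sqrt_sq q

/-- An algebraic integer `r + s √-q` is an integer combination of `1` and `(1 + √-q) / 2`. -/
lemma exists_int_of_isIntegral_add (hsq : Squarefree q) {r s : ℚ} (hq : q % 4 = 3)
    (h : IsIntegral ℤ ((r : ℂ) + s * (I * (Real.sqrt q : ℂ)))) :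
    ∃ u v : ℤ, (r : ℂ) + s * (I * (Real.sqrt q : ℂ)) =
      u + v * ((1 + I * (Real.sqrt q : ℂ)) / 2) := by
  have h' : IsIntegral ℤ ((r : ℂ) - s * (I * (Real.sqrt q : ℂ))) := by
    have := h.map (Complex.conjAe.toAlgHom.restrictScalars ℤ)
    simpa [sub_eq_add_neg] using this
  have hA : IsIntegral ℤ (2 * r : ℚ) := by
    have := h.add h'
    rw [show ((r : ℂ) + s * (I * (Real.sqrt q : ℂ))) + ((r : ℂ) - s * (I * (Real.sqrt q : ℂ))) =
      algebraMap ℚ ℂ (2 * r) by simp; ring] at this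
    exact (isIntegral_algebraMap_iff (algebraMap ℚ ℂ).injective).1 this
  have hB : IsIntegral ℤ (r ^ 2 + q * s ^ 2 : ℚ) := by
    have := h.mul h'
    rw [show ((r : ℂ) + s * (I * (Real.sqrt q : ℂ))) * ((r : ℂ) - s * (I * (Real.sqrt q : ℂ))) =
      algebraMap ℚ ℂ (r ^ 2 + q * s ^ 2) by
        simp; linear_combination -(s : ℂ) ^ 2 * I_mul_sqrt_sq q] at this
    exact (isIntegral_algebraMap_iff (algebraMap ℚ ℂ).injective).1 this
  obtain ⟨A, hA⟩ := IsIntegrallyClosed.isIntegral_iff.1 hA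
  obtain ⟨B, hB⟩ := IsIntegrallyClosed.isIntegral_iff.1 hB
  simp at hA hB
  have hC : (q : ℚ) * (2 * s) ^ 2 = (4 * B - A ^ 2 : ℤ) := by
    push_cast
    rw [hA, hB]
    ring
  obtain ⟨C, hC'⟩ : ∃ C : ℤ, (C : ℚ) = 2 * s := by
    set t := 2 * s with ht
    have h1 : (q : ℤ) * t.num ^ 2 = (4 * B - A ^ 2) * t.den ^ 2 := by
      have : (q : ℚ) * t.num ^ 2 = (4 * B - A ^ 2 : ℤ) * t.den ^ 2 := by
        rw [← hC]
        nth_rewrite 2 [← Rat.num_div_den t]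
        field_simp
      exact_mod_cast this
    have h2 : ((t.den : ℤ) ^ 2) ∣ q := by
      have hc : IsCoprime ((t.den : ℤ) ^ 2) (t.num ^ 2) := by
        apply IsCoprime.pow
        rw [Int.isCoprime_iff_gcd_eq_one, Int.gcd_comm]
        simpa [Int.gcd] using t.reduced
      exact hc.dvd_of_dvd_mul_right (h1 ▸ Dvd.intro_left _ rfl)
    have h3 : t.den * t.den ∣ q := by
      rw [← pow_two]; exact_mod_cast h2
    have h4 := Nat.isUnit_iff.1 (hsq _ h3)
    exact ⟨t.num, Rat.coe_int_num_of_den_eq_one h4⟩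
  rw [← hC'] at hC
  have hC2 : (q : ℤ) * C ^ 2 = 4 * B - A ^ 2 := by exact_mod_cast hC
  have hpar : (2 : ℤ) ∣ A - C := by
    have hq' : (q : ℤ) % 2 = 1 := by omega
    rw [Int.dvd_iff_emod_eq_zero]
    have h5 := congrArg (· % 2) hC2
    rcases Int.emod_two_eq_zero_or_one A with ha | ha <;>
    rcases Int.emod_two_eq_zero_or_one C with hc | hc <;>
    simp [pow_two, Int.mul_emod, Int.sub_emod, ha, hc, hq'] at h5 ⊢
  obtain ⟨u, hu⟩ := hpar
  have hr : (r : ℂ) = A / 2 := by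
    have : r = A / 2 := by rw [hA]; ring
    rw [this]; push_cast; rfl
  have hs : (s : ℂ) = C / 2 := by
    have : s = C / 2 := by rw [hC']; ring
    rw [this]; push_cast; rfl
  have hA' : (A : ℂ) = C + 2 * u := by
    have : A = C + 2 * u := by linarith
    rw [this]; push_cast; rfl
  refine ⟨u, C, ?_⟩
  rw [hr, hs, hA']
  ring

theorem imagQuadClassNumber_eq [NeZero q] (ho : Odd q) (h4 : 4 < q) {χ : DirichletCharacter ℂ q}
    (hχ : χ ≠ 1) (hp : χ.IsPrimitive) (h2 : χ ^ 2 = 1) (hodd : χ (-1) = -1) :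
    (imagQuadClassNumber q : ℂ) =
      -∑ a : ZMod q, χ a * ((a.val / q - 1 / 2 : ℝ) : ℂ) := by
  have hq3 : q % 4 = 3 := mod_four_of_odd_quadratic ho hp h2 hodd
  have hsq : Squarefree q := squarefree_of_isPrimitive_quadratic ho hp h2
  set ω : ℂ := I * (Real.sqrt q : ℂ) with hω
  have hω2 : ω ^ 2 = -(q : ℂ) := I_mul_sqrt_sq q
  have : NumberField ℚ⟮ω⟯ := numberField_adjoin_I_mul_sqrt q
  obtain ⟨m, hm⟩ : ∃ m : ℤ, 4 * m = q + 1 := ⟨(q + 1) / 4, by omega⟩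
  have hm' : (4 : ℂ) * m = q + 1 := by exact_mod_cast hm
  have hmem : (1 + ω) / 2 ∈ ℚ⟮ω⟯ :=
    div_mem (add_mem (one_mem _) (mem_adjoin_simple_self ℚ ω)) (ofNat_mem _ 2)
  have hθ0 : (1 + ω) / 2 * ((1 + ω) / 2) = (1 + ω) / 2 - m := by
    linear_combination hω2 / 4 + hm' / 4
  have h_int : IsIntegral ℤ ((1 + ω) / 2) := by
    refine ⟨Polynomial.X ^ 2 - Polynomial.X + Polynomial.C m, ?_, ?_⟩
    · monicity!
    · rw [Polynomial.eval₂_add, Polynomial.eval₂_sub, Polynomial.eval₂_C]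
      simp
      linear_combination hθ0
  have hinj : Function.Injective (algebraMap ℚ⟮ω⟯ ℂ) := (algebraMap ℚ⟮ω⟯ ℂ).injective
  have h_int' : IsIntegral ℤ (⟨(1 + ω) / 2, hmem⟩ : ℚ⟮ω⟯) :=
    (isIntegral_algebraMap_iff hinj).1 h_int
  let θ : 𝓞 ℚ⟮ω⟯ := ⟨⟨(1 + ω) / 2, hmem⟩, h_int'⟩
  have hext (x y : 𝓞 ℚ⟮ω⟯) (h : ((x : ℚ⟮ω⟯) : ℂ) = ((y : ℚ⟮ω⟯) : ℂ)) : x = y :=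
    RingOfIntegers.ext (Subtype.ext h)
  have hθv : ((θ : ℚ⟮ω⟯) : ℂ) = (1 + ω) / 2 := rfl
  have hθ : θ * θ = θ - m := by
    apply hext
    simp [hθv, hθ0]
  have hrep (x : 𝓞 ℚ⟮ω⟯) : ∃ u v : ℤ, x = u + v * θ := by
    obtain ⟨r, s, hrs⟩ := mem_adjoin_I_mul_sqrt (x : ℚ⟮ω⟯).2
    have hx : IsIntegral ℤ (((x : ℚ⟮ω⟯)) : ℂ) :=
      (isIntegral_algebraMap_iff hinj).2 (RingOfIntegers.isIntegral_coe x)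
    rw [hrs] at hx
    obtain ⟨u, v, huv⟩ := exists_int_of_isIntegral_add hsq hq3 hx
    refine ⟨u, v, hext _ _ ?_⟩
    simp only [map_add, map_mul, map_intCast]
    push_cast
    rw [hθv, hrs, huv]
  have hq0 : (0 : ℝ) < q := by exact_mod_cast (by omega : 0 < q)
  have hind (u v : ℤ) (h : (u : 𝓞 ℚ⟮ω⟯) + v * θ = 0) : u = 0 ∧ v = 0 := by
    have h1 := congrArg (fun x : 𝓞 ℚ⟮ω⟯ ↦ ((x : ℚ⟮ω⟯) : ℂ)) h
    simp only [map_add, map_mul, map_intCast, map_zero] at h1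
    push_cast at h1
    rw [hθv, hω] at h1
    have h2 := congrArg Complex.im h1
    have h3 := congrArg Complex.re h1
    simp at h2 h3
    have hv : v = 0 := by
      rcases h2 with h | h
      · exact h
      · omega
    subst hv
    simpa using h3
  have hcount {n : ℕ} (hn : n ≠ 0) := card_absNorm_eq_zetaMul (R := 𝓞 ℚ⟮ω⟯)
    (eq_jacobiSym_of_isPrimitive_quadratic ho hp h2) hq3 hsq
    (finrank_eq_two_of_quadratic_basis hrep hind hθ).1 hm hθ hrep hind hn
  have hres := dedekindZeta_residue_eq_LFunction_one (K := ℚ⟮ω⟯) hχ (fun n hn ↦ hcount hn)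
  rw [dedekindZeta_residue_of_quadratic h4 hm hθ hrep hind,
    LFunction_one_eq ho (by omega) hχ hp h2 hodd] at hres
  have hcl : imagQuadClassNumber q = classNumber ℚ⟮ω⟯ := by
    rw [imagQuadClassNumber, classNumber, Nat.card_eq_fintype_card]
  have hpi : (Real.pi / Real.sqrt q : ℂ) ≠ 0 := by
    have : Real.pi / Real.sqrt q ≠ 0 := (div_pos Real.pi_pos (Real.sqrt_pos.2 hq0)).ne'
    exact_mod_cast this
  rw [hcl]
  apply mul_left_cancel₀ hpi
  rw [mul_neg, ← neg_mul, ← hres]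
  push_cast
  rfl

end imaginary_quadratic

section circle

lemma sawtooth_eq (x : ℝ) : sawtooth x = (Int.fract x - Int.fract (-x)) / 2 := by
  unfold sawtooth
  split_ifs with h
  · obtain ⟨n, rfl⟩ := h
    rw [← Int.cast_neg, Int.fract_intCast, Int.fract_intCast]
    simp
  · have : Int.fract x ≠ 0 := fun h0 ↦ h (Int.fract_eq_zero_iff.1 h0)
    rw [Int.fract_neg this]
    ring

lemma sawtooth_periodic : Function.Periodic sawtooth 1 := by
  intro x
  rw [sawtooth_eq, sawtooth_eq, Int.fract_add_one, neg_add, ← sub_eq_add_neg, Int.fract_sub_one]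

/-- The sawtooth function on the circle `ℝ / ℤ`. -/
noncomputable def circleSawtooth : UnitAddCircle → ℝ := sawtooth_periodic.lift

lemma circleSawtooth_coe (x : ℝ) : circleSawtooth (x : UnitAddCircle) = sawtooth x := rfl

lemma circleSawtooth_neg (X : UnitAddCircle) : circleSawtooth (-X) = -circleSawtooth X := by
  induction X using QuotientAddGroup.induction_on with
  | H x =>
    change sawtooth (-x) = -sawtooth x
    rw [sawtooth_eq, sawtooth_eq, neg_neg]
    ring

lemma sum_fract_add_div {k : ℕ} (hk : k ≠ 0) (x : ℝ) :
    ∑ i ∈ range k, Int.fract (x + i / k) = Int.fract (k * x) + ((k : ℝ) - 1) / 2 := by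
  have hk0 : (0 : ℝ) < k := by exact_mod_cast Nat.pos_of_ne_zero hk
  have hper : Function.Periodic
      (fun x : ℝ ↦ ∑ i ∈ range k, Int.fract (x + i / k) - Int.fract (k * x)) (1 / k) := by
    intro x
    have h1 : ∑ i ∈ range k, Int.fract (x + 1 / k + i / k) =
        ∑ i ∈ range k, Int.fract (x + i / k) := by
      have h2 := Finset.sum_range_succ (fun i : ℕ ↦ Int.fract (x + i / k)) k
      rw [Finset.sum_range_succ'] at h2
      have h3 : Int.fract (x + k / k) = Int.fract (x + (0 : ℕ) / k) := by
        rw [div_self hk0.ne', Int.fract_add_one]; simp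
      rw [h3] at h2
      rw [← add_right_cancel h2]
      refine Finset.sum_congr rfl fun i _ ↦ ?_
      congr 1
      push_cast
      ring
    simp only
    rw [h1, mul_add, mul_one_div_cancel hk0.ne', Int.fract_add_one]
  set m := ⌊k * x⌋
  have h4 := hper.sub_int_mul_eq m (x := x)
  set y := x - m * (1 / k) with hy
  have hky : k * y = Int.fract (k * x) := by
    rw [hy, ← Int.self_sub_floor]
    field_simp
    rfl
  have hy0 : 0 ≤ y := by
    have := Int.fract_nonneg ((k : ℝ) * x)
    rw [← hky] at this
    exact nonneg_of_mul_nonneg_right this hk0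
  have hy1 : k * y < 1 := hky ▸ Int.fract_lt_one _
  have h5 : ∑ i ∈ range k, Int.fract (y + i / k) = ∑ i ∈ range k, (y + (i : ℝ) / k) := by
    refine Finset.sum_congr rfl fun i hi ↦ ?_
    rw [Int.fract_eq_self]
    refine ⟨by positivity, ?_⟩
    have : (i : ℝ) + 1 ≤ k := by exact_mod_cast Finset.mem_range.1 hi
    rw [← mul_lt_mul_iff_right₀ hk0, mul_add, mul_div_cancel₀ _ hk0.ne']
    linarith
  have h6 : ∑ i ∈ range k, (y + (i : ℝ) / k) = k * y + ((k : ℝ) - 1) / 2 := by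
    rw [Finset.sum_add_distrib, ← Finset.sum_div, Finset.sum_const, card_range, nsmul_eq_mul]
    have h7 : (∑ i ∈ range k, (i : ℝ)) * 2 = k * (k - 1) := by
      have := Finset.sum_range_id_mul_two k
      have h8 : (((∑ i ∈ range k, i) * 2 : ℕ) : ℝ) = ((k * (k - 1) : ℕ) : ℝ) := by rw [this]
      rw [Nat.cast_mul, Nat.cast_mul, Nat.cast_sub (Nat.pos_of_ne_zero hk)] at h8
      simpa using h8
    field_simp
    linarith
  have h9 : Int.fract (k * y) = k * y :=
    Int.fract_eq_self.2 ⟨by positivity, hy1⟩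
  rw [h5, h6, h9] at h4
  linarith

lemma sum_circleSawtooth_add {k : ℕ} (hk : k ≠ 0) (X : UnitAddCircle) :
    ∑ i ∈ range k, circleSawtooth (X + ((i / k : ℝ) : UnitAddCircle)) = circleSawtooth (k • X) := by
  induction X using QuotientAddGroup.induction_on with
  | H x =>
    have e1 (i : ℕ) : circleSawtooth ((x : UnitAddCircle) + ((i / k : ℝ) : UnitAddCircle)) =
      sawtooth (x + i / k) := rfl
    have e2 : circleSawtooth (k • (x : UnitAddCircle)) = sawtooth (k * x) := by
      rw [← nsmul_eq_mul]; rfl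
    change ∑ i ∈ range k, circleSawtooth ((x : UnitAddCircle) + ((i / k : ℝ) : UnitAddCircle)) =
      circleSawtooth (k • (x : UnitAddCircle))
    simp_rw [e1]
    have hk0 : (k : ℝ) ≠ 0 := by exact_mod_cast hk
    rw [e2]
    simp_rw [sawtooth_eq]
    have h1 : ∑ i ∈ range k, Int.fract (-(x + i / k)) =
        ∑ i ∈ range k, Int.fract (-x - 1 + 1 / k + i / k) := by
      rw [← Finset.sum_range_reflect]
      refine Finset.sum_congr rfl fun i hi ↦ ?_
      congr 1
      have : i + 1 ≤ k := Finset.mem_range.1 hi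
      rw [Nat.sub_sub, Nat.cast_sub (by omega)]
      push_cast
      field_simp
      ring
    rw [← Finset.sum_div, Finset.sum_sub_distrib, h1, sum_fract_add_div hk, sum_fract_add_div hk,
      show (k : ℝ) * (-x - 1 + 1 / k) = -(k * x) - (k : ℕ) + 1 by field_simp,
      Int.fract_add_one, Int.fract_sub_natCast]
    ring

lemma circleSawtooth_identity {X Y : UnitAddCircle} (hX : X ≠ 0) (hY : Y ≠ 0) (hXY : X + Y ≠ 0) :
    circleSawtooth X * circleSawtooth (X + Y) + circleSawtooth Y * circleSawtooth (X + Y) =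
      (circleSawtooth X ^ 2 + circleSawtooth Y ^ 2 + circleSawtooth (X + Y) ^ 2) / 2 +
        circleSawtooth X * circleSawtooth Y - 1 / 8 := by
  induction X using QuotientAddGroup.induction_on with
  | H x =>
  induction Y using QuotientAddGroup.induction_on with
  | H y =>
    have hns (z : ℝ) (hz : (z : UnitAddCircle) ≠ 0) : sawtooth z = Int.fract z - 1 / 2 := by
      refine if_neg fun ⟨n, hn⟩ ↦ hz ?_
      rw [← hn]
      exact (AddCircle.coe_eq_zero_iff 1).2 ⟨n, by simp⟩
    have hx : circleSawtooth (QuotientAddGroup.mk x : UnitAddCircle) = _ := hns x hX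
    have hy : circleSawtooth (QuotientAddGroup.mk y : UnitAddCircle) = _ := hns y hY
    have hxy :
        circleSawtooth ((QuotientAddGroup.mk x : UnitAddCircle) + QuotientAddGroup.mk y) = _ :=
      hns (x + y) hXY
    rw [hx, hy, hxy]
    obtain ⟨z, hz⟩ := Int.fract_add x y
    have h1 := Int.fract_add_le x y
    have h2 := Int.fract_add_fract_le x y
    have h3 : -1 ≤ z ∧ z ≤ 0 := by
      constructor
      · exact_mod_cast (by push_cast; linarith : ((-1 : ℤ) : ℝ) ≤ z)
      · exact_mod_cast (by push_cast; linarith : (z : ℝ) ≤ (0 : ℤ))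
    obtain rfl | rfl : z = -1 ∨ z = 0 := by omega
    · have : Int.fract (x + y) = Int.fract x + Int.fract y - 1 := by push_cast at hz; linarith
      rw [this]; ring
    · have : Int.fract (x + y) = Int.fract x + Int.fract y := by push_cast at hz; linarith
      rw [this]; ring

end circle

section reciprocity

open ZMod

lemma sum_zmod_eq_sum_range {A : Type*} [AddCommMonoid A] (N : ℕ) [NeZero N] (f : ZMod N → A) :
    ∑ j, f j = ∑ i ∈ range N, f (i : ℕ) := by
  refine Finset.sum_nbij' (fun j ↦ j.val) (fun i ↦ (i : ZMod N)) ?_ ?_ ?_ ?_ ?_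
  · intro j _; exact Finset.mem_range.2 j.val_lt
  · intro i _; exact Finset.mem_univ _
  · intro j _; simp
  · intro i hi; exact ZMod.val_cast_of_lt (Finset.mem_range.1 hi)
  · intro j _; simp

lemma sum_range_mul_eq {A : Type*} [AddCommMonoid A] (q a : ℕ) (f : ℕ → A) :
    ∑ i ∈ range (q * a), f i = ∑ n ∈ range q, ∑ ν ∈ range a, f (n + q * ν) := by
  rw [Finset.sum_comm]
  induction a with
  | zero => simp
  | succ a ih =>
    rw [Nat.mul_succ, Finset.sum_range_add, ih, Finset.sum_range_succ]
    congr 1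
    exact Finset.sum_congr rfl fun n _ ↦ by rw [add_comm]

/-- The distribution relation of the sawtooth function, weighted by a periodic function. -/
lemma sum_mul_circleSawtooth {q a N : ℕ} [NeZero q] [NeZero a] [NeZero N] (hN : N = q * a)
    (h : q ∣ N) (f : ZMod q → ℂ) (X : UnitAddCircle) :
    ∑ l : ZMod N, f (castHom h (ZMod q) l) * circleSawtooth (X + toAddCircle l) =
      ∑ n : ZMod q, f n * circleSawtooth (a • X + toAddCircle n) := by
  have ha : (a : ℝ) ≠ 0 := by exact_mod_cast NeZero.ne a
  have hq : (q : ℝ) ≠ 0 := by exact_mod_cast NeZero.ne q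
  rw [sum_zmod_eq_sum_range, sum_zmod_eq_sum_range]
  simp only [map_natCast]
  have : ∑ i ∈ range N, f i * (circleSawtooth (X + toAddCircle ((i : ℕ) : ZMod N)) : ℂ) =
      ∑ i ∈ range (q * a), f i * (circleSawtooth (X + toAddCircle ((i : ℕ) : ZMod N)) : ℂ) := by
    rw [← hN]
  rw [this, sum_range_mul_eq]
  refine Finset.sum_congr rfl fun n _ ↦ ?_
  have h1 (ν : ℕ) : f ((n + q * ν : ℕ) : ZMod q) = f n := by simp
  simp only [h1]
  rw [← Finset.mul_sum, ← ofReal_sum]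
  congr 2
  have h2 := sum_circleSawtooth_add (NeZero.ne a) (X + ((n / (q * a) : ℝ) : UnitAddCircle))
  have h3 : a • (X + ((n / (q * a) : ℝ) : UnitAddCircle)) = a • X + toAddCircle (n : ZMod q) := by
    rw [nsmul_add, toAddCircle_natCast, ← AddCircle.coe_nsmul, nsmul_eq_mul]
    congr 2
    field_simp
  rw [← h3, ← h2]
  refine Finset.sum_congr rfl fun ν _ ↦ ?_
  rw [toAddCircle_natCast, add_assoc, ← AddCircle.coe_add, hN]
  congr 3
  push_cast
  field_simp

lemma sum_castHom_eq_zero {q N : ℕ} [NeZero q] [NeZero N] (h : q ∣ N) {χ : DirichletCharacter ℂ q}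
    (hχ : χ ≠ 1) : ∑ l : ZMod N, χ (castHom h (ZMod q) l) = 0 := by
  obtain ⟨a, rfl⟩ := h
  rw [sum_zmod_eq_sum_range, sum_range_mul_eq]
  simp only [map_natCast]
  have h1 (n ν : ℕ) : χ ((n + q * ν : ℕ) : ZMod q) = χ n := by simp
  simp only [h1, Finset.sum_const]
  rw [← Finset.smul_sum, ← sum_zmod_eq_sum_range, MulChar.sum_eq_zero_of_ne_one hχ, smul_zero]

lemma toAddCircle_mul {N : ℕ} [NeZero N] (k : ℕ) (j : ZMod N) :
    toAddCircle ((k : ZMod N) * j) = k • toAddCircle j := by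
  rw [← map_nsmul, nsmul_eq_mul]

end reciprocity

section reciprocity_sums

open ZMod

variable {q₁ q₂ M L : ℕ} [NeZero q₁] [NeZero M] [NeZero L]

/-- A sum over `ℤ/M × ℤ/q₁` that agrees with the newform Dedekind sum for real characters. -/
noncomputable def circleDedekind (χ₁ : DirichletCharacter ℂ q₁) (χ₂ : DirichletCharacter ℂ q₂)
    (h : q₂ ∣ M) (a : ℤ) : ℂ :=
  ∑ j : ZMod M, ∑ n : ZMod q₁, χ₂ (castHom h (ZMod q₂) j) * χ₁ n *
    circleSawtooth (toAddCircle j) * circleSawtooth (toAddCircle n + a • toAddCircle j)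

/-- The companion of `circleDedekind` in the reciprocity law. -/
noncomputable def dualDedekind [NeZero q₂] (χ₁ : DirichletCharacter ℂ q₁)
    (χ₂ : DirichletCharacter ℂ q₂)
    (h : q₁ ∣ L) (k : ℕ) : ℂ :=
  ∑ l : ZMod L, ∑ n : ZMod q₂, χ₁ (castHom h (ZMod q₁) l) * χ₂ n *
    circleSawtooth (toAddCircle l) * circleSawtooth (k • toAddCircle l + toAddCircle n)

lemma sum_sum_circleSawtooth_add_eq_zero [NeZero q₂] {χ₁ : DirichletCharacter ℂ q₁}
    {χ₂ : DirichletCharacter ℂ q₂}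
    (hχ₁ : χ₁ ≠ 1) {r a : ℕ} (hM : M = r * q₁ * q₂) (hL : L = q₁ * a) (hcop : a.Coprime q₁)
    (h₂ : q₂ ∣ M) (h₁ : q₁ ∣ L) (G : UnitAddCircle → ℂ) :
    ∑ j : ZMod M, ∑ l : ZMod L, χ₂ (castHom h₂ (ZMod q₂) j) * χ₁ (castHom h₁ (ZMod q₁) l) *
      G (toAddCircle j + toAddCircle l) = 0 := by
  set S := ∑ j : ZMod M, ∑ l : ZMod L, χ₂ (castHom h₂ (ZMod q₂) j) * χ₁ (castHom h₁ (ZMod q₁) l) *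
      G (toAddCircle j + toAddCircle l) with hS
  have hr0 : (r : ℝ) ≠ 0 := by
    have := NeZero.ne M
    rw [hM] at this
    exact_mod_cast (show r ≠ 0 by rintro rfl; simp at this)
  have ha0 : (a : ℝ) ≠ 0 := by
    have := NeZero.ne L
    rw [hL] at this
    exact_mod_cast (show a ≠ 0 by rintro rfl; simp at this)
  have hq1 : (q₁ : ℝ) ≠ 0 := by exact_mod_cast NeZero.ne q₁
  have hq2 : (q₂ : ℝ) ≠ 0 := by exact_mod_cast NeZero.ne q₂
  have hcirc (t : ℕ) : toAddCircle ((r * q₂ * t : ℕ) : ZMod M) =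
      toAddCircle ((a * t : ℕ) : ZMod L) := by
    rw [toAddCircle_natCast, toAddCircle_natCast, hM, hL]
    congr 1
    push_cast
    field_simp
  have hshift (t : ℕ) : S = ∑ j : ZMod M, ∑ l : ZMod L, χ₂ (castHom h₂ (ZMod q₂) j) *
      χ₁ (castHom h₁ (ZMod q₁) l - a * t) * G (toAddCircle j + toAddCircle l) := by
    rw [hS, ← Equiv.sum_comp (Equiv.addRight ((r * q₂ * t : ℕ) : ZMod M))]
    refine Finset.sum_congr rfl fun j _ ↦ ?_
    rw [← Equiv.sum_comp (Equiv.subRight ((a * t : ℕ) : ZMod L))]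
    refine Finset.sum_congr rfl fun l _ ↦ ?_
    simp only [Equiv.coe_addRight, Equiv.subRight_apply, map_add, map_sub, hcirc, map_natCast]
    have e1 : ((r * q₂ * t : ℕ) : ZMod q₂) = 0 := by simp
    rw [e1, add_zero, add_add_sub_cancel]
    push_cast
    rfl
  have hu : IsUnit (a : ZMod q₁) := (ZMod.isUnit_iff_coprime a q₁).2 hcop
  have hchar (x : ZMod q₁) : ∑ t ∈ range q₁, χ₁ (x - a * t) = 0 := by
    obtain ⟨u, hu⟩ := hu
    have := sum_zmod_eq_sum_range q₁ (fun t : ZMod q₁ ↦ χ₁ (x - a * t))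
    rw [← this, ← MulChar.sum_eq_zero_of_ne_one hχ₁, ← hu]
    exact Equiv.sum_comp (u.mulLeft.trans (Equiv.subLeft x)) χ₁
  have h0 : ∑ t ∈ range q₁, S = 0 := by
    rw [Finset.sum_congr rfl fun t _ ↦ hshift t, Finset.sum_comm]
    refine Finset.sum_eq_zero fun j _ ↦ ?_
    rw [Finset.sum_comm]
    refine Finset.sum_eq_zero fun l _ ↦ ?_
    rw [← Finset.sum_mul, ← Finset.mul_sum, hchar, mul_zero, zero_mul]
  rw [Finset.sum_const, card_range, nsmul_eq_mul] at h0
  exact (mul_eq_zero.1 h0).resolve_left (by exact_mod_cast NeZero.ne q₁)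

lemma add_ne_zero_of_weight_ne_zero {χ₁ : DirichletCharacter ℂ q₁} {χ₂ : DirichletCharacter ℂ q₂}
    (hχ₁ : χ₁ ≠ 1) (hχ₂ : χ₂ ≠ 1) {r a : ℕ} (hM : M = r * q₁ * q₂) (hL : L = q₁ * a)
    (hcop : a.Coprime M) (h₂ : q₂ ∣ M) (h₁ : q₁ ∣ L) {j : ZMod M} {l : ZMod L}
    (hw : χ₂ (castHom h₂ (ZMod q₂) j) * χ₁ (castHom h₁ (ZMod q₁) l) ≠ 0) :
    toAddCircle j ≠ 0 ∧ toAddCircle l ≠ 0 ∧ toAddCircle j + toAddCircle l ≠ 0 := by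
  have hz {q : ℕ} {χ : DirichletCharacter ℂ q} (hχ : χ ≠ 1) : χ 0 = 0 := by
    apply MulChar.map_nonunit
    intro h
    rw [isUnit_zero_iff] at h
    have : Subsingleton (ZMod q) := subsingleton_of_zero_eq_one h
    refine hχ (MulChar.ext fun u ↦ ?_)
    rw [Subsingleton.elim (u : ZMod q) 1, map_one, map_one]
  obtain ⟨hw2, hw1⟩ := mul_ne_zero_iff.1 hw
  refine ⟨?_, ?_, ?_⟩
  · rw [ne_eq, toAddCircle_eq_zero]
    rintro rfl
    rw [map_zero] at hw2
    exact hw2 (hz hχ₂)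
  · rw [ne_eq, toAddCircle_eq_zero]
    rintro rfl
    rw [map_zero] at hw1
    exact hw1 (hz hχ₁)
  · intro h0
    have h3 : L • (toAddCircle j + toAddCircle l) = 0 := by rw [h0, smul_zero]
    rw [smul_add, ← toAddCircle_mul, ← toAddCircle_mul, ZMod.natCast_self, zero_mul, map_zero,
      add_zero, toAddCircle_eq_zero, hL, Nat.cast_mul, mul_comm (q₁ : ZMod M), mul_assoc] at h3
    have h4 : (q₁ : ZMod M) * j = 0 :=
      ((ZMod.isUnit_iff_coprime a M).2 hcop).mul_right_eq_zero.1 h3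
    rw [← ZMod.natCast_zmod_val j, ← Nat.cast_mul, ZMod.natCast_eq_zero_iff] at h4
    have h5 : q₂ ∣ j.val := by
      refine (Dvd.intro_left r rfl).trans (Nat.dvd_of_mul_dvd_mul_left (NeZero.pos q₁) ?_)
      rwa [← mul_assoc, mul_comm q₁ r, ← hM]
    rw [← ZMod.natCast_zmod_val j, map_natCast, (ZMod.natCast_eq_zero_iff _ _).2 h5] at hw2
    exact hw2 (hz hχ₂)

lemma sum_castHom_circleSawtooth {q k N : ℕ} [NeZero q] [NeZero k] [NeZero N] (hN : N = q * k)
    (h : q ∣ N) (f : ZMod q → ℂ) :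
    ∑ l : ZMod N, f (castHom h (ZMod q) l) * circleSawtooth (toAddCircle l) =
      ∑ n : ZMod q, f n * circleSawtooth (toAddCircle n) := by
  simpa using sum_mul_circleSawtooth hN h f 0

theorem circleDedekind_add_dualDedekind [NeZero q₂] {χ₁ : DirichletCharacter ℂ q₁}
    {χ₂ : DirichletCharacter ℂ q₂} (hχ₁ : χ₁ ≠ 1) (hχ₂ : χ₂ ≠ 1) {r a : ℕ}
    (hM : M = r * q₁ * q₂) (hL : L = q₁ * a) (hcop : a.Coprime M) (h₂ : q₂ ∣ M) (h₁ : q₁ ∣ L) :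
    circleDedekind χ₁ χ₂ h₂ a + dualDedekind χ₁ χ₂ h₁ (r * q₁) =
      (∑ n : ZMod q₁, χ₁ n * circleSawtooth (toAddCircle n)) *
        ∑ n : ZMod q₂, χ₂ n * circleSawtooth (toAddCircle n) := by
  have hr0 : r ≠ 0 := by
    have := NeZero.ne M
    rw [hM] at this
    rintro rfl; simp at this
  have ha0 : a ≠ 0 := by
    have := NeZero.ne L
    rw [hL] at this
    rintro rfl; simp at this
  have : NeZero a := ⟨ha0⟩
  have : NeZero (r * q₁) := ⟨mul_ne_zero hr0 (NeZero.ne q₁)⟩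
  have hM' : M = q₂ * (r * q₁) := by rw [hM, mul_comm]
  have hcop₁ : a.Coprime q₁ := hcop.coprime_dvd_right ⟨r * q₂, by rw [hM]; ring⟩
  let w (j : ZMod M) (l : ZMod L) : ℂ :=
    χ₂ (castHom h₂ (ZMod q₂) j) * χ₁ (castHom h₁ (ZMod q₁) l)
  have e1 : circleDedekind χ₁ χ₂ h₂ a = ∑ j : ZMod M, ∑ l : ZMod L, w j l *
      (circleSawtooth (toAddCircle j) * circleSawtooth (toAddCircle j + toAddCircle l)) := by
    refine Finset.sum_congr rfl fun j _ ↦ ?_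
    have := sum_mul_circleSawtooth hL h₁ χ₁ (toAddCircle j)
    calc _ = χ₂ (castHom h₂ (ZMod q₂) j) * circleSawtooth (toAddCircle j) *
        ∑ n : ZMod q₁, χ₁ n * circleSawtooth (a • toAddCircle j + toAddCircle n) := by
          rw [Finset.mul_sum]
          refine Finset.sum_congr rfl fun n _ ↦ ?_
          rw [add_comm (a • toAddCircle j), natCast_zsmul]
          ring
      _ = _ := by
          rw [← this, Finset.mul_sum]
          refine Finset.sum_congr rfl fun l _ ↦ ?_
          ring
  have e2 : dualDedekind χ₁ χ₂ h₁ (r * q₁) = ∑ j : ZMod M, ∑ l : ZMod L, w j l *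
      (circleSawtooth (toAddCircle l) * circleSawtooth (toAddCircle j + toAddCircle l)) := by
    rw [Finset.sum_comm]
    refine Finset.sum_congr rfl fun l _ ↦ ?_
    have := sum_mul_circleSawtooth hM' h₂ χ₂ (toAddCircle l)
    calc _ = χ₁ (castHom h₁ (ZMod q₁) l) * circleSawtooth (toAddCircle l) *
        ∑ n : ZMod q₂, χ₂ n * circleSawtooth ((r * q₁) • toAddCircle l + toAddCircle n) := by
          rw [Finset.mul_sum]
          refine Finset.sum_congr rfl fun n _ ↦ ?_
          ring
      _ = _ := by
          rw [← this, Finset.mul_sum]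
          refine Finset.sum_congr rfl fun j _ ↦ ?_
          rw [add_comm (toAddCircle j)]
          ring
  have e3 (j : ZMod M) (l : ZMod L) :
      w j l * (circleSawtooth (toAddCircle j) * circleSawtooth (toAddCircle j + toAddCircle l)) +
      w j l * (circleSawtooth (toAddCircle l) * circleSawtooth (toAddCircle j + toAddCircle l)) =
      w j l * ((circleSawtooth (toAddCircle j) : ℂ) ^ 2 / 2 - 1 / 8) +
      w j l * ((circleSawtooth (toAddCircle l) : ℂ) ^ 2 / 2) +
      w j l * ((circleSawtooth (toAddCircle j + toAddCircle l) : ℂ) ^ 2 / 2) +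
      w j l * (circleSawtooth (toAddCircle j) * circleSawtooth (toAddCircle l)) := by
    by_cases hw : w j l = 0
    · simp [hw]
    · obtain ⟨hj, hl, hjl⟩ := add_ne_zero_of_weight_ne_zero hχ₁ hχ₂ hM hL hcop h₂ h₁ hw
      have := congrArg (fun x : ℝ ↦ (x : ℂ)) (circleSawtooth_identity hj hl hjl)
      push_cast at this
      linear_combination w j l * this
  rw [e1, e2, ← Finset.sum_add_distrib]
  simp_rw [← Finset.sum_add_distrib, e3, Finset.sum_add_distrib]
  have z1 : ∑ j : ZMod M, ∑ l : ZMod L,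
      w j l * ((circleSawtooth (toAddCircle j) : ℂ) ^ 2 / 2 - 1 / 8) = 0 := by
    refine Finset.sum_eq_zero fun j _ ↦ ?_
    rw [← Finset.sum_mul, ← Finset.mul_sum, sum_castHom_eq_zero h₁ hχ₁, mul_zero, zero_mul]
  have z2 : ∑ j : ZMod M, ∑ l : ZMod L,
      w j l * ((circleSawtooth (toAddCircle l) : ℂ) ^ 2 / 2) = 0 := by
    rw [Finset.sum_comm]
    refine Finset.sum_eq_zero fun l _ ↦ ?_
    rw [← Finset.sum_mul, ← Finset.sum_mul, sum_castHom_eq_zero h₂ hχ₂, zero_mul, zero_mul]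
  have z3 : ∑ j : ZMod M, ∑ l : ZMod L,
      w j l * ((circleSawtooth (toAddCircle j + toAddCircle l) : ℂ) ^ 2 / 2) = 0 :=
    sum_sum_circleSawtooth_add_eq_zero hχ₁ hM hL hcop₁ h₂ h₁
      (fun X ↦ (circleSawtooth X : ℂ) ^ 2 / 2)
  rw [z1, z2, z3, ← sum_castHom_circleSawtooth hL h₁, ← sum_castHom_circleSawtooth hM' h₂,
    mul_comm, Finset.sum_mul_sum, zero_add, zero_add, zero_add]
  refine Finset.sum_congr rfl fun j _ ↦ Finset.sum_congr rfl fun l _ ↦ ?_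
  ring

end reciprocity_sums

section reciprocity_substitutions

open ZMod

variable {q₁ q₂ M L : ℕ} [NeZero q₁] [NeZero M] [NeZero L]

lemma circleDedekind_neg {χ₁ : DirichletCharacter ℂ q₁} {χ₂ : DirichletCharacter ℂ q₂}
    (ho₁ : χ₁ (-1) = -1) (h : q₂ ∣ M) (a : ℤ) :
    circleDedekind χ₁ χ₂ h (-a) = circleDedekind χ₁ χ₂ h a := by
  refine Finset.sum_congr rfl fun j _ ↦ ?_
  rw [← Equiv.sum_comp (Equiv.neg (ZMod q₁))]
  refine Finset.sum_congr rfl fun n _ ↦ ?_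
  simp only [Equiv.neg_apply]
  rw [(toAddCircle (N := q₁)).map_neg, neg_smul, ← neg_add, circleSawtooth_neg, ← neg_one_mul n,
    map_mul, ho₁]
  push_cast
  ring

lemma circleDedekind_inverse {χ₁ : DirichletCharacter ℂ q₁} {χ₂ : DirichletCharacter ℂ q₂}
    (ho₁ : χ₁ (-1) = -1) {k : ℕ} (hM : M = q₁ * k) (hk : q₂ ∣ k) (h : q₂ ∣ M) {a d : ℤ}
    (had : (M : ℤ) ∣ a * d - 1) :
    circleDedekind χ₁ χ₂ h d = -(χ₂ (a : ZMod q₂) * χ₁ (d : ZMod q₁)) *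
      circleDedekind χ₁ χ₂ h a := by
  have hk0 : (k : ℝ) ≠ 0 := by
    have := NeZero.ne M
    rw [hM] at this
    exact_mod_cast (show k ≠ 0 by rintro rfl; simp at this)
  have hq1 : (q₁ : ℝ) ≠ 0 := by exact_mod_cast NeZero.ne q₁
  have unitOf {N : ℕ} (hN : (N : ℤ) ∣ a * d - 1) : (a : ZMod N) * d = 1 := by
    have := (ZMod.intCast_zmod_eq_zero_iff_dvd _ N).2 hN
    push_cast at this
    exact sub_eq_zero.1 this
  have hq1M : (q₁ : ℤ) ∣ M := by exact_mod_cast Dvd.intro k hM.symm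
  have uM := unitOf had
  have uq := unitOf (hq1M.trans had)
  let u : (ZMod M)ˣ := ⟨a, d, uM, by rw [mul_comm, uM]⟩
  let v : (ZMod q₁)ˣ := ⟨-d, -a, by rw [neg_mul_neg, mul_comm, uq], by rw [neg_mul_neg, uq]⟩
  unfold circleDedekind
  rw [Finset.sum_comm, Finset.sum_comm (γ := ZMod M), ← Equiv.sum_comp v.mulLeft, Finset.mul_sum]
  refine Finset.sum_congr rfl fun n _ ↦ ?_
  rw [← Equiv.sum_comp (u.mulLeft.trans (Equiv.addRight ((n.val * k : ℕ) : ZMod M))),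
    Finset.mul_sum]
  refine Finset.sum_congr rfl fun j _ ↦ ?_
  simp only [Units.mulLeft_apply, Equiv.trans_apply, Equiv.coe_addRight, u, v]
  have e1 : castHom h (ZMod q₂) (a * j + (n.val * k : ℕ)) = a * castHom h (ZMod q₂) j := by
    rw [map_add, map_mul, map_intCast, map_natCast, Nat.cast_mul,
      (ZMod.natCast_eq_zero_iff k q₂).2 hk, mul_zero, add_zero]
  have e2 : toAddCircle ((n.val * k : ℕ) : ZMod M) = toAddCircle n := by
    rw [toAddCircle_natCast, toAddCircle_apply, hM]
    congr 1
    push_cast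
    field_simp
  have e3 : toAddCircle ((a : ZMod M) * j) = a • toAddCircle j := by
    rw [← map_zsmul, zsmul_eq_mul]
  have e4 : toAddCircle (-(d : ZMod q₁) * n) = -(d • toAddCircle n) := by
    rw [← map_zsmul, zsmul_eq_mul, ← map_neg, neg_mul]
  have e5 : d • a • toAddCircle j = toAddCircle j := by
    rw [← map_zsmul, ← map_zsmul, zsmul_eq_mul, zsmul_eq_mul, ← mul_assoc, mul_comm (d : ZMod M),
      uM, one_mul]
  rw [e1, map_add, e2, e3, e4, smul_add, e5, neg_add_eq_sub, add_sub_cancel_right, map_mul,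
    map_mul, neg_eq_neg_one_mul (d : ZMod q₁), map_mul, ho₁, add_comm (a • toAddCircle j)]
  ring

lemma dualDedekind_eq [NeZero q₂] {χ₁ : DirichletCharacter ℂ q₁} {χ₂ : DirichletCharacter ℂ q₂}
    (ho₁ : χ₁ (-1) = -1) {L' a r β : ℕ} [NeZero L'] {d s : ℤ} (hL : L = q₁ * a) (hL' : L' = q₂ * a)
    (hs : s = 1 ∨ s = -1) (had : a * d + s * (β * r * q₁ * q₂) = 1) (h₁ : q₁ ∣ L) (h₂ : q₂ ∣ L') :
    dualDedekind χ₂ χ₁ h₂ (β * q₂) =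
      χ₂ (a : ZMod q₂) * χ₁ (d : ZMod q₁) * dualDedekind χ₁ χ₂ h₁ (r * q₁) := by
  have ha0 : a ≠ 0 := by
    have := NeZero.ne L
    rw [hL] at this
    rintro rfl; simp at this
  have ha : (a : ℝ) ≠ 0 := by exact_mod_cast ha0
  have : NeZero a := ⟨ha0⟩
  have hq1 : (q₁ : ℝ) ≠ 0 := by exact_mod_cast NeZero.ne q₁
  have hq2 : (q₂ : ℝ) ≠ 0 := by exact_mod_cast NeZero.ne q₂
  have hLR : (L : ℝ) = q₁ * a := by rw [hL, Nat.cast_mul]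
  have hLR' : (L' : ℝ) = q₂ * a := by rw [hL', Nat.cast_mul]
  have hs2 : s * s = 1 := by rcases hs with rfl | rfl <;> norm_num
  have hdu : IsUnit ((s * d : ℤ) : ZMod q₁) := by
    have h1 : ((a * d + s * (β * r * q₁ * q₂) : ℤ) : ZMod q₁) = 1 := by rw [had]; simp
    push_cast at h1
    simp only [ZMod.natCast_self, mul_zero, zero_mul, add_zero] at h1
    have h2 : IsUnit (d : ZMod q₁) := IsUnit.of_mul_eq_one_right _ h1
    have h3 : IsUnit (s : ZMod q₁) := by
      refine IsUnit.of_mul_eq_one (s : ZMod q₁) ?_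
      exact_mod_cast congrArg (fun x : ℤ ↦ (x : ZMod q₁)) hs2
    push_cast
    exact h3.mul h2
  have hcop₁ : a.Coprime q₁ := by
    rw [← Nat.isCoprime_iff_coprime]
    exact ⟨d, s * (β * r * q₂), by linear_combination had⟩
  have hcopr : a.Coprime (r * q₂) := by
    rw [← Nat.isCoprime_iff_coprime]
    exact ⟨d, s * (β * q₁), by push_cast; linear_combination had⟩
  let φ : ZMod L × ZMod q₂ → ZMod L' × ZMod q₁ := fun p ↦
    (((a * p.2.val + r * q₂ * p.1.val : ℕ) : ZMod L'), ((s * d : ℤ) : ZMod q₁) *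
      castHom h₁ (ZMod q₁) p.1)
  have hinj : Function.Injective φ := by
    rintro ⟨l, n⟩ ⟨m, p⟩ h
    obtain ⟨h3, h4⟩ := Prod.mk.inj h
    simp only at h3 h4
    have h5 := hdu.mul_left_cancel h4
    rw [← ZMod.natCast_zmod_val l, ← ZMod.natCast_zmod_val m, map_natCast, map_natCast,
      ZMod.natCast_eq_natCast_iff] at h5
    rw [ZMod.natCast_eq_natCast_iff, hL'] at h3
    have h6 : r * q₂ * l.val ≡ r * q₂ * m.val [MOD a] := by
      have h7 := h3.of_mul_left
      unfold Nat.ModEq at h7 ⊢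
      simpa [Nat.add_mod, Nat.mul_mod] using h7
    have h8 : l.val ≡ m.val [MOD a] := Nat.ModEq.cancel_left_of_coprime hcopr h6
    have h9 : l.val ≡ m.val [MOD q₁ * a] :=
      (Nat.modEq_and_modEq_iff_modEq_mul hcop₁.symm).1 ⟨h5, h8⟩
    rw [← hL, ← ZMod.natCast_eq_natCast_iff, ZMod.natCast_zmod_val, ZMod.natCast_zmod_val] at h9
    subst h9
    have h10 := Nat.ModEq.add_right_cancel' _ h3
    rw [mul_comm q₂ a] at h10
    have h11 := Nat.ModEq.mul_left_cancel' ha0 h10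
    rw [← ZMod.natCast_eq_natCast_iff, ZMod.natCast_zmod_val, ZMod.natCast_zmod_val] at h11
    rw [h11]
  have hbij : Function.Bijective φ := by
    rw [Fintype.bijective_iff_injective_and_card]
    refine ⟨hinj, ?_⟩
    simp only [Fintype.card_prod, ZMod.card, hL, hL']
    ring
  unfold dualDedekind
  rw [← Fintype.sum_prod_type', ← Fintype.sum_prod_type', ← hbij.sum_comp, Finset.mul_sum]
  refine Finset.sum_congr rfl fun p _ ↦ ?_
  obtain ⟨l, n⟩ := p
  simp only [φ]
  have e1 : castHom h₂ (ZMod q₂) ((a * n.val + r * q₂ * l.val : ℕ) : ZMod L') = a * n := by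
    rw [map_natCast]
    simp
  have e2 : toAddCircle ((a * n.val + r * q₂ * l.val : ℕ) : ZMod L') =
      (r * q₁) • toAddCircle l + toAddCircle n := by
    rw [toAddCircle_natCast, toAddCircle_apply, toAddCircle_apply, ← AddCircle.coe_nsmul,
      ← AddCircle.coe_add, hLR, hLR', nsmul_eq_mul]
    congr 1
    push_cast
    field_simp
    ring
  have e3 : toAddCircle (((s * d : ℤ) : ZMod q₁) * castHom h₁ (ZMod q₁) l) =
      ((s * d * l.val / q₁ : ℝ) : UnitAddCircle) := by
    conv_lhs => rw [← ZMod.natCast_zmod_val l, map_natCast]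
    have := toAddCircle_intCast (N := q₁) (s * d * l.val)
    push_cast at this ⊢
    exact this
  have e4 : (β * q₂) • ((r * q₁) • toAddCircle l + toAddCircle n) +
      toAddCircle (((s * d : ℤ) : ZMod q₁) * castHom h₁ (ZMod q₁) l) = s • toAddCircle l := by
    rw [e3, toAddCircle_apply, toAddCircle_apply, ← AddCircle.coe_nsmul, ← AddCircle.coe_add,
      ← AddCircle.coe_nsmul, ← AddCircle.coe_add, ← AddCircle.coe_zsmul, ← sub_eq_zero,
      ← AddCircle.coe_sub, AddCircle.coe_eq_zero_iff]
    refine ⟨β * n.val, ?_⟩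
    have had' : (a * d + s * (β * r * q₁ * q₂) : ℝ) = 1 := by exact_mod_cast had
    have hs' : (s * s : ℝ) = 1 := by exact_mod_cast hs2
    have key : (β * r * q₁ * q₂ : ℝ) = s - s * a * d := by
      linear_combination s * had' - (β * r * q₁ * q₂ : ℝ) * hs'
    rw [hLR]
    simp only [zsmul_eq_mul, nsmul_eq_mul]
    push_cast
    field_simp
    linear_combination -(l.val : ℝ) * key
  have e5 : circleSawtooth (s • toAddCircle l) = s * circleSawtooth (toAddCircle l) := by
    rcases hs with rfl | rfl
    · simp
    · simp [circleSawtooth_neg]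
  have e6 : χ₁ ((s * d : ℤ) : ZMod q₁) = s * χ₁ (d : ZMod q₁) := by
    rcases hs with rfl | rfl
    · simp
    · rw [Int.cast_mul, map_mul]
      simp [ho₁]
  have hs' : (s * s : ℂ) = 1 := by exact_mod_cast hs2
  rw [e1, e2, e4, e5, map_mul, map_mul, e6]
  push_cast
  linear_combination (χ₂ (a : ZMod q₂) * χ₂ n * χ₁ (d : ZMod q₁) * χ₁ (castHom h₁ (ZMod q₁) l) *
    circleSawtooth ((r * q₁) • toAddCircle l + toAddCircle n) * circleSawtooth (toAddCircle l)) * hs'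

end reciprocity_substitutions

section conclusion

open ZMod

variable {q₁ q₂ : ℕ}

lemma conj_eq_self_of_sq_eq_one {q : ℕ} {χ : DirichletCharacter ℂ q} (h : χ ^ 2 = 1) (x : ZMod q) :
    (starRingEnd ℂ) (χ x) = χ x := by
  by_cases hx : IsUnit x
  · have h1 : χ x ^ 2 = 1 := by
      rw [← MulChar.pow_apply' χ two_ne_zero, h, MulChar.one_apply hx]
    rcases sq_eq_sq_iff_eq_or_eq_neg.1 (h1.trans (one_pow 2).symm) with h2 | h2 <;> simp [h2]
  · simp [χ.map_nonunit hx]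

lemma newformDedekindSum_eq_circleDedekind {M : ℕ} [NeZero q₁] [NeZero M]
    {χ₁ : DirichletCharacter ℂ q₁} {χ₂ : DirichletCharacter ℂ q₂} (h2₁ : χ₁ ^ 2 = 1)
    (h2₂ : χ₂ ^ 2 = 1) (h : q₂ ∣ M) (a : ℤ) :
    newformDedekindSum χ₁ χ₂ a M = circleDedekind χ₁ χ₂ h a := by
  rw [newformDedekindSum, circleDedekind, Int.toNat_natCast, sum_zmod_eq_sum_range]
  refine Finset.sum_congr rfl fun j _ ↦ ?_
  rw [sum_zmod_eq_sum_range]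
  refine Finset.sum_congr rfl fun n _ ↦ ?_
  rw [conj_eq_self_of_sq_eq_one h2₁, conj_eq_self_of_sq_eq_one h2₂,
    map_natCast (castHom h (ZMod q₂)),
    toAddCircle_natCast, toAddCircle_natCast, ← AddCircle.coe_zsmul, ← AddCircle.coe_add,
    circleSawtooth_coe, circleSawtooth_coe, zsmul_eq_mul, mul_div_assoc, Int.cast_natCast]

lemma sum_mul_circleSawtooth_eq_neg_classNumber {q : ℕ} [NeZero q] (ho : Odd q) (h4 : 4 < q)
    {χ : DirichletCharacter ℂ q} (hχ : χ ≠ 1) (hp : χ.IsPrimitive) (h2 : χ ^ 2 = 1)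
    (hodd : χ (-1) = -1) :
    ∑ n : ZMod q, χ n * circleSawtooth (toAddCircle n) = -imagQuadClassNumber q := by
  rw [imagQuadClassNumber_eq ho h4 hχ hp h2 hodd, neg_neg]
  refine Finset.sum_congr rfl fun n _ ↦ ?_
  by_cases hn : n = 0
  · subst hn
    have : Fact (1 < q) := ⟨by omega⟩
    rw [MulChar.map_zero, zero_mul, zero_mul]
  · congr 2
    have hq : (0 : ℝ) < q := by exact_mod_cast NeZero.pos q
    have hv : (0 : ℝ) < n.val := by
      exact_mod_cast Nat.pos_of_ne_zero ((ZMod.val_ne_zero n).2 hn)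
    have hlt : (n.val / q : ℝ) < 1 := (div_lt_one hq).2 (by exact_mod_cast n.val_lt)
    have hfr : Int.fract (n.val / q : ℝ) = n.val / q := Int.fract_eq_self.2 ⟨by positivity, hlt⟩
    rw [toAddCircle_apply, circleSawtooth_coe, sawtooth, if_neg, hfr]
    rintro ⟨k, hk⟩
    have h0 : Int.fract (n.val / q : ℝ) = 0 := by rw [← hk, Int.fract_intCast]
    rw [hfr] at h0
    exact (div_pos hv hq).ne' h0

/-- Reciprocity for real odd characters, in terms of sums over the circle. -/
lemma circleDedekind_reciprocity {M M' : ℕ} [NeZero q₁] [NeZero q₂] [NeZero M] [NeZero M']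
    {χ₁ : DirichletCharacter ℂ q₁} {χ₂ : DirichletCharacter ℂ q₂} (hχ₁ : χ₁ ≠ 1) (hχ₂ : χ₂ ≠ 1)
    (h2₁ : χ₁ ^ 2 = 1) (ho₁ : χ₁ (-1) = -1) (ho₂ : χ₂ (-1) = -1)
    {a r β : ℕ} {d s : ℤ} (hs : s = 1 ∨ s = -1) (had : a * d + s * (β * r * q₁ * q₂) = 1)
    (ha : a ≠ 0) (hM : M = r * q₁ * q₂) (hM' : M' = β * q₂ * q₁) (h : q₂ ∣ M) (h' : q₁ ∣ M') :
    circleDedekind χ₁ χ₂ h a + circleDedekind χ₂ χ₁ h' d =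
      (1 - χ₁ (d : ZMod q₁) * χ₂ (d : ZMod q₂)) *
        ((∑ n : ZMod q₁, χ₁ n * circleSawtooth (toAddCircle n)) *
        ∑ n : ZMod q₂, χ₂ n * circleSawtooth (toAddCircle n)) := by
  have : NeZero a := ⟨ha⟩
  have hcop : a.Coprime M := by
    rw [← Nat.isCoprime_iff_coprime, hM]
    exact ⟨d, s * β, by push_cast; linear_combination had⟩
  have hcop' : a.Coprime M' := by
    rw [← Nat.isCoprime_iff_coprime, hM']
    exact ⟨d, s * r, by push_cast; linear_combination had⟩
  have r1 := circleDedekind_add_dualDedekind hχ₁ hχ₂ hM (L := q₁ * a) rfl hcop h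
    (Nat.dvd_mul_right _ _)
  have r2 := circleDedekind_add_dualDedekind hχ₂ hχ₁ hM' (L := q₂ * a) rfl hcop' h'
    (Nat.dvd_mul_right _ _)
  have r3 := dualDedekind_eq (χ₁ := χ₁) (χ₂ := χ₂) ho₁ (L := q₁ * a) (L' := q₂ * a) rfl rfl hs had
    (Nat.dvd_mul_right _ _) (Nat.dvd_mul_right _ _)
  have r4 := circleDedekind_inverse (χ₁ := χ₂) (χ₂ := χ₁) ho₂ (M := M') (k := β * q₁)
    (by rw [hM']; ring) (Nat.dvd_mul_left _ _) h' (a := a) (d := d)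
    ⟨-(s * r), by rw [hM']; push_cast; linear_combination had⟩
  have u1 : χ₁ (a : ZMod q₁) * χ₁ (d : ZMod q₁) = 1 := by
    have h1 : ((a * d + s * (β * r * q₁ * q₂) : ℤ) : ZMod q₁) = 1 := by rw [had]; simp
    push_cast at h1
    simp only [ZMod.natCast_self, mul_zero, zero_mul, add_zero] at h1
    rw [← map_mul, h1, map_one]
  have u2 : χ₂ (a : ZMod q₂) * χ₂ (d : ZMod q₂) = 1 := by
    have h1 : ((a * d + s * (β * r * q₁ * q₂) : ℤ) : ZMod q₂) = 1 := by rw [had]; simp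
    push_cast at h1
    simp only [ZMod.natCast_self, mul_zero, add_zero] at h1
    rw [← map_mul, h1, map_one]
  have u3 : χ₁ (a : ZMod q₁) = χ₁ (d : ZMod q₁) := by
    have hu : IsUnit (d : ZMod q₁) := by
      by_contra hn
      rw [χ₁.map_nonunit hn, mul_zero] at u1
      exact zero_ne_one u1
    have h1 : χ₁ (d : ZMod q₁) ^ 2 = 1 := by
      rw [← MulChar.pow_apply' χ₁ two_ne_zero, h2₁, MulChar.one_apply hu]
    linear_combination χ₁ (d : ZMod q₁) * u1 - χ₁ (a : ZMod q₁) * h1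
  rw [Int.cast_natCast] at r4
  rw [r4]
  rw [r3] at r2
  set A := circleDedekind χ₁ χ₂ h a
  set B := circleDedekind χ₂ χ₁ h' a
  set D := dualDedekind χ₁ χ₂ (Nat.dvd_mul_right q₁ a) (r * q₁)
  rw [u3] at r4 u1 ⊢
  linear_combination r1 - χ₁ (d : ZMod q₁) * χ₂ (d : ZMod q₂) * r2 +
    D * (χ₁ (d : ZMod q₁) ^ 2 * u2 + u1)

lemma newformDedekindSumSL_eq_circleDedekind {M : ℕ} [NeZero q₁] [NeZero M]
    {χ₁ : DirichletCharacter ℂ q₁} {χ₂ : DirichletCharacter ℂ q₂} (h2₁ : χ₁ ^ 2 = 1)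
    (h2₂ : χ₂ ^ 2 = 1) (ho₁ : χ₁ (-1) = -1) (h : q₂ ∣ M)
    {γ : Matrix.SpecialLinearGroup (Fin 2) ℤ} (hM : M = (γ.1 1 0).natAbs) :
    newformDedekindSumSL χ₁ χ₂ γ = circleDedekind χ₁ χ₂ h (γ.1 0 0) := by
  have h0 : M ≠ 0 := NeZero.ne M
  rw [newformDedekindSumSL, if_neg (by omega)]
  split_ifs with h1
  · rw [show γ.1 1 0 = (M : ℤ) by omega, newformDedekindSum_eq_circleDedekind h2₁ h2₂ h]
  · rw [show -γ.1 1 0 = (M : ℤ) by omega, newformDedekindSum_eq_circleDedekind h2₁ h2₂ h,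
      circleDedekind_neg ho₁]

lemma circleDedekind_natAbs {M : ℕ} [NeZero q₁] [NeZero M] {χ₁ : DirichletCharacter ℂ q₁}
    {χ₂ : DirichletCharacter ℂ q₂} (ho₁ : χ₁ (-1) = -1) (h : q₂ ∣ M) (a : ℤ) :
    circleDedekind χ₁ χ₂ h a.natAbs = circleDedekind χ₁ χ₂ h a := by
  rcases Int.natAbs_eq a with e | e
  · rw [← e]
  · conv_rhs => rw [e]
    rw [circleDedekind_neg ho₁]

lemma circleDedekind_sign_mul {M : ℕ} [NeZero q₁] [NeZero M] {χ₁ : DirichletCharacter ℂ q₁}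
    {χ₂ : DirichletCharacter ℂ q₂} (ho₁ : χ₁ (-1) = -1) (h : q₂ ∣ M) {s : ℤ} (hs : s = 1 ∨ s = -1)
    (a : ℤ) : circleDedekind χ₁ χ₂ h (s * a) = circleDedekind χ₁ χ₂ h a := by
  rcases hs with rfl | rfl
  · rw [one_mul]
  · rw [neg_one_mul, circleDedekind_neg ho₁]

lemma apply_neg_of_odd {q : ℕ} {χ : DirichletCharacter ℂ q} (ho : χ (-1) = -1) (x : ZMod q) :
    χ (-x) = -χ x := by
  rw [← neg_one_mul, map_mul, ho, neg_one_mul]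

end conclusion

theorem newform_dedekind_sum_reciprocity_class_numbers {q₁ q₂ : ℕ} (hq₁ : 0 < q₁) (hq₂ : 0 < q₂)
    (χ₁ : DirichletCharacter ℂ q₁) (χ₂ : DirichletCharacter ℂ q₂)
    (hχ₁ : χ₁ ≠ 1) (hχ₂ : χ₂ ≠ 1) (hp₁ : χ₁.IsPrimitive) (hp₂ : χ₂.IsPrimitive)
    (hpar : χ₁ (-1) * χ₂ (-1) = 1)
    (hquad₁ : χ₁ ^ 2 = 1) (hquad₂ : χ₂ ^ 2 = 1)
    (hodd₁ : Odd q₁) (hodd₂ : Odd q₂) (h4₁ : 4 < q₁) (h4₂ : 4 < q₂)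
    (ho₁ : χ₁ (-1) = -1) (ho₂ : χ₂ (-1) = -1)
    (γ γ' : Matrix.SpecialLinearGroup (Fin 2) ℤ) (hγ : InGamma0 (q₁ * q₂) γ)
    (r : ℤ) (hr : 1 ≤ r) (hc : γ.1 1 0 = r * ((q₁ : ℤ) * (q₂ : ℤ)))
    (h'a : γ'.1 0 0 = γ.1 1 1) (h'b : γ'.1 0 1 = -r)
    (h'c : γ'.1 1 0 = -(γ.1 0 1) * ((q₁ : ℤ) * (q₂ : ℤ))) (h'd : γ'.1 1 1 = γ.1 0 0) :
    newformDedekindSumSL χ₁ χ₂ γ = -newformDedekindSumSL χ₂ χ₁ γ' +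
      (1 - χ₁ ((γ.1 1 1 : ℤ) : ZMod q₁) * (starRingEnd ℂ) (χ₂ ((γ.1 1 1 : ℤ) : ZMod q₂))) *
        (imagQuadClassNumber q₁ : ℂ) * (imagQuadClassNumber q₂ : ℂ) := by
  have : NeZero q₁ := ⟨hq₁.ne'⟩
  have : NeZero q₂ := ⟨hq₂.ne'⟩
  rw [conj_eq_self_of_sq_eq_one hquad₂]
  have hdet : γ.1 0 0 * γ.1 1 1 - γ.1 0 1 * γ.1 1 0 = 1 := by
    rw [← Matrix.det_fin_two]
    exact γ.2
  lift r to ℕ using by omega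
  have hr0 : r ≠ 0 := by omega
  obtain ⟨M, hM⟩ : ∃ M, M = r * q₁ * q₂ := ⟨_, rfl⟩
  have : NeZero M := ⟨by rw [hM]; exact mul_ne_zero (mul_ne_zero hr0 hq₁.ne') hq₂.ne'⟩
  have h : q₂ ∣ M := hM ▸ Nat.dvd_mul_left _ _
  rw [newformDedekindSumSL_eq_circleDedekind hquad₁ hquad₂ ho₁ h
    (by rw [hc, hM]; simp only [Int.natAbs_mul, Int.natAbs_natCast, mul_assoc])]
  rw [hc] at hdet
  generalize γ.1 0 0 = a, γ.1 0 1 = b, γ.1 1 1 = d at *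
  by_cases hb : b = 0
  · subst hb
    have h1 : circleDedekind χ₁ χ₂ h 1 = 0 := by
      have := circleDedekind_inverse (χ₁ := χ₁) (χ₂ := χ₂) ho₁ (M := M) (k := r * q₂)
        (by rw [hM]; ring) (Nat.dvd_mul_left _ _) h (a := 1) (d := 1) (by simp)
      simp only [Int.cast_one, map_one, mul_one, neg_one_mul] at this
      exact self_eq_neg.1 this
    rw [newformDedekindSumSL, if_pos (by rw [h'c]; simp)]
    have had : a * d = 1 := by linear_combination hdet
    have ha : a = 1 ∨ a = -1 := Int.isUnit_iff.1 (IsUnit.of_mul_eq_one _ had)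
    rw [← circleDedekind_natAbs ho₁ h a,
      show a.natAbs = 1 by rcases ha with rfl | rfl <;> rfl, Nat.cast_one, h1]
    rcases ha with rfl | rfl
    · rw [show d = 1 by omega]
      simp
    · rw [show d = -1 by omega]
      simp [ho₁, ho₂]
  · have ha : a ≠ 0 := by
      rintro rfl
      have h1 : (q₁ : ℤ) ∣ 1 := ⟨-(b * r * q₂), by linear_combination -hdet⟩
      have := Int.le_of_dvd one_pos h1
      omega
    obtain ⟨M', hM'⟩ : ∃ M', M' = b.natAbs * q₂ * q₁ := ⟨_, rfl⟩
    have : NeZero M' :=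
      ⟨by rw [hM']; exact mul_ne_zero (mul_ne_zero (Int.natAbs_ne_zero.2 hb) hq₂.ne') hq₁.ne'⟩
    have h' : q₁ ∣ M' := hM' ▸ Nat.dvd_mul_left _ _
    have hsign (x : ℤ) (hx : x ≠ 0) : x.sign = 1 ∨ x.sign = -1 := by
      rcases lt_or_gt_of_ne hx with h0 | h0
      · exact Or.inr (Int.sign_eq_neg_one_of_neg h0)
      · exact Or.inl (Int.sign_eq_one_of_pos h0)
    have hs : -b.sign = 1 ∨ -b.sign = -1 := by
      rcases hsign b hb with e | e <;> simp [e]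
    have had : (a.natAbs : ℤ) * (a.sign * d) +
        -b.sign * ((b.natAbs : ℤ) * (r : ℤ) * (q₁ : ℤ) * (q₂ : ℤ)) = 1 := by
      linear_combination hdet + d * Int.sign_mul_natAbs a - r * q₁ * q₂ * Int.sign_mul_natAbs b
    have key := circleDedekind_reciprocity hχ₁ hχ₂ hquad₁ ho₁ ho₂ hs had
      (Int.natAbs_ne_zero.2 ha) hM hM' h h'
    rw [circleDedekind_natAbs ho₁, circleDedekind_sign_mul ho₂ h' (hsign a ha),
      sum_mul_circleSawtooth_eq_neg_classNumber hodd₁ h4₁ hχ₁ hp₁ hquad₁ ho₁,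
      sum_mul_circleSawtooth_eq_neg_classNumber hodd₂ h4₂ hχ₂ hp₂ hquad₂ ho₂] at key
    have hψ : χ₁ ((a.sign * d : ℤ) : ZMod q₁) * χ₂ ((a.sign * d : ℤ) : ZMod q₂) =
        χ₁ (d : ZMod q₁) * χ₂ (d : ZMod q₂) := by
      rcases hsign a ha with e | e
      · rw [e, one_mul]
      · rw [e, neg_one_mul, Int.cast_neg, Int.cast_neg, apply_neg_of_odd ho₁,
          apply_neg_of_odd ho₂, neg_mul_neg]
    rw [hψ] at key
    rw [newformDedekindSumSL_eq_circleDedekind hquad₂ hquad₁ ho₂ h' (by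
      rw [h'c, hM']
      simp only [Int.natAbs_mul, Int.natAbs_neg, Int.natAbs_natCast]
      ring), h'a]
    linear_combination key
end

section
/- For every γ ∈ Γ₁(q₁q₂), the number q₂·S_{χ₁,χ₂}(γ) lies in ℤ[χ₁,χ₂]; that is, S_{χ₁,χ₂}(γ) ∈ (1/q₂)·ℤ[χ₁,χ₂]. -/
open Complex Finset
open scoped Classical

lemma sawtooth_add_int (x : ℝ) (n : ℤ) : sawtooth (x + n) = sawtooth x := by
  have h : (∃ m : ℤ, (m : ℝ) = x + n) ↔ ∃ m : ℤ, (m : ℝ) = x :=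
    ⟨fun ⟨m, hm⟩ => ⟨m - n, by push_cast; linarith⟩, fun ⟨m, hm⟩ => ⟨m + n, by push_cast; linarith⟩⟩
  unfold sawtooth
  simp only [h, Int.fract_add_intCast]

lemma sawtooth_intCast_div {c : ℕ} (hc : 0 < c) {k : ℤ} (hk : ¬ (c : ℤ) ∣ k) :
    sawtooth ((k : ℝ) / c) = (k : ℝ) / c - 1 / 2 - ((k / c : ℤ) : ℝ) := by
  have hc' : (c : ℝ) ≠ 0 := by positivity
  have hfl : ⌊(k : ℝ) / c⌋ = k / c := by
    rw [Int.floor_div_natCast, Int.floor_intCast]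
  have hint : ¬ ∃ n : ℤ, (n : ℝ) = (k : ℝ) / c := by
    rintro ⟨n, hn⟩
    rw [eq_div_iff hc'] at hn
    exact hk ⟨n, by rw [mul_comm]; exact_mod_cast hn.symm⟩
  rw [sawtooth, if_neg hint, Int.fract, hfl]
  ring

/-- Multiplication by a residue `d` invertible modulo `c` permutes the residues modulo `c`. -/
lemma sum_range_mul_left_of_periodic {c : ℕ} {a d b : ℤ} (had : a * d = 1 + b * c)
    (F : ℤ → ℂ) (hF : ∀ k l : ℤ, F (k + c * l) = F k) :
    ∑ j ∈ range c, F (d * j) = ∑ j ∈ range c, F j := by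
  have hmod : ∀ k : ℤ, F (k % c) = F k := fun k => by
    conv_rhs => rw [← Int.emod_add_mul_ediv k c]
    rw [hF]
  have hinv : ∀ u v : ℤ, u * v = 1 + b * c → ∀ j ∈ range c,
      ((u * (((v * j) % c).toNat : ℤ)) % c).toNat = j := by
    intro u v huv j hj
    have hj := mem_range.mp hj
    have hc : (c : ℤ) ≠ 0 := by omega
    rw [Int.toNat_of_nonneg (Int.emod_nonneg _ hc), Int.mul_emod, Int.emod_emod_of_dvd _ dvd_rfl,
      ← Int.mul_emod, ← mul_assoc, huv,
      show (1 + b * c) * (j : ℤ) = j + c * (b * j) by ring, Int.add_mul_emod_self_left,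
      Int.emod_eq_of_lt (by omega) (by omega)]
    simp
  have hmaps : ∀ u : ℤ, ∀ j ∈ range c, ((u * (j : ℤ)) % c).toNat ∈ range c := by
    intro u j hj
    have hj := mem_range.mp hj
    have := Int.emod_lt_of_pos (u * j) (show (0 : ℤ) < c by omega)
    rw [mem_range]
    omega
  refine sum_nbij' (fun j => ((d * (j : ℤ)) % c).toNat) (fun j => ((a * (j : ℤ)) % c).toNat)
    (hmaps d) (hmaps a) (hinv a d had) (hinv d a (by rw [mul_comm, had])) ?_
  intro j hj
  have hj := mem_range.mp hj
  rw [Int.toNat_of_nonneg (Int.emod_nonneg _ (by omega)), hmod]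

lemma sum_range_mul_eq_sum_blocks (q M : ℕ) (f : ℕ → ℂ) :
    ∑ j ∈ range (q * M), f j = ∑ m ∈ range q, ∑ i ∈ range M, f (m * M + i) := by
  induction q with
  | zero => simp
  | succ q ih => rw [add_mul, one_mul, sum_range_add, ih, sum_range_succ]

lemma sum_range_add_div {q : ℕ} (hq : 0 < q) (n : ℕ) :
    ∑ m ∈ range q, (n + m) / q = n := by
  induction n with
  | zero => exact sum_eq_zero fun m hm => by simp [mem_range.mp hm]
  | succ n ih =>
    have h1 := sum_range_succ (fun m => (n + m) / q) q
    rw [sum_range_succ' (fun m => (n + m) / q) q, Nat.add_div_right _ hq] at h1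
    simp only [add_zero] at h1
    have h2 : ∑ m ∈ range q, (n + 1 + m) / q = ∑ m ∈ range q, (n + (m + 1)) / q :=
      sum_congr rfl fun m _ => by congr 1; ring
    omega

section Character

variable {q : ℕ} (ψ : DirichletCharacter ℂ q)

lemma character_zero_of_ne_one (hψ : ψ ≠ 1) : ψ 0 = 0 := by
  refine DirichletCharacter.map_zero' ψ fun hq => hψ ?_
  subst hq
  exact DirichletCharacter.level_one ψ

lemma sum_range_character_eq_zero (hq : 0 < q) (hψ : ψ ≠ 1) :
    ∑ n ∈ range q, ψ (n : ZMod q) = 0 := by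
  have : NeZero q := ⟨hq.ne'⟩
  rw [← MulChar.sum_eq_zero_of_ne_one hψ]
  refine sum_nbij' (fun n => (n : ZMod q)) (fun x => x.val) (by simp)
    (fun x _ => mem_range.mpr x.val_lt) (fun n hn => ZMod.val_cast_of_lt (mem_range.mp hn))
    (fun x _ => ZMod.natCast_zmod_val x) (by simp)

lemma sum_range_mul_character_eq_zero (hq : 0 < q) (hψ : ψ ≠ 1) (L : ℕ) :
    ∑ n ∈ range (q * L), ψ (n : ZMod q) = 0 := by
  rw [mul_comm, sum_range_mul_eq_sum_blocks]
  simp [sum_range_character_eq_zero ψ hq hψ]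

lemma sum_range_mul_id_mul_character (hq : 0 < q) (hψ : ψ ≠ 1) (L : ℕ) :
    ∑ n ∈ range (q * L), (n : ℂ) * ψ (n : ZMod q) =
      L * ∑ n ∈ range q, (n : ℂ) * ψ (n : ZMod q) := by
  rw [mul_comm q, sum_range_mul_eq_sum_blocks]
  simp [add_mul, sum_add_distrib, ← mul_sum, sum_range_character_eq_zero ψ hq hψ]

lemma sum_range_id_mul_character_of_even (hq : 0 < q) (hψ : ψ ≠ 1) (he : ψ (-1) = 1) :
    ∑ n ∈ range q, (n : ℂ) * ψ (n : ZMod q) = 0 := by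
  have h0 := character_zero_of_ne_one ψ hψ
  have hs : ∑ n ∈ range (q + 1), (n : ℂ) * ψ (n : ZMod q) =
      ∑ n ∈ range (q + 1), (q - n : ℂ) * ψ (n : ZMod q) := by
    rw [← sum_range_reflect]
    refine sum_congr rfl fun n hn => ?_
    have hn' : n ≤ q := Nat.lt_succ_iff.mp (mem_range.mp hn)
    rw [show q + 1 - 1 - n = q - n by omega, Nat.cast_sub hn', Nat.cast_sub hn', ZMod.natCast_self,
      zero_sub, neg_eq_neg_one_mul, map_mul, he, one_mul]
  simp only [sum_range_succ, ZMod.natCast_self, h0, sub_mul, sum_sub_distrib, ← mul_sum,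
    sum_range_character_eq_zero ψ hq hψ, mul_zero, add_zero, zero_sub] at hs
  exact self_eq_neg.mp hs

lemma not_dvd_of_character_ne_zero (hψ : ψ ≠ 1) {c : ℕ} (hqc : q ∣ c) {k : ℤ}
    (hk : ψ (k : ZMod q) ≠ 0) : ¬ (c : ℤ) ∣ k := by
  intro h
  have hk0 : (k : ZMod q) = 0 := (ZMod.intCast_zmod_eq_zero_iff_dvd k q).mpr
    ((Int.natCast_dvd_natCast.mpr hqc).trans h)
  exact hk (by rw [hk0, character_zero_of_ne_one ψ hψ])

lemma sum_range_character_mul_sawtooth (hq : 0 < q) (hψ : ψ ≠ 1) {M : ℕ} (hM : 0 < M) {j : ℕ}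
    (hj : ¬ M ∣ j) :
    ∑ n ∈ range q, ψ (n : ZMod q) *
        (sawtooth ((n : ℝ) / (q : ℝ) + (j : ℝ) / ((q * M : ℕ) : ℝ)) : ℂ) =
      (∑ n ∈ range q, (n : ℂ) * ψ (n : ZMod q)) / q -
        ∑ n ∈ range q, ψ (n : ZMod q) * (((n + j / M) / q : ℕ) : ℂ) := by
  have key : ∀ n : ℕ, sawtooth ((n : ℝ) / (q : ℝ) + (j : ℝ) / ((q * M : ℕ) : ℝ)) =
      (n : ℝ) / q + (j : ℝ) / ((q * M : ℕ) : ℝ) - 1 / 2 - (((n + j / M) / q : ℕ) : ℝ) := by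
    intro n
    have hnd : ¬ (((q * M : ℕ) : ℤ) ∣ ((n * M + j : ℕ) : ℤ)) := by
      rw [Int.natCast_dvd_natCast]
      intro h
      exact hj ((Nat.dvd_add_right (dvd_mul_left M n)).mp ((dvd_mul_left M q).trans h))
    have hs := sawtooth_intCast_div (Nat.mul_pos hq hM) hnd
    have hdiv : (n * M + j) / (q * M) = (n + j / M) / q := by
      rw [mul_comm q, ← Nat.div_div_eq_div_mul, Nat.mul_comm n, Nat.mul_add_div hM]
    have hx : (((n * M + j : ℕ) : ℤ) : ℝ) / ((q * M : ℕ) : ℝ) =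
        (n : ℝ) / (q : ℝ) + (j : ℝ) / ((q * M : ℕ) : ℝ) := by
      push_cast
      field_simp
    rw [hx, ← Int.natCast_div, hdiv] at hs
    exact_mod_cast hs
  have hz := sum_range_character_eq_zero ψ hq hψ
  have hsplit : ∀ n : ℕ, ψ (n : ZMod q) *
      (sawtooth ((n : ℝ) / (q : ℝ) + (j : ℝ) / ((q * M : ℕ) : ℝ)) : ℂ) =
      (n : ℂ) * ψ (n : ZMod q) / q + ψ (n : ZMod q) * ((j : ℂ) / ((q * M : ℕ) : ℂ) - 1 / 2) -
        ψ (n : ZMod q) * (((n + j / M) / q : ℕ) : ℂ) := by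
    intro n
    rw [key]
    push_cast
    ring
  simp only [hsplit, sum_sub_distrib, sum_add_distrib, ← sum_mul, ← sum_div, hz, zero_mul, add_zero]

lemma sum_range_character_mul_add_div (hq : 0 < q) :
    ∑ m ∈ range q, ∑ n ∈ range q, ψ (n : ZMod q) * (((n + m) / q : ℕ) : ℂ) =
      ∑ n ∈ range q, (n : ℂ) * ψ (n : ZMod q) := by
  rw [sum_comm]
  refine sum_congr rfl fun n _ => ?_
  rw [← mul_sum, ← Nat.cast_sum, sum_range_add_div hq, mul_comm]

/-- The first Bernoulli-type sum attached to a nontrivial character, over a multiple of its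
modulus. -/
lemma sum_range_character_mul_sawtooth_div (hq : 0 < q) (hψ : ψ ≠ 1) {c L : ℕ} (hc : c = q * L)
    (hL : 0 < L) :
    ∑ j ∈ range c, ψ (j : ZMod q) * (sawtooth ((j : ℝ) / (c : ℝ)) : ℂ) =
      (∑ n ∈ range q, (n : ℂ) * ψ (n : ZMod q)) / q := by
  have hcpos : 0 < c := hc ▸ Nat.mul_pos hq hL
  have hterm : ∀ j ∈ range c, ψ (j : ZMod q) * (sawtooth ((j : ℝ) / (c : ℝ)) : ℂ) =
      (j : ℂ) * ψ (j : ZMod q) / c - ψ (j : ZMod q) / 2 := by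
    intro j hj
    by_cases h0 : ψ (j : ZMod q) = 0
    · simp [h0]
    have hnd : ¬ (c : ℤ) ∣ (j : ℤ) :=
      not_dvd_of_character_ne_zero ψ hψ (hc ▸ dvd_mul_right q L) (by exact_mod_cast h0)
    have hs := sawtooth_intCast_div hcpos hnd
    have hz : (j : ℤ) / (c : ℤ) = 0 := by
      exact_mod_cast Nat.div_eq_of_lt (mem_range.mp hj)
    rw [hz] at hs
    rw [Int.cast_natCast] at hs
    rw [hs]
    push_cast
    ring
  rw [sum_congr rfl hterm, sum_sub_distrib, ← sum_div, ← sum_div, hc,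
    sum_range_mul_character_eq_zero ψ hq hψ, sum_range_mul_id_mul_character ψ hq hψ]
  have : (q : ℂ) ≠ 0 := by exact_mod_cast hq.ne'
  have : (L : ℂ) ≠ 0 := by exact_mod_cast hL.ne'
  push_cast
  field_simp
  ring

end Character

/-- Evaluation of the newform Dedekind sum up to an explicit combination, with integer
coefficients, of products of values of the two conjugate characters. -/
lemma newformDedekindSum_eq {q₁ q₂ : ℕ} (hq₁ : 0 < q₁) (hq₂ : 0 < q₂)
    {χ₁ ψ₁ : DirichletCharacter ℂ q₁} {χ₂ ψ₂ : DirichletCharacter ℂ q₂}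
    (h₁ : ∀ x, (starRingEnd ℂ) (χ₁ x) = ψ₁ x) (h₂ : ∀ x, (starRingEnd ℂ) (χ₂ x) = ψ₂ x)
    (hψ₁ : ψ₁ ≠ 1) (hψ₂ : ψ₂ ≠ 1) {c L : ℕ} (hL : 0 < L) (hc : c = q₁ * (q₂ * L)) {a b d : ℤ}
    (had : a * d = 1 + b * c) :
    newformDedekindSum χ₁ χ₂ a c =
      (1 - ψ₂ (d : ZMod q₂) * d) * (∑ n ∈ range q₁, (n : ℂ) * ψ₁ (n : ZMod q₁)) *
          (∑ n ∈ range q₂, (n : ℂ) * ψ₂ (n : ZMod q₂)) / (q₁ * q₂) +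
        ∑ j ∈ range c, ψ₂ ((d * j : ℤ) : ZMod q₂) * ((d * j / c : ℤ) : ℂ) *
          ∑ n ∈ range q₁, ψ₁ (n : ZMod q₁) * (((n + j / (q₂ * L)) / q₁ : ℕ) : ℂ) := by
  have hM : 0 < q₂ * L := Nat.mul_pos hq₂ hL
  have hcpos : 0 < c := hc ▸ Nat.mul_pos hq₁ hM
  have hcR : (c : ℝ) ≠ 0 := by exact_mod_cast hcpos.ne'
  have hqc : q₂ ∣ c := ⟨q₁ * L, by rw [hc]; ring⟩
  set T₁ : ℂ := ∑ n ∈ range q₁, (n : ℂ) * ψ₁ (n : ZMod q₁) with hT₁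
  set T₂ : ℂ := ∑ n ∈ range q₂, (n : ℂ) * ψ₂ (n : ZMod q₂) with hT₂
  set A : ℕ → ℂ := fun m => ∑ n ∈ range q₁, ψ₁ (n : ZMod q₁) * (((n + m) / q₁ : ℕ) : ℂ)
  have hper : ∀ k l : ℤ, ψ₂ ((k + c * l : ℤ) : ZMod q₂) = ψ₂ (k : ZMod q₂) := by
    intro k l
    have : ((c : ℤ) : ZMod q₂) = 0 := by
      exact_mod_cast (ZMod.natCast_eq_zero_iff c q₂).mpr hqc
    rw [Int.cast_add, Int.cast_mul, this, zero_mul, add_zero]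
  have hsper : ∀ (x : ℝ) (k l : ℤ), sawtooth (x + ((k + c * l : ℤ) : ℝ) / c) =
      sawtooth (x + (k : ℝ) / c) := by
    intro x k l
    rw [← sawtooth_add_int (x + (k : ℝ) / c) l]
    congr 1
    push_cast
    field_simp
    ring
  have hsper₀ : ∀ k l : ℤ, sawtooth (((k + c * l : ℤ) : ℝ) / c) = sawtooth ((k : ℝ) / c) := by
    intro k l
    simpa using hsper 0 k l
  let G : ℤ → ℂ := fun k => ψ₂ (k : ZMod q₂) * (sawtooth ((k : ℝ) / c) : ℂ)
  let H : ℤ → ℂ := fun k => ∑ n ∈ range q₁, ψ₁ (n : ZMod q₁) *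
    (sawtooth ((n : ℝ) / (q₁ : ℝ) + (k : ℝ) / c) : ℂ)
  have hG : ∀ k l : ℤ, G (k + c * l) = G k := fun k l => by simp only [G, hper, hsper₀]
  have hH : ∀ k l : ℤ, H (k + c * l) = H k := fun k l => by simp only [H, hsper]
  have hS : newformDedekindSum χ₁ χ₂ a c = ∑ j ∈ range c, G j * H (a * j) := by
    simp only [newformDedekindSum, Int.toNat_natCast, G, H, mul_sum, h₁, h₂]
    refine sum_congr rfl fun j _ => sum_congr rfl fun n _ => ?_
    push_cast
    ring
  have hS' : newformDedekindSum χ₁ χ₂ a c = ∑ j ∈ range c, G (d * j) * H j := by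
    rw [hS, ← sum_range_mul_left_of_periodic had (fun k => G k * H (a * k))]
    · refine sum_congr rfl fun j _ => ?_
      rw [← mul_assoc a, had, show (1 + b * c) * (j : ℤ) = j + c * (b * j) by ring, hH]
    · intro k l
      rw [hG, mul_add, mul_left_comm, hH]
  have hterm : ∀ j ∈ range c, G (d * j) * H j = T₁ / q₁ * G (d * j) -
      ψ₂ (d : ZMod q₂) * (d / c * ((j : ℂ) * ψ₂ (j : ZMod q₂) * A (j / (q₂ * L))) -
        1 / 2 * (ψ₂ (j : ZMod q₂) * A (j / (q₂ * L)))) +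
      ψ₂ ((d * j : ℤ) : ZMod q₂) * ((d * j / c : ℤ) : ℂ) * A (j / (q₂ * L)) := by
    intro j _
    by_cases h0 : ψ₂ ((d * j : ℤ) : ZMod q₂) = 0
    · have h0' := h0
      rw [Int.cast_mul, map_mul, Int.cast_natCast] at h0'
      rcases mul_eq_zero.mp h0' with h | h <;> simp [G, h]
    have hs := sawtooth_intCast_div hcpos (not_dvd_of_character_ne_zero ψ₂ hψ₂ hqc h0)
    have hj0 : ψ₂ ((j : ℤ) : ZMod q₂) ≠ 0 := fun h => h0 (by rw [Int.cast_mul, map_mul, h, mul_zero])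
    have hnd : ¬ (q₂ * L) ∣ j := by
      have := not_dvd_of_character_ne_zero ψ₂ hψ₂ (dvd_mul_right q₂ L) hj0
      exact_mod_cast this
    have hHj : H j = T₁ / q₁ - A (j / (q₂ * L)) := by
      simp only [H, Int.cast_natCast, hc]
      exact sum_range_character_mul_sawtooth ψ₁ hq₁ hψ₁ hM hnd
    rw [hHj, mul_sub, mul_comm (G _), sub_add]
    congr 1
    simp only [G, hs]
    push_cast
    rw [map_mul]
    ring
  have hGsum : ∑ j ∈ range c, G (d * j) = T₂ / q₂ := by
    rw [sum_range_mul_left_of_periodic had G hG]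
    simp only [G, Int.cast_natCast]
    exact sum_range_character_mul_sawtooth_div ψ₂ hq₂ hψ₂ (L := q₁ * L) (by rw [hc]; ring)
      (Nat.mul_pos hq₁ hL)
  have hblock : ∀ m i : ℕ, i < q₂ * L → (m * (q₂ * L) + i) / (q₂ * L) = m := by
    intro m i hi
    rw [mul_comm m, Nat.mul_add_div hM, Nat.div_eq_of_lt hi, add_zero]
  have hcast : ∀ m i : ℕ, ((m * (q₂ * L) + i : ℕ) : ZMod q₂) = i := by
    intro m i
    simp
  have hAsum : ∑ m ∈ range q₁, A m = T₁ := sum_range_character_mul_add_div ψ₁ hq₁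
  have hA₀ : ∑ j ∈ range c, ψ₂ (j : ZMod q₂) * A (j / (q₂ * L)) = 0 := by
    rw [hc, sum_range_mul_eq_sum_blocks]
    refine sum_eq_zero fun m _ => ?_
    rw [sum_congr rfl fun i hi => by rw [hblock m i (mem_range.mp hi), hcast], ← sum_mul,
      sum_range_mul_character_eq_zero ψ₂ hq₂ hψ₂, zero_mul]
  have hA₁ : ∑ j ∈ range c, (j : ℂ) * ψ₂ (j : ZMod q₂) * A (j / (q₂ * L)) = L * T₂ * T₁ := by
    rw [hc, sum_range_mul_eq_sum_blocks, ← hAsum, mul_sum]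
    refine sum_congr rfl fun m _ => ?_
    rw [sum_congr rfl fun i hi => by rw [hblock m i (mem_range.mp hi), hcast], ← sum_mul]
    congr 1
    simp only [Nat.cast_add, add_mul, sum_add_distrib, ← mul_sum,
      sum_range_mul_character_eq_zero ψ₂ hq₂ hψ₂, sum_range_mul_id_mul_character ψ₂ hq₂ hψ₂,
      mul_zero, zero_add]
    rfl
  rw [hS', sum_congr rfl hterm, sum_add_distrib, sum_sub_distrib, ← mul_sum, ← mul_sum,
    sum_sub_distrib, ← mul_sum, ← mul_sum, hGsum, hA₀, hA₁]
  congr 1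
  have : (q₁ : ℂ) ≠ 0 := by exact_mod_cast hq₁.ne'
  have : (q₂ : ℂ) ≠ 0 := by exact_mod_cast hq₂.ne'
  have : (L : ℂ) ≠ 0 := by exact_mod_cast hL.ne'
  rw [hc]
  push_cast
  field_simp
  ring



/-- The ring of integers of the field generated by the values of `χ₁` and `χ₂`, as a subring
of `ℂ`. -/
noncomputable def characterIntegers {q₁ q₂ : ℕ} (χ₁ : DirichletCharacter ℂ q₁)
    (χ₂ : DirichletCharacter ℂ q₂) : Subring ℂ :=
  (Subfield.closure (Set.range (χ₁ : ZMod q₁ → ℂ) ∪ Set.range (χ₂ : ZMod q₂ → ℂ))).toSubring ⊓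
    (integralClosure ℤ ℂ).toSubring

lemma mem_characterIntegers {q₁ q₂ : ℕ} {χ₁ : DirichletCharacter ℂ q₁}
    {χ₂ : DirichletCharacter ℂ q₂} {x : ℂ} :
    x ∈ characterIntegers χ₁ χ₂ ↔ InRingOfIntegers χ₁ χ₂ x := Iff.rfl

lemma isIntegral_character_apply {q : ℕ} (hq : 0 < q) (χ : DirichletCharacter ℂ q) (x : ZMod q) :
    IsIntegral ℤ (χ x) := by
  have : NeZero q := ⟨hq.ne'⟩
  by_cases hx : IsUnit x
  · obtain ⟨u, rfl⟩ := hx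
    refine IsIntegral.of_pow (Fintype.card_pos (α := (ZMod q)ˣ)) ?_
    rw [← map_pow, ← Units.val_pow_eq_pow_val, pow_card_eq_one, Units.val_one, map_one]
    exact isIntegral_one
  · rw [χ.map_nonunit hx]
    exact isIntegral_zero

lemma inv_apply_mem_characterIntegers {q₁ q₂ : ℕ} (hq₁ : 0 < q₁) (hq₂ : 0 < q₂)
    (χ₁ : DirichletCharacter ℂ q₁) (χ₂ : DirichletCharacter ℂ q₂) :
    (∀ x, χ₁⁻¹ x ∈ characterIntegers χ₁ χ₂) ∧ ∀ x, χ₂⁻¹ x ∈ characterIntegers χ₁ χ₂ := by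
  refine ⟨fun x => ?_, fun x => ?_⟩ <;> rw [MulChar.inv_apply]
  · exact ⟨Subfield.subset_closure (Or.inl ⟨_, rfl⟩), isIntegral_character_apply hq₁ χ₁ _⟩
  · exact ⟨Subfield.subset_closure (Or.inr ⟨_, rfl⟩), isIntegral_character_apply hq₂ χ₂ _⟩

/-- If `γ ∈ Γ₁(q₁q₂) ∪ -Γ₁(q₁q₂)` has positive lower-left entry, its newform Dedekind sum is an
algebraic integer of `ℚ(χ₁, χ₂)`. -/
lemma newformDedekindSum_mem_characterIntegers {q₁ q₂ : ℕ} (hq₁ : 0 < q₁) (hq₂ : 0 < q₂)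
    {χ₁ : DirichletCharacter ℂ q₁} {χ₂ : DirichletCharacter ℂ q₂} (hχ₁ : χ₁ ≠ 1) (hχ₂ : χ₂ ≠ 1)
    {a b c d : ℤ} (hc : 0 < c) (hqc : ((q₁ * q₂ : ℕ) : ℤ) ∣ c) (had : a * d = 1 + b * c)
    (hd : ((q₁ * q₂ : ℕ) : ℤ) ∣ d - 1 ∨ ((q₁ * q₂ : ℕ) : ℤ) ∣ -d - 1) :
    newformDedekindSum χ₁ χ₂ a c ∈ characterIntegers χ₁ χ₂ := by
  have : NeZero q₁ := ⟨hq₁.ne'⟩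
  have : NeZero q₂ := ⟨hq₂.ne'⟩
  lift c to ℕ using hc.le
  obtain ⟨L, hL⟩ := Int.natCast_dvd_natCast.mp hqc
  have hcL : c = q₁ * (q₂ * L) := by rw [hL, mul_assoc]
  have hLpos : 0 < L := Nat.pos_of_ne_zero fun h => by simp [hL, h] at hc
  obtain ⟨hm₁, hm₂⟩ := inv_apply_mem_characterIntegers hq₁ hq₂ χ₁ χ₂
  have hψ₂ : χ₂⁻¹ ≠ 1 := inv_ne_one.mpr hχ₂
  rw [newformDedekindSum_eq hq₁ hq₂ (MulChar.star_apply' χ₁) (MulChar.star_apply' χ₂)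
    (inv_ne_one.mpr hχ₁) hψ₂ hLpos hcL had]
  have hT₁ : ∑ n ∈ range q₁, (n : ℂ) * χ₁⁻¹ (n : ZMod q₁) ∈ characterIntegers χ₁ χ₂ :=
    sum_mem fun n _ => mul_mem (natCast_mem _ n) (hm₁ _)
  have hT₂ : ∑ n ∈ range q₂, (n : ℂ) * χ₂⁻¹ (n : ZMod q₂) ∈ characterIntegers χ₁ χ₂ :=
    sum_mem fun n _ => mul_mem (natCast_mem _ n) (hm₂ _)
  refine add_mem ?_ (sum_mem fun j _ => mul_mem (mul_mem (hm₂ _) (intCast_mem _ _))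
    (sum_mem fun n _ => mul_mem (hm₁ _) (natCast_mem _ _)))
  have hone : ∀ e : ℤ, ((q₁ * q₂ : ℕ) : ℤ) ∣ e - 1 → (e : ZMod q₂) = 1 := by
    intro e he
    have h := (ZMod.intCast_zmod_eq_zero_iff_dvd (e - 1) q₂).mpr
      ((Int.natCast_dvd_natCast.mpr (dvd_mul_left q₂ q₁)).trans he)
    rw [Int.cast_sub, Int.cast_one] at h
    exact sub_eq_zero.mp h
  have hcase : ∑ n ∈ range q₂, (n : ℂ) * χ₂⁻¹ (n : ZMod q₂) = 0 ∨
      ∃ k : ℤ, 1 - χ₂⁻¹ (d : ZMod q₂) * d = (q₁ * q₂ : ℂ) * k := by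
    rcases hd with hd | hd
    · obtain ⟨k, hk⟩ := hd
      refine Or.inr ⟨-k, ?_⟩
      have hk' : (d : ℂ) = 1 + q₁ * q₂ * k := by
        have : d = 1 + q₁ * q₂ * k := by push_cast at hk; linarith
        exact_mod_cast congrArg (Int.cast : ℤ → ℂ) this
      rw [hone d ⟨k, hk⟩, map_one, hk']
      push_cast
      ring
    · have hsq : χ₂⁻¹ (-1) * χ₂⁻¹ (-1) = 1 := by rw [← map_mul, neg_one_mul, neg_neg, map_one]
      rcases mul_self_eq_one_iff.mp hsq with he | ho
      · exact Or.inl (sum_range_id_mul_character_of_even _ hq₂ hψ₂ he)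
      · have hd' := hone (-d) hd
        obtain ⟨k, hk⟩ := hd
        refine Or.inr ⟨-k, ?_⟩
        have hk' : (d : ℂ) = -1 - q₁ * q₂ * k := by
          have : d = -1 - q₁ * q₂ * k := by push_cast at hk; linarith
          exact_mod_cast congrArg (Int.cast : ℤ → ℂ) this
        rw [show (d : ZMod q₂) = -1 by rw [← hd']; simp, ho, hk']
        push_cast
        ring
  rcases hcase with h | ⟨k, hk⟩
  · rw [h, mul_zero, zero_div]
    exact zero_mem _
  · have h₁ : (q₁ : ℂ) ≠ 0 := by exact_mod_cast hq₁.ne'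
    have h₂ : (q₂ : ℂ) ≠ 0 := by exact_mod_cast hq₂.ne'
    rw [hk, mul_assoc, mul_assoc, mul_div_cancel_left₀ _ (mul_ne_zero h₁ h₂)]
    exact mul_mem (intCast_mem _ k) (mul_mem hT₁ hT₂)

theorem newform_dedekind_sum_gamma1_denominator_q2 {q₁ q₂ : ℕ} (hq₁ : 0 < q₁) (hq₂ : 0 < q₂)
    (χ₁ : DirichletCharacter ℂ q₁) (χ₂ : DirichletCharacter ℂ q₂)
    (hχ₁ : χ₁ ≠ 1) (hχ₂ : χ₂ ≠ 1) (hp₁ : χ₁.IsPrimitive) (hp₂ : χ₂.IsPrimitive)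
    (hpar : χ₁ (-1) * χ₂ (-1) = 1) :
    ∀ γ : Matrix.SpecialLinearGroup (Fin 2) ℤ, InGamma1 (q₁ * q₂) γ →
      InRingOfIntegers χ₁ χ₂ ((q₂ : ℂ) * newformDedekindSumSL χ₁ χ₂ γ) := by
  intro γ ⟨hc, _, hd⟩
  rw [← mem_characterIntegers]
  refine mul_mem (natCast_mem _ q₂) ?_
  have hdet : γ.1 0 0 * γ.1 1 1 - γ.1 0 1 * γ.1 1 0 = 1 := by
    rw [← Matrix.det_fin_two, γ.2]
  unfold InGamma0 at hc
  unfold newformDedekindSumSL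
  split_ifs with h0 h1
  · exact zero_mem _
  · exact newformDedekindSum_mem_characterIntegers hq₁ hq₂ hχ₁ hχ₂ (b := γ.1 0 1) (d := γ.1 1 1)
      (by omega) hc (by linarith) (Or.inl hd)
  · exact newformDedekindSum_mem_characterIntegers hq₁ hq₂ hχ₁ hχ₂ (b := -γ.1 0 1)
      (d := -γ.1 1 1) (by omega) (Int.dvd_neg.mpr hc) (by linarith) (Or.inr (by rwa [neg_neg]))
end
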